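/- (Restriction-type estimate for the spectral measure of P(D).) For λ > 0 let Σ_λ = {ξ ∈ ℝⁿ : P(ξ) = λ}, let σ denote the (n−1)-dimensional Hausdorff measure on Σ_λ, and define the operator A_λ on Schwartz functions by A_λ f(x) = (2π)^{−n} ∫_{Σ_λ} e^{ix·ξ} f̂(ξ) |∇P(ξ)|^{−1} dσ(ξ). Let 1 ≤ p, q ≤ ∞ satisfy min(1/p − 1/2, 1/2 − 1/q) > 1/(2n) and 2/(n+1) < 1/p − 1/q. Then there is a constant C such that for every λ > 0 and every Schwartz function f, ‖A_λ f‖_{L^q} ≤ C λ^{(n/m)(1/p−1/q) − 1} ‖f‖_{L^p}. -/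

import Mathlib

open MeasureTheory Complex
open scoped ENNReal RealInnerProductSpace

noncomputable section

/-- The Fourier transform `f̂(ξ) = ∫ e^{−ix·ξ} f(x) dx`. -/
def FT {n : ℕ} (f : EuclideanSpace ℝ (Fin n) → ℂ) (ξ : EuclideanSpace ℝ (Fin n)) : ℂ :=
  ∫ x, Complex.exp (-Complex.I * (⟪x, ξ⟫ : ℂ)) * f x

/-- The inverse Fourier transform `𝓕⁻¹g(x) = (2π)^{−n} ∫ e^{ix·ξ} g(ξ) dξ`. -/
def IFT {n : ℕ} (g : EuclideanSpace ℝ (Fin n) → ℂ) (x : EuclideanSpace ℝ (Fin n)) : ℂ :=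
  (((2 * Real.pi) ^ n : ℝ) : ℂ)⁻¹ * ∫ ξ, Complex.exp (Complex.I * (⟪x, ξ⟫ : ℂ)) * g ξ

/-- The determinant of the Hessian matrix `(∂²f/∂ξᵢ∂ξⱼ)` of `f` at `ξ`. -/
def HessDet {n : ℕ} (f : EuclideanSpace ℝ (Fin n) → ℝ) (ξ : EuclideanSpace ℝ (Fin n)) : ℝ :=
  Matrix.det (Matrix.of fun i j : Fin n =>
    fderiv ℝ (fun y => fderiv ℝ f y (EuclideanSpace.single j 1)) ξ (EuclideanSpace.single i 1))

section

theorem osc_nonstat {E F : Type*} [NormedAddCommGroup E] [NormedSpace ℝ E] [FiniteDimensional ℝ E]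
    [MeasurableSpace E] [BorelSpace E] [NormedAddCommGroup F] [NormedSpace ℝ F]
    (μ : Measure E) [μ.IsAddHaarMeasure]
    (K : Set E) (hK : IsCompact K) (Kp : Set F) (hKp : IsCompact Kp)
    (φ : F → E → ℝ) (hφ : ∀ p ∈ Kp, ContDiff ℝ (⊤ : ℕ∞) (φ p))
    (ρ : F → ℝ) (v : F → E) (hv : ContDiff ℝ (⊤ : ℕ∞) v)
    (e : E × F → ℝ) (he : ContDiff ℝ (⊤ : ℕ∞) e)
    (hder : ∀ p ∈ Kp, ∀ y ∈ K, e (y,p) * fderiv ℝ (φ p) y (v p) = ρ p) (k : ℕ) :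
    ∀ a : E × F → ℂ, ContDiff ℝ (⊤ : ℕ∞) a → (∀ y p, y ∉ K → p ∈ Kp → a (y,p) = 0) →
      ∃ C, 0 ≤ C ∧ ∀ p ∈ Kp, 0 < ρ p → ∀ N : ℝ, 0 < N →
        ‖∫ y, cexp (I * ((N * φ p y : ℝ) : ℂ)) * a (y,p) ∂μ‖ ≤ C * ((N * ρ p)⁻¹) ^ k := by
  induction k with
  | zero =>
    intro a ha hsupp
    obtain ⟨C, hC⟩ := (hK.prod hKp).exists_bound_of_continuousOn ha.continuous.continuousOn
    refine ⟨|C| * (μ K).toReal, by positivity, fun p hp _ N _ => ?_⟩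
    have h1 : ∫ y, cexp (I * ((N * φ p y : ℝ) : ℂ)) * a (y,p) ∂μ
        = ∫ y in K, cexp (I * ((N * φ p y : ℝ) : ℂ)) * a (y,p) ∂μ := by
      symm
      apply setIntegral_eq_integral_of_forall_compl_eq_zero
      intro y hy
      rw [hsupp y p hy hp, mul_zero]
    rw [h1, pow_zero, mul_one]
    refine norm_setIntegral_le_of_norm_le_const hK.measure_lt_top ?_
    intro y hy
    rw [norm_mul, mul_comm I, Complex.norm_exp_ofReal_mul_I, one_mul]
    exact (hC (y,p) ⟨hy, hp⟩).trans (le_abs_self C)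
  | succ k ih =>
    intro a ha hsupp
    have hae : ContDiff ℝ (⊤ : ℕ∞) (fun x : E × F => a x * (e x : ℂ)) :=
      ha.mul (Complex.ofRealCLM.contDiff.comp he)
    set a1 : E × F → ℂ := fun x => fderiv ℝ (fun x : E × F => a x * (e x : ℂ)) x (v x.2, 0) with ha1
    have ha1s : ContDiff ℝ (⊤ : ℕ∞) a1 := by
      apply ContDiff.clm_apply
      · exact hae.fderiv_right (by simp)
      · exact (hv.comp contDiff_snd).prodMk contDiff_const
    have hslice : ∀ p y, HasFDerivAt (fun y => a (y,p) * (e (y,p) : ℂ))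
        ((fderiv ℝ (fun x : E × F => a x * (e x : ℂ)) (y,p)).comp (ContinuousLinearMap.inl ℝ E F)) y := by
      intro p y
      have h1 : HasFDerivAt (fun x : E × F => a x * (e x : ℂ)) _ (y,p) :=
        (hae.differentiable (by simp) (y,p)).hasFDerivAt
      exact HasFDerivAt.comp (f := fun y : E => (y, p)) y h1 (hasFDerivAt_prodMk_left y p)
    have ha1' : ∀ p y, a1 (y,p) = fderiv ℝ (fun y => a (y,p) * (e (y,p) : ℂ)) y (v p) := by
      intro p y
      rw [(hslice p y).fderiv]
      simp [ha1]
    have hsupp1 : ∀ y p, y ∉ K → p ∈ Kp → a1 (y,p) = 0 := by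
      intro y p hy hp
      rw [ha1']
      have : (fun y => a (y,p) * (e (y,p) : ℂ)) =ᶠ[nhds y] fun _ => 0 := by
        filter_upwards [hK.isClosed.isOpen_compl.mem_nhds hy] with z hz
        rw [hsupp z p hz hp, zero_mul]
      rw [this.fderiv_eq]
      simp
    obtain ⟨C, hC0, hC⟩ := ih a1 ha1s hsupp1
    refine ⟨C, hC0, fun p hp hρ N hN => ?_⟩
    have hφd := hφ p hp
    set f : E → ℂ := fun y => cexp (I * ((N * φ p y : ℝ) : ℂ)) with hf
    have hfs : ContDiff ℝ (⊤ : ℕ∞) f :=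
      (contDiff_const.mul (Complex.ofRealCLM.contDiff.comp (contDiff_const.mul hφd))).cexp
    have hfd : ∀ y, fderiv ℝ f y (v p) = I * N * (fderiv ℝ (φ p) y (v p) : ℝ) * f y := by
      intro y
      have h1 : HasFDerivAt (φ p) _ y := (hφd.differentiable (by simp) y).hasFDerivAt
      have h2 := ((HasFDerivAt.comp y (Complex.ofRealCLM.hasFDerivAt) (h1.const_mul N)).const_mul I).cexp
      simp only [Function.comp_def, Complex.ofRealCLM_apply] at h2
      rw [hf, h2.fderiv]
      simp
      ring
    set g : E → ℂ := fun y => a (y,p) * (e (y,p) : ℂ) with hg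
    have hgs : ContDiff ℝ (⊤ : ℕ∞) g := hae.comp (contDiff_id.prodMk contDiff_const)
    have hg0 : ∀ y, y ∉ K → g y = 0 := fun y hy => by simp [hg, hsupp y p hy hp]
    have hgc : HasCompactSupport g := HasCompactSupport.intro hK hg0
    have hg'c : HasCompactSupport (fun y => fderiv ℝ g y (v p)) := by
      refine HasCompactSupport.intro hK fun y hy => ?_
      rw [← ha1' p y]; exact hsupp1 y p hy hp
    have hibp := integral_mul_fderiv_eq_neg_fderiv_mul_of_integrable (μ := μ) (f := f) (g := g)
      (v := v p) ?_ ?_ ?_ (fun x _ => hfs.differentiable (by simp) x)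
      (fun x _ => hgs.differentiable (by simp) x)
    rotate_left
    · apply Continuous.integrable_of_hasCompactSupport
      · exact ((hfs.continuous_fderiv (by simp)).clm_apply continuous_const).mul hgs.continuous
      · exact hgc.mul_left
    · apply Continuous.integrable_of_hasCompactSupport
      · exact hfs.continuous.mul ((hgs.continuous_fderiv (by simp)).clm_apply continuous_const)
      · exact hg'c.mul_left
    · apply Continuous.integrable_of_hasCompactSupport
      · exact hfs.continuous.mul hgs.continuous
      · exact hgc.mul_left
    have h3 : ∫ y, fderiv ℝ f y (v p) * g y ∂μ = I * (N * ρ p : ℝ) * ∫ y, f y * a (y,p) ∂μ := by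
      rw [← integral_const_mul]
      congr 1
      ext y
      rw [hfd]
      by_cases hy : y ∈ K
      · have := hder p hp y hy
        rw [← this]
        simp only [hg]
        push_cast
        ring
      · simp [hg, hsupp y p hy hp]
    have h4 : ∫ y, f y * fderiv ℝ g y (v p) ∂μ = ∫ y, f y * a1 (y,p) ∂μ := by
      congr 1; ext y; rw [ha1']
    rw [h3, h4] at hibp
    have h5 := hC p hp hρ N hN
    have hNρ : 0 < N * ρ p := mul_pos hN hρ
    have h6 : ‖∫ y, f y * a1 (y,p) ∂μ‖ = (N * ρ p) * ‖∫ y, f y * a (y,p) ∂μ‖ := by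
      rw [hibp, norm_neg, norm_mul, norm_mul, Complex.norm_I, one_mul, Complex.norm_real,
        Real.norm_of_nonneg hNρ.le]
    have h7 : (N * ρ p) * ‖∫ y, f y * a (y,p) ∂μ‖ ≤ C * ((N * ρ p)⁻¹) ^ k := h6 ▸ h5
    calc ‖∫ y, f y * a (y,p) ∂μ‖ = (N * ρ p)⁻¹ * ((N * ρ p) * ‖∫ y, f y * a (y,p) ∂μ‖) := by
          field_simp
      _ ≤ (N * ρ p)⁻¹ * (C * ((N * ρ p)⁻¹) ^ k) := by gcongr
      _ = _ := by ring

end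

section

theorem contDiff_param_integral {P : Type*} [NormedAddCommGroup P] [NormedSpace ℝ P]
    (G : P × ℝ → ℝ) (hG : ContDiff ℝ (⊤ : ℕ∞) G) :
    ContDiff ℝ (⊤ : ℕ∞) (fun p => ∫ τ in (0:ℝ)..1, G (p, τ)) := by
  let χ : ContDiffBump (0 : ℝ) := ⟨2, 3, by norm_num, by norm_num⟩
  have h := contDiffOn_convolution_right_with_param_comp (μ := (volume : Measure ℝ))
    (n := (⊤ : ℕ∞)) (ContinuousLinearMap.mul ℝ ℝ)
    (s := (Set.univ : Set P)) (v := fun _ => (0:ℝ)) contDiffOn_const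
    (f := Set.indicator (Set.Ioc (0:ℝ) 1) (fun _ => (1:ℝ)))
    (g := fun p x => χ x * G (p, -x)) (k := Metric.closedBall 0 3)
    isOpen_univ (isCompact_closedBall _ _) ?_ ?_ ?_
  · rw [contDiffOn_univ] at h
    convert h using 2 with p
    rw [convolution_def, intervalIntegral.integral_of_le zero_le_one,
      ← integral_indicator measurableSet_Ioc]
    congr 1
    ext t
    by_cases ht : t ∈ Set.Ioc (0:ℝ) 1
    · have : χ (-t) = 1 := by
        apply χ.one_of_mem_closedBall
        simp only [Metric.mem_closedBall, dist_zero_right, norm_neg, Real.norm_eq_abs]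
        rw [abs_of_pos ht.1]
        exact ht.2.trans (by norm_num [χ])
      simp [ht, this]
    · simp [ht]
  · intro p x _ hx
    have : χ x = 0 := by
      apply χ.zero_of_le_dist
      simp only [Metric.mem_closedBall, not_le] at hx
      exact hx.le
    simp [this]
  · exact (integrable_indicator_iff measurableSet_Ioc).2 (by simp) |>.locallyIntegrable
  · apply ContDiff.contDiffOn
    have h1 : ContDiff ℝ (⊤ : ℕ∞) (fun x => χ x) := χ.contDiff
    exact (h1.comp contDiff_snd).mul (hG.comp (contDiff_fst.prodMk contDiff_snd.neg))

theorem exists_smooth_inv (c : ℝ) (hc : 0 < c) :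
    ∃ κ : ℝ → ℝ, ContDiff ℝ (⊤ : ℕ∞) κ ∧ ∀ x, c ≤ x → κ x * x = 1 := by
  refine ⟨fun x => Real.smoothTransition (2 * x / c - 1) / x, ?_, ?_⟩
  · rw [contDiff_iff_contDiffAt]
    intro x
    by_cases hx : 0 < x
    · apply ContDiffAt.div
      · exact (Real.smoothTransition.contDiff.comp (by fun_prop)).contDiffAt
      · exact contDiffAt_id
      · exact hx.ne'
    · have : (fun x => Real.smoothTransition (2 * x / c - 1) / x) =ᶠ[nhds x] fun _ => 0 := by
        filter_upwards [Iio_mem_nhds (show x < c / 2 by linarith)] with y hy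
        rw [Real.smoothTransition.zero_of_nonpos, zero_div]
        have : 2 * y / c ≤ 1 := by
          rw [div_le_one hc]; have := Set.mem_Iio.1 hy; linarith
        linarith
      exact contDiffAt_const.congr_of_eventuallyEq this
  · intro x hx
    have hx0 : 0 < x := hc.trans_le hx
    show Real.smoothTransition (2 * x / c - 1) / x * x = 1
    rw [Real.smoothTransition.one_of_one_le, one_div, inv_mul_cancel₀ hx0.ne']
    have : 2 ≤ 2 * x / c := by rw [le_div_iff₀ hc]; linarith
    linarith

section
variable {E : Type*} [NormedAddCommGroup E] [NormedSpace ℝ E] [FiniteDimensional ℝ E]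
    [MeasurableSpace E] [BorelSpace E]

theorem osc_ftc (Φ : E → ℝ) (hΦ : ContDiff ℝ (⊤ : ℕ∞) Φ) (T : E →L[ℝ] E) (y : E) (ρ : ℝ) (θ : E) :
    fderiv ℝ Φ (y + ρ • θ) (T θ) - fderiv ℝ Φ y (T θ) =
      ρ * ∫ τ in (0:ℝ)..1, fderiv ℝ (fderiv ℝ Φ) (y + (τ * ρ) • θ) θ (T θ) := by
  have hΦ1 : ContDiff ℝ (⊤ : ℕ∞) (fderiv ℝ Φ) := hΦ.fderiv_right (by simp)
  have hΦ2 : ContDiff ℝ (⊤ : ℕ∞) (fderiv ℝ (fderiv ℝ Φ)) := hΦ1.fderiv_right (by simp)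
  have h1 : ∀ τ : ℝ, HasDerivAt (fun τ : ℝ => fderiv ℝ Φ (y + (τ * ρ) • θ) (T θ))
      (ρ * fderiv ℝ (fderiv ℝ Φ) (y + (τ * ρ) • θ) θ (T θ)) τ := by
    intro τ
    have h2 : HasFDerivAt (fderiv ℝ Φ) (fderiv ℝ (fderiv ℝ Φ) (y + (τ * ρ) • θ)) (y + (τ * ρ) • θ) :=
      (hΦ1.differentiable (by simp) _).hasFDerivAt
    have h3 : HasDerivAt (fun τ : ℝ => y + (τ * ρ) • θ) (ρ • θ) τ := by
      have := (((hasDerivAt_id τ).mul_const ρ).smul_const θ).const_add y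
      simpa using this
    have h4 := (ContinuousLinearMap.apply ℝ ℝ (T θ)).hasFDerivAt.comp_hasDerivAt τ
      (h2.comp_hasDerivAt τ h3)
    have h7 : ((ContinuousLinearMap.apply ℝ ℝ) (T θ)) ((fderiv ℝ (fderiv ℝ Φ) (y + (τ * ρ) • θ)) (ρ • θ))
        = ρ * fderiv ℝ (fderiv ℝ Φ) (y + (τ * ρ) • θ) θ (T θ) := by
      rw [ContinuousLinearMap.apply_apply, ContinuousLinearMap.map_smul]
      rfl
    rw [h7] at h4
    exact h4
  have h5 := intervalIntegral.integral_eq_sub_of_hasDerivAt (a := 0) (b := 1) (fun τ _ => h1 τ) (by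
    apply Continuous.intervalIntegrable
    apply continuous_const.mul
    have h6 : Continuous (fun τ : ℝ => fderiv ℝ (fderiv ℝ Φ) (y + (τ * ρ) • θ)) :=
      hΦ2.continuous.comp (by fun_prop)
    exact (h6.clm_apply continuous_const).clm_apply continuous_const)
  simp only [one_mul, zero_mul, zero_smul, add_zero] at h5
  rw [← h5, intervalIntegral.integral_const_mul]

set_option maxHeartbeats 1000000 in
/-- autocorrelation bound, small support -/
theorem osc_local_aux (μ : Measure E) [μ.IsAddHaarMeasure] (Φ : E → ℝ)
    (hΦ : ContDiff ℝ (⊤ : ℕ∞) Φ) (y0 : E) (T : E →L[ℝ] E)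
    (hT : ∀ h, h ≠ 0 → 0 < fderiv ℝ (fderiv ℝ Φ) y0 h (T h)) (k : ℕ) :
    ∃ r > 0, ∀ a : E → ℂ, ContDiff ℝ (⊤ : ℕ∞) a → (∀ y, y ∉ Metric.closedBall y0 r → a y = 0) →
      ∃ C, 0 ≤ C ∧ ∀ h : E, h ≠ 0 → ∀ N : ℝ, 0 < N →
        ‖∫ y, cexp (I * ((N * (Φ (y + h) - Φ y) : ℝ) : ℂ)) * (a (y + h) * (starRingEnd ℂ) (a y)) ∂μ‖
          ≤ C * ((N * ‖h‖)⁻¹) ^ k := by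
  have hΦ1 : ContDiff ℝ (⊤ : ℕ∞) (fderiv ℝ Φ) := hΦ.fderiv_right (by simp)
  have hΦ2 : ContDiff ℝ (⊤ : ℕ∞) (fderiv ℝ (fderiv ℝ Φ)) := hΦ1.fderiv_right (by simp)
  set H : E × E → ℝ := fun x => fderiv ℝ (fderiv ℝ Φ) x.1 x.2 (T x.2) with hH
  have hHs : ContDiff ℝ (⊤ : ℕ∞) H :=
    ((hΦ2.comp contDiff_fst).clm_apply contDiff_snd).clm_apply (T.contDiff.comp contDiff_snd)
  have hsph : IsCompact (Metric.sphere (0:E) 1) := isCompact_sphere 0 1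
  obtain ⟨U, V, hU, hV, hyU, hSV, hUV⟩ := generalized_tube_lemma (isCompact_singleton (x := y0)) hsph
    (n := {x | 0 < H x}) (isOpen_lt continuous_const hHs.continuous) (by
      rintro ⟨y, θ⟩ ⟨hy, hθ⟩
      simp only [Set.mem_singleton_iff] at hy
      subst hy
      apply hT
      rintro rfl
      simp at hθ)
  obtain ⟨r0, hr0, hball⟩ := Metric.nhds_basis_closedBall.mem_iff.1
    (hU.mem_nhds (hyU (Set.mem_singleton y0)))
  have hcomp : IsCompact (Metric.closedBall y0 r0 ×ˢ Metric.sphere (0:E) 1) :=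
    (isCompact_closedBall y0 r0).prod hsph
  obtain ⟨c, hc, hcH⟩ := hcomp.exists_forall_le' (f := H) (a := 0) hHs.continuous.continuousOn
    (fun x hx => hUV ⟨hball hx.1, hSV hx.2⟩)
  obtain ⟨κ, hκs, hκ⟩ := exists_smooth_inv c hc
  refine ⟨r0 / 4, by positivity, fun a ha hsupp => ?_⟩
  set r := r0 / 4 with hr
  have hrpos : 0 < r := by positivity
  set b : E × (ℝ × E) → ℝ := fun x =>
    ∫ τ in (0:ℝ)..1, H (x.1 + (τ * x.2.1) • x.2.2, x.2.2) with hb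
  have hbs : ContDiff ℝ (⊤ : ℕ∞) b := by
    apply contDiff_param_integral (fun q : (E × (ℝ × E)) × ℝ =>
      H (q.1.1 + (q.2 * q.1.2.1) • q.1.2.2, q.1.2.2))
    apply hHs.comp
    fun_prop
  have hlow : ∀ y ∈ Metric.closedBall y0 r, ∀ ρ ∈ Set.Icc (0:ℝ) (2*r),
      ∀ θ ∈ Metric.sphere (0:E) 1, c ≤ b (y, (ρ, θ)) := by
    intro y hy ρ hρ θ hθ
    have h1 : ∫ τ in (0:ℝ)..1, c = c := by simp
    rw [← h1]
    apply intervalIntegral.integral_mono_on zero_le_one (by simp)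
    · apply Continuous.intervalIntegrable
      apply hHs.continuous.comp
      fun_prop
    · intro τ hτ
      apply hcH
      refine ⟨?_, hθ⟩
      simp only [Metric.mem_closedBall, dist_eq_norm, mem_sphere_iff_norm, sub_zero] at hy hθ ⊢
      calc ‖y + (τ * ρ) • θ - y0‖ = ‖(y - y0) + (τ * ρ) • θ‖ := by congr 1; abel
        _ ≤ ‖y - y0‖ + ‖(τ * ρ) • θ‖ := norm_add_le _ _
        _ ≤ r + 1 * (2 * r) := by
          rw [norm_smul, hθ, mul_one, Real.norm_of_nonneg (mul_nonneg hτ.1 hρ.1)]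
          gcongr
          · exact hρ.1
          · exact hτ.2
          · exact hρ.2
        _ ≤ r0 := by rw [hr]; linarith
  have hftc : ∀ y ρ θ, fderiv ℝ Φ (y + ρ • θ) (T θ) - fderiv ℝ Φ y (T θ) = ρ * b (y, (ρ, θ)) := by
    intro y ρ θ
    exact osc_ftc Φ hΦ T y ρ θ
  have key := osc_nonstat μ (Metric.closedBall y0 r) (isCompact_closedBall y0 r)
    (Set.Icc (0:ℝ) (2*r) ×ˢ Metric.sphere (0:E) 1) (isCompact_Icc.prod hsph)
    (fun p y => Φ (y + p.1 • p.2) - Φ y) (fun p _ => (hΦ.comp (by fun_prop)).sub hΦ)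
    (fun p => p.1) (fun p => T p.2) (T.contDiff.comp contDiff_snd)
    (fun x => κ (b x)) (hκs.comp hbs) (by
      rintro ⟨ρ, θ⟩ ⟨hρ, hθ⟩ y hy
      have h1 : HasFDerivAt (fun y => Φ (y + ρ • θ) - Φ y)
          (fderiv ℝ Φ (y + ρ • θ) - fderiv ℝ Φ y) y := by
        apply HasFDerivAt.sub
        · have h2 : HasFDerivAt Φ _ (y + ρ • θ) := (hΦ.differentiable (by simp) _).hasFDerivAt
          exact (hasFDerivAt_comp_add_right _).2 h2
        · exact (hΦ.differentiable (by simp) _).hasFDerivAt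
      simp only
      rw [h1.fderiv, _root_.sub_apply, hftc, mul_left_comm, hκ _ (hlow y hy ρ hρ θ hθ),
        mul_one]) k
    (fun x => a (x.1 + x.2.1 • x.2.2) * (starRingEnd ℂ) (a x.1)) (by
      apply ContDiff.mul
      · apply ha.comp; fun_prop
      · exact Complex.conjCLE.contDiff.comp (ha.comp contDiff_fst)) (by
      intro y p hy _
      simp [hsupp y hy])
  obtain ⟨C, hC0, hC⟩ := key
  refine ⟨C, hC0, fun h hh N hN => ?_⟩
  have hhn : 0 < ‖h‖ := norm_pos_iff.2 hh
  by_cases hh2 : ‖h‖ ≤ 2 * r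
  · have h1 := hC (‖h‖, ‖h‖⁻¹ • h) ⟨⟨hhn.le, hh2⟩, by simp [norm_smul, hhn.ne']⟩ hhn N hN
    simpa only [smul_smul, mul_inv_cancel₀ hhn.ne', one_smul] using h1
  · have h0 : ∀ y, a (y + h) * (starRingEnd ℂ) (a y) = 0 := by
      intro y
      by_cases hy : y ∈ Metric.closedBall y0 r
      · rw [hsupp (y + h), zero_mul]
        intro hy2
        apply hh2
        simp only [Metric.mem_closedBall, dist_eq_norm] at hy hy2
        calc ‖h‖ = ‖(y + h - y0) - (y - y0)‖ := by congr 1; abel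
          _ ≤ ‖y + h - y0‖ + ‖y - y0‖ := norm_sub_le _ _
          _ ≤ 2 * r := by linarith
      · rw [hsupp y hy]; simp
    simp only [h0, mul_zero, integral_zero, norm_zero]
    positivity
end

end

section

section
variable {E : Type*} [NormedAddCommGroup E] [NormedSpace ℝ E] [FiniteDimensional ℝ E]
    [MeasurableSpace E] [BorelSpace E]

theorem osc_sq (μ : Measure E) [μ.IsAddHaarMeasure] (F : E → ℂ) (hF : Continuous F)
    (hFc : HasCompactSupport F) (J : E → ℝ) (hJ : Integrable J μ)
    (hJb : ∀ h, ‖∫ y, F (y + h) * (starRingEnd ℂ) (F y) ∂μ‖ ≤ J h) :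
    ‖∫ y, F y ∂μ‖ ^ 2 ≤ ∫ h, J h ∂μ := by
  have h1 : ((‖∫ y, F y ∂μ‖ ^ 2 : ℝ) : ℂ) = ∫ h, ∫ y, F (y + h) * (starRingEnd ℂ) (F y) ∂μ ∂μ := by
    have hsw := integral_integral_swap_of_hasCompactSupport (μ := μ) (ν := μ)
      (f := fun h y => F (y + h) * (starRingEnd ℂ) (F y)) (by
        have : Continuous (fun q : E × E => F (q.2 + q.1) * (starRingEnd ℂ) (F q.2)) := by fun_prop
        exact this) (by
        apply HasCompactSupport.intro (K := ((fun q : E × E => q.1 - q.2) '' (tsupport F ×ˢ tsupport F)) ×ˢ tsupport F)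
        · exact ((hFc.isCompact.prod hFc.isCompact).image (by fun_prop)).prod hFc.isCompact
        · rintro ⟨h, y⟩ hq
          simp only [Function.uncurry_apply_pair]
          by_contra hne
          have hy : F y ≠ 0 := fun h0 => hne (by simp [h0])
          have hyh : F (y + h) ≠ 0 := fun h0 => hne (by simp [h0])
          exact hq ⟨⟨(y + h, y), ⟨subset_tsupport _ hyh, subset_tsupport _ hy⟩, by simp⟩,
            subset_tsupport _ hy⟩)
    rw [hsw]
    have h2 : ∀ y, ∫ h, F (y + h) * (starRingEnd ℂ) (F y) ∂μ = (∫ x, F x ∂μ) * (starRingEnd ℂ) (F y) := by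
      intro y
      rw [integral_mul_const, integral_add_left_eq_self F y]
    simp_rw [h2]
    rw [integral_const_mul, integral_conj, Complex.mul_conj, Complex.normSq_eq_norm_sq]
  have h2 : ‖∫ y, F y ∂μ‖ ^ 2 = ‖((‖∫ y, F y ∂μ‖ ^ 2 : ℝ) : ℂ)‖ := by
    rw [Complex.norm_real, Real.norm_of_nonneg (by positivity)]
  rw [h2, h1]
  exact norm_integral_le_of_norm_le hJ (Filter.Eventually.of_forall hJb)

/-- local oscillatory integral bound -/
theorem osc_local (μ : Measure E) [μ.IsAddHaarMeasure] (Φ : E → ℝ)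
    (hΦ : ContDiff ℝ (⊤ : ℕ∞) Φ) (y0 : E) (T : E →L[ℝ] E)
    (hT : ∀ h, h ≠ 0 → 0 < fderiv ℝ (fderiv ℝ Φ) y0 h (T h)) :
    ∃ r > 0, ∀ a : E → ℂ, ContDiff ℝ (⊤ : ℕ∞) a → (∀ y, y ∉ Metric.closedBall y0 r → a y = 0) →
      ∃ C, 0 ≤ C ∧ ∀ w : E →L[ℝ] ℝ, ∀ N : ℝ, 0 < N →
        ‖∫ y, cexp (I * ((N * Φ y + w y : ℝ) : ℂ)) * a y ∂μ‖ ^ 2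
          ≤ C * (N⁻¹) ^ (Module.finrank ℝ E) := by
  set d := Module.finrank ℝ E with hd
  obtain ⟨r, hr, H⟩ := osc_local_aux μ Φ hΦ y0 T hT (d + 1)
  refine ⟨r, hr, fun a ha hsupp => ?_⟩
  obtain ⟨C1, hC1, H1⟩ := H a ha hsupp
  have hac : HasCompactSupport a := HasCompactSupport.intro (isCompact_closedBall y0 r) hsupp
  obtain ⟨A, hA⟩ := ha.continuous.bounded_above_of_compact_support hac
  have hA0 : 0 ≤ A := (norm_nonneg _).trans (hA 0)
  have haint : Integrable a μ := ha.continuous.integrable_of_hasCompactSupport hac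
  set C0 : ℝ := A * ∫ y, ‖a y‖ ∂μ with hC0
  have hC00 : 0 ≤ C0 := mul_nonneg hA0 (integral_nonneg fun _ => norm_nonneg _)
  set C2 : ℝ := 2 ^ (d + 1) * (C0 + C1) with hC2
  have hb0 : ∀ N : ℝ, ∀ h, ‖∫ y, cexp (I * ((N * (Φ (y + h) - Φ y) : ℝ) : ℂ)) * (a (y + h) * (starRingEnd ℂ) (a y)) ∂μ‖ ≤ C0 := by
    intro N h
    rw [hC0, ← integral_const_mul]
    apply norm_integral_le_of_norm_le (haint.norm.const_mul A)
    refine Filter.Eventually.of_forall fun y => ?_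
    rw [norm_mul, mul_comm I, Complex.norm_exp_ofReal_mul_I, one_mul, norm_mul, RCLike.norm_conj]
    gcongr
    exact hA _
  have hb : ∀ N : ℝ, 0 < N → ∀ h, ‖∫ y, cexp (I * ((N * (Φ (y + h) - Φ y) : ℝ) : ℂ)) * (a (y + h) * (starRingEnd ℂ) (a y)) ∂μ‖ ≤ C2 * ((1 + ‖N • h‖)⁻¹) ^ (d+1) := by
    intro N hN h
    rw [norm_smul, Real.norm_of_nonneg hN.le]
    by_cases hle : N * ‖h‖ ≤ 1
    · refine (hb0 N h).trans ?_
      have h1 : (1:ℝ) ≤ (2 * (1 + N * ‖h‖)⁻¹) ^ (d+1) := by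
        apply one_le_pow₀
        rw [← div_eq_mul_inv, le_div_iff₀ (by positivity)]
        linarith
      calc C0 ≤ C0 + C1 := by linarith
        _ ≤ (C0 + C1) * (2 * (1 + N * ‖h‖)⁻¹) ^ (d+1) := le_mul_of_one_le_right (by positivity) h1
        _ = _ := by rw [mul_pow, hC2]; ring
    · push Not at hle
      have hh : h ≠ 0 := by rintro rfl; simp at hle; linarith
      refine (H1 h hh N hN).trans ?_
      calc C1 * ((N * ‖h‖)⁻¹) ^ (d+1) ≤ (C0 + C1) * (2 * (1 + N * ‖h‖)⁻¹) ^ (d+1) := by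
            gcongr
            · linarith
            · rw [← div_eq_mul_inv, le_div_iff₀ (by positivity), inv_mul_eq_div, div_le_iff₀ (by linarith)]
              linarith
        _ = _ := by rw [mul_pow, hC2]; ring
  have hIntg : Integrable (fun h : E => ((1 + ‖h‖)⁻¹) ^ (d+1)) μ := by
    have := integrable_one_add_norm (E := E) (μ := μ) (r := ((d + 1 : ℕ) : ℝ)) (by push_cast; linarith)
    refine this.congr (Filter.Eventually.of_forall fun h => ?_)
    simp only
    rw [Real.rpow_neg (by positivity), Real.rpow_natCast, inv_pow]
  refine ⟨C2 * ∫ h : E, ((1 + ‖h‖)⁻¹) ^ (d+1) ∂μ, by positivity, fun w N hN => ?_⟩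
  have hint2 : Integrable (fun h : E => C2 * ((1 + ‖N • h‖)⁻¹) ^ (d+1)) μ :=
    ((integrable_comp_smul_iff μ _ hN.ne').2 hIntg).const_mul C2
  have hval : ∫ h : E, C2 * ((1 + ‖N • h‖)⁻¹) ^ (d+1) ∂μ =
      C2 * (∫ h : E, ((1 + ‖h‖)⁻¹) ^ (d+1) ∂μ) * (N⁻¹) ^ d := by
    rw [integral_const_mul, Measure.integral_comp_smul μ (fun h => ((1 + ‖h‖)⁻¹) ^ (d+1)) N]
    rw [abs_of_nonneg (by positivity), smul_eq_mul, inv_pow]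
    ring
  rw [← hval]
  apply osc_sq μ (fun y => cexp (I * ((N * Φ y + w y : ℝ) : ℂ)) * a y) _ _ _ hint2
  · intro h
    refine le_trans (le_of_eq ?_) (hb N hN h)
    have : ∀ y, cexp (I * ((N * Φ (y+h) + w (y+h) : ℝ) : ℂ)) * a (y+h) * (starRingEnd ℂ) (cexp (I * ((N * Φ y + w y : ℝ) : ℂ)) * a y)
        = cexp (((w h : ℝ) : ℂ) * I) * (cexp (I * ((N * (Φ (y + h) - Φ y) : ℝ) : ℂ)) * (a (y + h) * (starRingEnd ℂ) (a y))) := by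
      intro y
      rw [map_mul, ← Complex.exp_conj, map_mul, Complex.conj_I, Complex.conj_ofReal]
      have : cexp (I * ((N * Φ (y+h) + w (y+h) : ℝ) : ℂ)) * cexp (-I * ((N * Φ y + w y : ℝ) : ℂ))
        = cexp (((w h : ℝ) : ℂ) * I) * cexp (I * ((N * (Φ (y + h) - Φ y) : ℝ) : ℂ)) := by
        rw [← Complex.exp_add, ← Complex.exp_add, map_add]
        congr 1
        push_cast
        ring
      linear_combination (a (y+h) * (starRingEnd ℂ) (a y)) * this
    simp_rw [this]
    rw [integral_const_mul, norm_mul, Complex.norm_exp_ofReal_mul_I, one_mul]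
  · have := hΦ.continuous
    have := ha.continuous
    fun_prop
  · exact hac.mul_left
end

end

section

section
variable {E : Type*} [NormedAddCommGroup E] [NormedSpace ℝ E] [FiniteDimensional ℝ E]
    [MeasurableSpace E] [BorelSpace E]

theorem osc_global (μ : Measure E) [μ.IsAddHaarMeasure] (Φ : E → ℝ)
    (hΦ : ContDiff ℝ (⊤ : ℕ∞) Φ) (a : E → ℂ) (ha : ContDiff ℝ (⊤ : ℕ∞) a)
    (hac : HasCompactSupport a)
    (hT : ∀ y0 ∈ tsupport a, ∃ T : E →L[ℝ] E, ∀ h, h ≠ 0 → 0 < fderiv ℝ (fderiv ℝ Φ) y0 h (T h)) :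
      ∃ C, 0 ≤ C ∧ ∀ w : E →L[ℝ] ℝ, ∀ N : ℝ, 0 < N →
        ‖∫ y, cexp (I * ((N * Φ y + w y : ℝ) : ℂ)) * a y ∂μ‖ ^ 2
          ≤ C * (N⁻¹) ^ (Module.finrank ℝ E) := by
  classical
  have hloc : ∀ y0 ∈ tsupport a, ∃ b : E → ℝ, ContDiff ℝ (⊤ : ℕ∞) b ∧ {y | b y = 1} ∈ nhds y0 ∧
      ∀ a' : E → ℂ, ContDiff ℝ (⊤ : ℕ∞) a' → ∃ C, 0 ≤ C ∧ ∀ w : E →L[ℝ] ℝ, ∀ N : ℝ, 0 < N →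
        ‖∫ y, cexp (I * ((N * Φ y + w y : ℝ) : ℂ)) * (a' y * (b y : ℂ)) ∂μ‖ ^ 2
          ≤ C * (N⁻¹) ^ (Module.finrank ℝ E) := by
    intro y0 hy0
    obtain ⟨T, hT⟩ := hT y0 hy0
    obtain ⟨r, hr, H⟩ := osc_local μ Φ hΦ y0 T hT
    let b : ContDiffBump y0 := ⟨r / 2, r, by positivity, by linarith⟩
    have hbs : ContDiff ℝ (⊤ : ℕ∞) (fun y => b y) := b.contDiff
    refine ⟨fun y => b y, hbs, ?_, fun a' ha' => ?_⟩
    · filter_upwards [Metric.closedBall_mem_nhds y0 (show 0 < r/2 by positivity)] with y hy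
      exact b.one_of_mem_closedBall hy
    · apply H (fun y => a' y * (b y : ℂ))
      · exact ha'.mul (Complex.ofRealCLM.contDiff.comp hbs)
      · intro y hy
        have : b y = 0 := by
          apply b.zero_of_le_dist
          simp only [Metric.mem_closedBall, not_le] at hy
          exact hy.le
        simp [this]
  choose! b hbs hbn hb using hloc
  obtain ⟨t, ht, hcov⟩ := hac.isCompact.elim_nhds_subcover (fun y => {x | b y x = 1}) hbn
  have key : ∀ t : Finset E, (∀ y ∈ t, y ∈ tsupport a) → ∀ a' : E → ℂ, ContDiff ℝ (⊤ : ℕ∞) a' →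
      HasCompactSupport a' → (∀ y, a' y ≠ 0 → ∃ i ∈ t, b i y = 1) →
      ∃ C, 0 ≤ C ∧ ∀ w : E →L[ℝ] ℝ, ∀ N : ℝ, 0 < N →
        ‖∫ y, cexp (I * ((N * Φ y + w y : ℝ) : ℂ)) * a' y ∂μ‖ ^ 2
          ≤ C * (N⁻¹) ^ (Module.finrank ℝ E) := by
    intro t
    induction t using Finset.induction_on with
    | empty =>
      intro _ a' _ _ h0
      refine ⟨0, le_rfl, fun w N hN => ?_⟩
      have : ∀ y, a' y = 0 := by
        intro y; by_contra hy; obtain ⟨i, hi, _⟩ := h0 y hy; simp at hi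
      simp [this]
    | insert i t hi ih =>
      intro hts a' ha' hac' h0
      have hbi := hbs i (hts i (Finset.mem_insert_self _ _))
      have hbic : ContDiff ℝ (⊤ : ℕ∞) (fun y => (b i y : ℂ)) := Complex.ofRealCLM.contDiff.comp hbi
      obtain ⟨C1, hC1, H1⟩ := hb i (hts i (Finset.mem_insert_self _ _)) a' ha'
      obtain ⟨C2, hC2, H2⟩ := ih (fun y hy => hts y (Finset.mem_insert_of_mem hy))
        (fun y => a' y * (1 - (b i y : ℂ))) (ha'.mul (contDiff_const.sub hbic)) hac'.mul_right (by
          intro y hy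
          have h1 : a' y ≠ 0 := left_ne_zero_of_mul hy
          have h2 : b i y ≠ 1 := by
            intro h; apply right_ne_zero_of_mul hy; simp [h]
          obtain ⟨j, hj, hj1⟩ := h0 y h1
          rcases Finset.mem_insert.1 hj with rfl | hj
          · exact absurd hj1 h2
          · exact ⟨j, hj, hj1⟩)
      refine ⟨2 * (C1 + C2), by positivity, fun w N hN => ?_⟩
      have hΦc := hΦ.continuous
      have hac1 := ha'.continuous
      have hbc := hbic.continuous
      have hsplit : ∫ y, cexp (I * ((N * Φ y + w y : ℝ) : ℂ)) * a' y ∂μ =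
        ∫ y, cexp (I * ((N * Φ y + w y : ℝ) : ℂ)) * (a' y * (b i y : ℂ)) ∂μ +
        ∫ y, cexp (I * ((N * Φ y + w y : ℝ) : ℂ)) * (a' y * (1 - (b i y : ℂ))) ∂μ := by
        rw [← integral_add]
        · congr 1; ext y; ring
        · apply Continuous.integrable_of_hasCompactSupport
          · fun_prop
          · exact (hac'.mul_right).mul_left
        · apply Continuous.integrable_of_hasCompactSupport
          · fun_prop
          · exact (hac'.mul_right).mul_left
      rw [hsplit]
      have h1 := H1 w N hN
      have h2 := H2 w N hN
      set X := ∫ y, cexp (I * ((N * Φ y + w y : ℝ) : ℂ)) * (a' y * (b i y : ℂ)) ∂μ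
      set Y := ∫ y, cexp (I * ((N * Φ y + w y : ℝ) : ℂ)) * (a' y * (1 - (b i y : ℂ))) ∂μ
      calc ‖X + Y‖ ^ 2 ≤ (‖X‖ + ‖Y‖) ^ 2 := by gcongr; exact norm_add_le _ _
        _ ≤ 2 * (‖X‖ ^ 2 + ‖Y‖ ^ 2) := add_sq_le
        _ ≤ _ := by nlinarith
  apply key t ht a ha hac
  intro y hy
  have := hcov (subset_tsupport _ hy)
  simpa using this
end

end

section

/-- analytic hypotheses on the symbol -/
structure GoodP {n : ℕ} (m : ℕ) (P : EuclideanSpace ℝ (Fin n) → ℝ) : Prop where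
  hn : 2 ≤ n
  hm : 2 ≤ m
  smooth : ContDiff ℝ (⊤ : ℕ∞) P
  hom : ∀ (r : ℝ) ξ, P (r • ξ) = r ^ m * P ξ
  pos : ∀ ξ, ξ ≠ 0 → 0 < P ξ
  inj : ∀ ξ, ξ ≠ 0 → ∀ h, fderiv ℝ (fderiv ℝ P) ξ h = 0 → h = 0

namespace GoodP
variable {n m : ℕ} {P : EuclideanSpace ℝ (Fin n) → ℝ}

theorem diff (hP : GoodP m P) : Differentiable ℝ P := hP.smooth.differentiable (by simp)

theorem diff1 (hP : GoodP m P) : ContDiff ℝ (⊤ : ℕ∞) (fderiv ℝ P) := hP.smooth.fderiv_right (by simp)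

theorem m_ne (hP : GoodP m P) : m ≠ 0 := by have := hP.hm; omega

theorem zero (hP : GoodP m P) : P 0 = 0 := by
  have := hP.hom 0 0
  simpa [hP.m_ne] using this

theorem nonneg (hP : GoodP m P) (ξ) : 0 ≤ P ξ := by
  by_cases h : ξ = 0
  · rw [h, hP.zero]
  · exact (hP.pos ξ h).le

theorem even (hP : GoodP m P) (ξ) : P (-ξ) = P ξ := by
  by_cases h : ξ = 0
  · simp [h]
  · have h1 := hP.hom (-1) ξ
    rw [neg_one_smul] at h1
    rcases neg_one_pow_eq_or ℝ m with h2 | h2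
    · rw [h1, h2, one_mul]
    · have := hP.pos ξ h
      have := hP.pos (-ξ) (neg_ne_zero.2 h)
      rw [h1, h2] at this
      linarith

theorem euler1 (hP : GoodP m P) (ξ) : fderiv ℝ P ξ ξ = m * P ξ := by
  have h1 : HasDerivAt (fun r : ℝ => P (r • ξ)) (fderiv ℝ P ((1:ℝ) • ξ) ξ) 1 := by
    have h2 : HasDerivAt (fun r : ℝ => r • ξ) ξ 1 := by
      simpa using (hasDerivAt_id (1:ℝ)).smul_const ξ
    exact (hP.diff _).hasFDerivAt.comp_hasDerivAt 1 h2
  have h3 : HasDerivAt (fun r : ℝ => P (r • ξ)) (m * P ξ) 1 := by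
    simp_rw [hP.hom]
    simpa using (hasDerivAt_pow m (1:ℝ)).mul_const (P ξ)
  rw [one_smul] at h1
  exact h1.unique h3

theorem fderiv_hom (hP : GoodP m P) (r : ℝ) (hr : r ≠ 0) (ξ) :
    fderiv ℝ P (r • ξ) = r ^ (m - 1) • fderiv ℝ P ξ := by
  have h1 : HasFDerivAt (fun ξ => P (r • ξ)) ((fderiv ℝ P (r • ξ)).comp (r • ContinuousLinearMap.id ℝ _)) ξ := by
    apply HasFDerivAt.comp ξ (hP.diff _).hasFDerivAt
    exact (hasFDerivAt_id ξ).const_smul r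
  have h3 : HasFDerivAt (fun ξ => P (r • ξ)) (r ^ m • fderiv ℝ P ξ) ξ := by
    simp_rw [hP.hom]
    exact (hP.diff ξ).hasFDerivAt.const_mul _
  have h4 := h1.unique h3
  ext v
  have h5 := congrArg (fun L => L v) h4
  simp only [ContinuousLinearMap.comp_apply, _root_.smul_apply, smul_eq_mul,
    ContinuousLinearMap.id_apply, map_smul] at h5 ⊢
  have : r ^ m = r * r ^ (m-1) := by rw [← pow_succ']; congr 1; have := hP.m_ne; omega
  rw [this, mul_assoc] at h5
  exact mul_left_cancel₀ hr h5

theorem euler2 (hP : GoodP m P) (ξ) :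
    fderiv ℝ (fderiv ℝ P) ξ ξ = ((m - 1 : ℕ) : ℝ) • fderiv ℝ P ξ := by
  have h1 : HasDerivAt (fun r : ℝ => fderiv ℝ P (r • ξ)) (fderiv ℝ (fderiv ℝ P) ((1:ℝ) • ξ) ξ) 1 := by
    have h2 : HasDerivAt (fun r : ℝ => r • ξ) ξ 1 := by
      simpa using (hasDerivAt_id (1:ℝ)).smul_const ξ
    exact (hP.diff1.differentiable (by simp) _).hasFDerivAt.comp_hasDerivAt 1 h2
  have h3 : HasDerivAt (fun r : ℝ => r ^ (m-1) • fderiv ℝ P ξ) (((m - 1 : ℕ) : ℝ) • fderiv ℝ P ξ) 1 := by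
    simpa using (hasDerivAt_pow (m-1) (1:ℝ)).smul_const (fderiv ℝ P ξ)
  have h4 : (fun r : ℝ => fderiv ℝ P (r • ξ)) =ᶠ[nhds 1] (fun r : ℝ => r ^ (m-1) • fderiv ℝ P ξ) := by
    filter_upwards [isOpen_ne.mem_nhds (one_ne_zero : (1:ℝ) ≠ 0)] with r hr
    exact hP.fderiv_hom r hr ξ
  rw [one_smul] at h1
  exact h1.unique (h3.congr_of_eventuallyEq h4)

/-- the phase -/
theorem phase_fderiv2 (hP : GoodP m P) (ξ h k : EuclideanSpace ℝ (Fin n)) (s σ τ : ℝ) :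
    fderiv ℝ (fderiv ℝ (fun y : EuclideanSpace ℝ (Fin n) × ℝ => 2 * Real.pi * (y.2 * (P y.1 - 1))))
      (ξ, s) (h, σ) (k, τ) = 2 * Real.pi * (s * fderiv ℝ (fderiv ℝ P) ξ h k + σ * fderiv ℝ P ξ k
        + τ * fderiv ℝ P ξ h) := by
  set Φ : EuclideanSpace ℝ (Fin n) × ℝ → ℝ := fun y => 2 * Real.pi * (y.2 * (P y.1 - 1)) with hΦ
  have hΦs : ContDiff ℝ (⊤ : ℕ∞) Φ := by
    have := hP.smooth.comp (contDiff_fst (E := EuclideanSpace ℝ (Fin n)) (F := ℝ) (𝕜 := ℝ))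
    exact contDiff_const.mul (contDiff_snd.mul (this.sub contDiff_const))
  have hΦ1 : ContDiff ℝ (⊤ : ℕ∞) (fderiv ℝ Φ) := hΦs.fderiv_right (by simp)
  have hPf : ∀ y : EuclideanSpace ℝ (Fin n) × ℝ, HasFDerivAt (fun y : EuclideanSpace ℝ (Fin n) × ℝ => P y.1)
      ((fderiv ℝ P y.1).comp (ContinuousLinearMap.fst ℝ _ _)) y := by
    intro y
    exact HasFDerivAt.comp y (hP.diff _).hasFDerivAt hasFDerivAt_fst
  have h1 : ∀ y, fderiv ℝ Φ y (k, τ) = 2 * Real.pi * (y.2 * fderiv ℝ P y.1 k + τ * (P y.1 - 1)) := by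
    intro y
    have h2 : HasFDerivAt Φ _ y := ((hasFDerivAt_snd (p := y)).mul ((hPf y).sub_const 1)).const_mul (2 * Real.pi)
    rw [h2.fderiv]
    simp
    ring
  have h3 : HasFDerivAt (fun y => fderiv ℝ Φ y (k, τ))
      ((ContinuousLinearMap.apply ℝ ℝ (k, τ)).comp (fderiv ℝ (fderiv ℝ Φ) (ξ, s))) (ξ, s) :=
    (ContinuousLinearMap.apply ℝ ℝ ((k, τ) : EuclideanSpace ℝ (Fin n) × ℝ)).hasFDerivAt.comp (ξ, s)
      (hΦ1.differentiable (by simp) _).hasFDerivAt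
  have h4 : HasFDerivAt (fun y : EuclideanSpace ℝ (Fin n) × ℝ => fderiv ℝ P y.1 k)
      (((ContinuousLinearMap.apply ℝ ℝ k).comp (fderiv ℝ (fderiv ℝ P) ξ)).comp
        (ContinuousLinearMap.fst ℝ _ _)) (ξ, s) := by
    have h5 : HasFDerivAt (fun x => fderiv ℝ P x k)
      ((ContinuousLinearMap.apply ℝ ℝ k).comp (fderiv ℝ (fderiv ℝ P) ξ)) ξ :=
      (ContinuousLinearMap.apply ℝ ℝ k).hasFDerivAt.comp ξ
        (hP.diff1.differentiable (by simp) _).hasFDerivAt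
    exact HasFDerivAt.comp (f := Prod.fst) (g := fun x => fderiv ℝ P x k) (ξ, s) h5 hasFDerivAt_fst
  have h6 := (((hasFDerivAt_snd (𝕜 := ℝ) (p := (ξ, s))).mul h4).add (((hPf (ξ, s)).sub_const 1).const_mul τ)).const_mul (2 * Real.pi)
  have h7 := h3.unique (h6.congr_of_eventuallyEq (Filter.Eventually.of_forall h1))
  have h8 := congrArg (fun L => L (h, σ)) h7
  simp only [ContinuousLinearMap.comp_apply, ContinuousLinearMap.apply_apply] at h8
  rw [h8]
  simp
  ring

theorem phase_nondeg (hP : GoodP m P) (ξ : EuclideanSpace ℝ (Fin n)) (hξ : ξ ≠ 0) (s : ℝ) (hs : s ≠ 0) :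
    ∃ T : EuclideanSpace ℝ (Fin n) × ℝ →L[ℝ] EuclideanSpace ℝ (Fin n) × ℝ, ∀ h, h ≠ 0 →
    0 < fderiv ℝ (fderiv ℝ (fun y : EuclideanSpace ℝ (Fin n) × ℝ => 2 * Real.pi * (y.2 * (P y.1 - 1))))
      (ξ, s) h (T h) := by
  let R0 : (EuclideanSpace ℝ (Fin n) →L[ℝ] ℝ) →ₗ[ℝ] EuclideanSpace ℝ (Fin n) :=
    { toFun := fun L => (InnerProductSpace.toDual ℝ (EuclideanSpace ℝ (Fin n))).symm L
      map_add' := fun x y => by simp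
      map_smul' := fun c x => by simp }
  let R : (EuclideanSpace ℝ (Fin n) →L[ℝ] ℝ) →L[ℝ] EuclideanSpace ℝ (Fin n) :=
    LinearMap.toContinuousLinearMap R0
  have hR : ∀ L k, L k = ⟪R L, k⟫ := fun L k => by simp [R, R0]
  let g := fderiv ℝ P ξ
  let A := fderiv ℝ (fderiv ℝ P) ξ
  let T1 : EuclideanSpace ℝ (Fin n) × ℝ →L[ℝ] EuclideanSpace ℝ (Fin n) :=
    s • ((R.comp A).comp (ContinuousLinearMap.fst ℝ _ _)) +
      (ContinuousLinearMap.snd ℝ _ _).smulRight (R g)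
  let T : EuclideanSpace ℝ (Fin n) × ℝ →L[ℝ] EuclideanSpace ℝ (Fin n) × ℝ :=
    T1.prod (g.comp (ContinuousLinearMap.fst ℝ _ _))
  refine ⟨T, ?_⟩
  rintro ⟨h, σ⟩ hne
  have hT : T (h, σ) = (R (s • A h + σ • g), g h) := by
    simp [T, T1]
  rw [hT, hP.phase_fderiv2]
  change 0 < 2 * Real.pi * (s * (A h) (R (s • A h + σ • g)) + σ * g (R (s • A h + σ • g)) + g h * g h)
  have h1 : s * (A h) (R (s • A h + σ • g)) + σ * g (R (s • A h + σ • g)) = ‖R (s • A h + σ • g)‖ ^ 2 := by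
    rw [← real_inner_self_eq_norm_sq, ← hR]
    simp
  rw [h1]
  have hpi := Real.pi_pos
  by_contra hcon
  have h2 : ‖R (s • A h + σ • g)‖ ^ 2 + g h * g h ≤ 0 := by
    by_contra h3
    push Not at h3
    exact hcon (by positivity)
  have h3 : ‖R (s • A h + σ • g)‖ ^ 2 = 0 := by nlinarith [sq_nonneg ‖R (s • A h + σ • g)‖, mul_self_nonneg (g h)]
  have h4 : g h = 0 := by nlinarith [sq_nonneg ‖R (s • A h + σ • g)‖, mul_self_nonneg (g h)]
  have h5 : s • A h + σ • g = 0 := by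
    have : R (s • A h + σ • g) = 0 := by simpa using h3
    ext k
    rw [hR, this]; simp
  have hm1 : ((m - 1 : ℕ) : ℝ) ≠ 0 := by have := hP.hm; norm_cast; omega
  have h6 : A (s • h + (σ / ((m - 1 : ℕ) : ℝ)) • ξ) = 0 := by
    rw [map_add, map_smul, map_smul, hP.euler2, smul_smul, div_mul_cancel₀ _ hm1]
    exact h5
  have h7 := hP.inj ξ hξ _ h6
  have h8 : g (s • h + (σ / ((m - 1 : ℕ) : ℝ)) • ξ) = 0 := by rw [h7, map_zero]
  rw [map_add, map_smul, map_smul, h4, hP.euler1, smul_zero, zero_add, smul_eq_mul] at h8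
  have hp := (hP.pos ξ hξ).ne'
  have hm0 : (m : ℝ) ≠ 0 := by exact_mod_cast hP.m_ne
  have hσ : σ = 0 := by
    have := mul_eq_zero.1 h8
    rcases this with h | h
    · rcases div_eq_zero_iff.1 h with h | h
      · exact h
      · exact absurd h hm1
    · exact absurd h (mul_ne_zero hm0 hp)
  subst hσ
  simp only [zero_div, zero_smul, add_zero, smul_eq_zero, hs, false_or] at h7
  apply hne
  simp [h7]

theorem continuous (hP : GoodP m P) : Continuous P := hP.smooth.continuous

/-- coercivity -/
theorem coercive (hP : GoodP m P) : ∃ c > 0, ∀ ξ, c * ‖ξ‖ ^ m ≤ P ξ := by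
  obtain ⟨c, hc, h⟩ := (isCompact_sphere (0 : EuclideanSpace ℝ (Fin n)) 1).exists_forall_le'
    (f := P) (a := 0) hP.continuous.continuousOn (fun x hx => hP.pos x (by rintro rfl; simp at hx))
  refine ⟨c, hc, fun ξ => ?_⟩
  by_cases h0 : ξ = 0
  · simp [h0, hP.zero, hP.m_ne]
  · have hpos : 0 < ‖ξ‖ := norm_pos_iff.2 h0
    have h1 := h (‖ξ‖⁻¹ • ξ) (by simp [norm_smul, hpos.ne'])
    have h2 := hP.hom ‖ξ‖ (‖ξ‖⁻¹ • ξ)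
    rw [smul_smul, mul_inv_cancel₀ hpos.ne', one_smul] at h2
    rw [h2, mul_comm]
    gcongr

theorem isCompact_le (hP : GoodP m P) (b : ℝ) : IsCompact {ξ | P ξ ≤ b} := by
  obtain ⟨c, hc, h⟩ := hP.coercive
  apply Metric.isCompact_of_isClosed_isBounded (isClosed_le hP.continuous continuous_const)
  rw [isBounded_iff_forall_norm_le]
  refine ⟨max 1 (b / c), fun ξ hξ => ?_⟩
  by_cases h1 : ‖ξ‖ ≤ 1
  · exact h1.trans (le_max_left _ _)
  · push Not at h1
    apply le_trans _ (le_max_right _ _)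
    rw [le_div_iff₀ hc, mul_comm]
    calc c * ‖ξ‖ ≤ c * ‖ξ‖ ^ m := by
          gcongr
          exact le_self_pow₀ h1.le hP.m_ne
      _ ≤ P ξ := h ξ
      _ ≤ b := hξ
end GoodP

end

section

theorem exists_kernel : ∃ (η : ℝ → ℝ) (h : ℝ → ℂ), ContDiff ℝ (⊤ : ℕ∞) η ∧ (∀ t, |t| ≤ 1/2 → η t = 1) ∧
    (∀ t, 1 ≤ |t| → η t = 0) ∧ Continuous h ∧ Integrable h ∧ Integrable (fun τ => ‖h τ‖ ^ 2) ∧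
    (∃ A, 0 ≤ A ∧ ∀ τ, ‖h τ‖ ≤ A) ∧
    (∀ τ, h τ = ∫ t, cexp (I * ((2 * Real.pi * (t * τ) : ℝ) : ℂ)) * (η t : ℂ)) ∧ ∫ τ, h τ = 1 := by
  let b : ContDiffBump (0:ℝ) := ⟨1/2, 1, by norm_num, by norm_num⟩
  have hbs : ContDiff ℝ (⊤ : ℕ∞) (fun t => b t) := b.contDiff
  have hbc : HasCompactSupport (fun t => (b t : ℂ)) := by
    have := b.hasCompactSupport
    exact this.comp_left (g := fun x : ℝ => (x : ℂ)) (by simp)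
  let S : SchwartzMap ℝ ℂ := hbc.toSchwartzMap (Complex.ofRealCLM.contDiff.comp hbs)
  have hS : ∀ t, S t = (b t : ℂ) := fun t => rfl
  let H : SchwartzMap ℝ ℂ := FourierTransform.fourierInv S
  have hH : ∀ τ, H τ = FourierTransform.fourierInv (S : ℝ → ℂ) τ := by
    intro τ
    rw [← SchwartzMap.fourierInv_coe]
  refine ⟨fun t => b t, H, hbs, ?_, ?_, H.continuous, H.integrable, ?_, ?_, ?_, ?_⟩
  · intro t ht
    apply b.one_of_mem_closedBall
    simpa [b] using ht
  · intro t ht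
    apply b.zero_of_le_dist
    simpa [b] using ht
  · have := (H.memLp 2 volume)
    exact (memLp_two_iff_integrable_sq_norm this.1).1 this
  · have := H.toBoundedContinuousFunction.norm_coe_le_norm
    exact ⟨‖H.toBoundedContinuousFunction‖, norm_nonneg _, this⟩
  · intro τ
    rw [hH, Real.fourierInv_eq']
    congr 1
    ext t
    rw [hS, smul_eq_mul, mul_comm I]
    congr 4
    simp
    ring
  · have h1 : FourierTransform.fourier H = S := FourierTransform.fourier_fourierInv_eq S
    have h2 : (FourierTransform.fourier H) 0 = ∫ τ, H τ := by
      rw [SchwartzMap.fourier_coe, Real.fourier_eq']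
      simp
    rw [← h2, h1, hS]
    have : b 0 = 1 := b.one_of_mem_closedBall (by simp [b])
    simp [this]

theorem approx_id (h : ℝ → ℂ) (hi : Integrable h) (h1 : ∫ τ, h τ = 1) (F : ℝ → ℂ)
    (hF : StronglyMeasurable F) (A : ℝ) (hA : ∀ x, ‖F x‖ ≤ A) (hc : ContinuousAt F 1) :
    Filter.Tendsto (fun J : ℕ => ∫ l, ((2:ℂ) ^ J * h (2 ^ J * (l - 1))) * F l) Filter.atTop (nhds (F 1)) := by
  have hsub : ∀ J : ℕ, ∫ l, ((2:ℂ) ^ J * h (2 ^ J * (l - 1))) * F l =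
      ∫ τ, h τ * F (1 + (2 ^ J)⁻¹ * τ) := by
    intro J
    have h2 : (0:ℝ) < 2 ^ J := by positivity
    have h3 := Measure.integral_comp_mul_left (fun τ => h τ * F (1 + (2 ^ J)⁻¹ * τ)) (2 ^ J)
    have h4 := integral_sub_right_eq_self (μ := volume) (fun l => h (2 ^ J * l) * F (1 + (2 ^ J)⁻¹ * (2 ^ J * l))) (1:ℝ)
    rw [← h4] at h3
    rw [abs_of_pos (by positivity)] at h3
    have h5 : ∫ τ, h τ * F (1 + (2 ^ J)⁻¹ * τ) = (2:ℝ)^J • ((2:ℝ)^J)⁻¹ • ∫ τ, h τ * F (1 + (2 ^ J)⁻¹ * τ) := by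
      rw [smul_smul, mul_inv_cancel₀ h2.ne', one_smul]
    rw [h5, ← h3, ← integral_smul]
    congr 1
    ext l
    rw [← mul_assoc, inv_mul_cancel₀ h2.ne', one_mul, add_sub_cancel]
    simp
    ring
  simp_rw [hsub]
  have : F 1 = ∫ τ, h τ * F 1 := by rw [integral_mul_const, h1, one_mul]
  rw [this]
  apply tendsto_integral_of_dominated_convergence (fun τ => ‖h τ‖ * A)
  · intro J
    exact hi.1.mul (hF.comp_measurable (by fun_prop)).aestronglyMeasurable
  · exact hi.norm.mul_const A
  · intro J
    refine Filter.Eventually.of_forall fun τ => ?_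
    rw [norm_mul]
    gcongr
    exact hA _
  · refine Filter.Eventually.of_forall fun τ => ?_
    apply Filter.Tendsto.const_mul
    apply hc.tendsto.comp
    have : Filter.Tendsto (fun J : ℕ => 1 + ((2:ℝ) ^ J)⁻¹ * τ) Filter.atTop (nhds (1 + 0 * τ)) := by
      apply Filter.Tendsto.const_add
      apply Filter.Tendsto.mul_const
      exact (tendsto_pow_atTop_atTop_of_one_lt (by norm_num)).inv_tendsto_atTop
    simpa using this

end

section

theorem kernel_osc {n m : ℕ} {P : EuclideanSpace ℝ (Fin n) → ℝ} (hP : GoodP m P)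
    (χ ψ : ℝ → ℝ) (hχ : ContDiff ℝ (⊤ : ℕ∞) χ) (hψ : ContDiff ℝ (⊤ : ℕ∞) ψ)
    (hχ0 : ∀ l, l ∉ Set.Icc (1/2 : ℝ) (3/2) → χ l = 0)
    (hψ0 : ∀ t, |t| ≤ 1/4 → ψ t = 0) (hψ1 : ∀ t, 1 ≤ |t| → ψ t = 0) :
    ∃ C, 0 ≤ C ∧ ∀ N : ℝ, 0 < N → ∀ x : EuclideanSpace ℝ (Fin n),
      ‖∫ ξ, ((N : ℂ) * (∫ t, cexp (I * ((2 * Real.pi * (t * (N * (P ξ - 1))) : ℝ) : ℂ)) * (ψ t : ℂ)) * (χ (P ξ) : ℂ))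
        * cexp (I * (⟪x, ξ⟫ : ℂ))‖ ≤ C * N ^ (-((n:ℝ) - 1) / 2) := by
  set a : EuclideanSpace ℝ (Fin n) × ℝ → ℂ := fun y => ((χ (P y.1) * ψ y.2 : ℝ) : ℂ) with ha
  set Φ : EuclideanSpace ℝ (Fin n) × ℝ → ℝ := fun y => 2 * Real.pi * (y.2 * (P y.1 - 1)) with hΦ
  have hΦs : ContDiff ℝ (⊤ : ℕ∞) Φ := by
    have := hP.smooth.comp (contDiff_fst (E := EuclideanSpace ℝ (Fin n)) (F := ℝ) (𝕜 := ℝ))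
    exact contDiff_const.mul (contDiff_snd.mul (this.sub contDiff_const))
  have has : ContDiff ℝ (⊤ : ℕ∞) a := by
    apply Complex.ofRealCLM.contDiff.comp
    exact (hχ.comp (hP.smooth.comp contDiff_fst)).mul (hψ.comp contDiff_snd)
  set K : Set (EuclideanSpace ℝ (Fin n) × ℝ) := {ξ | P ξ ∈ Set.Icc (1/2 : ℝ) (3/2)} ×ˢ {t | 1/4 ≤ |t| ∧ |t| ≤ 1} with hK
  have hKc : IsCompact K := by
    apply IsCompact.prod
    · apply (hP.isCompact_le (3/2)).of_isClosed_subset (isClosed_Icc.preimage hP.continuous)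
      exact fun ξ hξ => hξ.2
    · apply (isCompact_Icc (a := (-1:ℝ)) (b := 1)).of_isClosed_subset
      · exact (isClosed_le continuous_const continuous_abs).inter (isClosed_le continuous_abs continuous_const)
      · exact fun t ht => abs_le.1 ht.2
  have ha0 : ∀ y, y ∉ K → a y = 0 := by
    intro y hy
    by_cases h1 : P y.1 ∈ Set.Icc (1/2 : ℝ) (3/2)
    · have : ψ y.2 = 0 := by
        by_cases h2 : |y.2| ≤ 1/4
        · exact hψ0 _ h2
        · apply hψ1
          by_contra h3
          push Not at h2 h3
          exact hy ⟨h1, h2.le, h3.le⟩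
      simp [ha, this]
    · simp [ha, hχ0 _ h1]
  have hac : HasCompactSupport a := HasCompactSupport.intro hKc ha0
  have hts : tsupport a ⊆ K := by
    apply closure_minimal _ hKc.isClosed
    intro y hy
    by_contra h
    exact hy (ha0 y h)
  have hhaar : (volume : Measure (EuclideanSpace ℝ (Fin n) × ℝ)).IsAddHaarMeasure := by
    rw [Measure.volume_eq_prod]; infer_instance
  obtain ⟨C, hC, H⟩ := osc_global (volume : Measure (EuclideanSpace ℝ (Fin n) × ℝ)) Φ hΦs a has hac (by
    rintro ⟨ξ, s⟩ hy
    have h1 := hts hy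
    apply hP.phase_nondeg ξ _ s _
    · rintro rfl
      have := h1.1.1
      simp only [hP.zero] at this
      norm_num at this
    · rintro rfl
      have := h1.2.1
      simp only [abs_zero] at this
      norm_num at this)
  refine ⟨Real.sqrt C, Real.sqrt_nonneg _, fun N hN x => ?_⟩
  have hfr : Module.finrank ℝ (EuclideanSpace ℝ (Fin n) × ℝ) = n + 1 := by simp
  rw [hfr] at H
  let w : EuclideanSpace ℝ (Fin n) × ℝ →L[ℝ] ℝ := (innerSL ℝ x).comp (ContinuousLinearMap.fst ℝ _ _)
  have hw : ∀ y, w y = ⟪x, y.1⟫ := fun y => by simp [w]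
  have h1 := H w N hN
  have hcont := has.continuous
  have hcont2 := hΦs.continuous
  have hIntg : Integrable (fun y => cexp (I * ((N * Φ y + w y : ℝ) : ℂ)) * a y) (volume : Measure (EuclideanSpace ℝ (Fin n) × ℝ)) := by
    apply Continuous.integrable_of_hasCompactSupport
    · fun_prop
    · exact hac.mul_left
  have heq : (∫ ξ, ((N : ℂ) * (∫ t, cexp (I * ((2 * Real.pi * (t * (N * (P ξ - 1))) : ℝ) : ℂ)) * (ψ t : ℂ)) * (χ (P ξ) : ℂ))
        * cexp (I * (⟪x, ξ⟫ : ℂ))) = N * ∫ y, cexp (I * ((N * Φ y + w y : ℝ) : ℂ)) * a y := by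
    rw [Measure.volume_eq_prod] at hIntg ⊢
    rw [integral_prod _ hIntg, ← integral_const_mul]
    congr 1
    ext ξ
    rw [mul_assoc, mul_assoc]
    congr 1
    rw [← integral_mul_const]
    congr 1
    ext t
    simp only [ha, hΦ, hw]
    have : cexp (I * ((N * (2 * Real.pi * (t * (P ξ - 1))) + ⟪x, ξ⟫ : ℝ) : ℂ)) =
      cexp (I * ((2 * Real.pi * (t * (N * (P ξ - 1))) : ℝ) : ℂ)) * cexp (I * (⟪x, ξ⟫ : ℂ)) := by
      rw [← Complex.exp_add]
      congr 1
      push_cast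
      ring
    rw [this]
    push_cast
    ring
  rw [heq, norm_mul, Complex.norm_real, Real.norm_of_nonneg hN.le]
  apply le_of_sq_le_sq _ (by positivity)
  rw [mul_pow, mul_pow, Real.sq_sqrt hC]
  have h2 : (N ^ (-((n:ℝ) - 1) / 2)) ^ 2 = N ^ 2 * (N⁻¹) ^ (n + 1) := by
    rw [← Real.rpow_natCast, ← Real.rpow_mul hN.le, ← Real.rpow_natCast, ← Real.rpow_natCast,
      ← Real.rpow_neg_one, ← Real.rpow_mul hN.le, ← Real.rpow_add hN]
    congr 1
    push_cast
    ring
  rw [h2]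
  calc _ ≤ N ^ 2 * (C * (N⁻¹) ^ (n + 1)) := by gcongr
    _ = _ := by ring

theorem exists_multipliers {n m : ℕ} {P : EuclideanSpace ℝ (Fin n) → ℝ} (hP : GoodP m P) :
    ∃ (M : ℕ → ℝ → ℂ) (C : ℝ), 0 < C ∧ (∀ j, Continuous (M j)) ∧
    (∀ j l, l ∉ Set.Icc (1/2 : ℝ) (3/2) → M j l = 0) ∧
    (∀ j (x : EuclideanSpace ℝ (Fin n)), ‖∫ ξ, M j (P ξ) * cexp (I * (⟪x, ξ⟫ : ℂ))‖ ≤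
      C * ((2:ℝ) ^ j) ^ (-((n:ℝ) - 1) / 2)) ∧
    (∀ j l, ‖M j l‖ ≤ C * 2 ^ j) ∧ (∀ j, ∫ l, ‖M j l‖ ^ 2 ≤ C * 2 ^ j) ∧
    (∀ F : ℝ → ℂ, StronglyMeasurable F → (∃ A, ∀ x, ‖F x‖ ≤ A) → ContinuousAt F 1 →
      Filter.Tendsto (fun J : ℕ => ∫ l, (∑ j ∈ Finset.range J, M j l) * F l) Filter.atTop (nhds (F 1))) := by
  obtain ⟨η, h, hηs, hη1, hη0, hhc, hhi, hh2, ⟨A, hA0, hA⟩, hh, hone⟩ := exists_kernel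
  let b : ContDiffBump (1:ℝ) := ⟨1/4, 1/2, by norm_num, by norm_num⟩
  have hχs : ContDiff ℝ (⊤ : ℕ∞) (fun t => b t) := b.contDiff
  have hχ0 : ∀ l, l ∉ Set.Icc (1/2 : ℝ) (3/2) → b l = 0 := by
    intro l hl
    apply b.zero_of_le_dist
    by_contra hcon
    push Not at hcon
    apply hl
    rw [Real.dist_eq, abs_lt] at hcon
    simp only [b] at hcon
    constructor <;> linarith [hcon.1, hcon.2]
  have hχ1 : b 1 = 1 := b.one_of_mem_closedBall (by simp [b])
  have hχn : ∀ l, ‖((b l : ℝ) : ℂ)‖ ≤ 1 := by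
    intro l
    rw [Complex.norm_real, Real.norm_of_nonneg b.nonneg]
    exact b.le_one
  have hbc := hχs.continuous
  set Q : ℕ → ℝ → ℂ := fun J l => (2:ℂ) ^ J * h (2 ^ J * (l - 1)) * (b l : ℂ) with hQ
  have hQc : ∀ J, Continuous (Q J) := by intro J; fun_prop
  have hQ0 : ∀ J l, l ∉ Set.Icc (1/2 : ℝ) (3/2) → Q J l = 0 := by
    intro J l hl; simp [hQ, hχ0 l hl]
  have hQn : ∀ J l, ‖Q J l‖ ≤ 2 ^ J * ‖h (2 ^ J * (l - 1))‖ := by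
    intro J l
    simp only [hQ, norm_mul, norm_pow]
    have := hχn l
    calc _ ≤ ‖(2:ℂ)‖ ^ J * ‖h (2 ^ J * (l - 1))‖ * 1 := by gcongr
      _ = _ := by simp
  have hQA : ∀ J l, ‖Q J l‖ ≤ A * 2 ^ J := by
    intro J l
    refine (hQn J l).trans ?_
    rw [mul_comm]
    gcongr
    exact hA _
  have hQcs : ∀ J, HasCompactSupport (Q J) := fun J => HasCompactSupport.intro isCompact_Icc (hQ0 J)
  have hQsqi : ∀ J, Integrable (fun l => ‖Q J l‖ ^ 2) := by
    intro J
    apply Continuous.integrable_of_hasCompactSupport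
    · have := hQc J; fun_prop
    · exact (hQcs J).comp_left (g := fun z => ‖z‖ ^ 2) (by simp)
  set B : ℝ := ∫ τ, ‖h τ‖ ^ 2 with hB
  have hB0 : 0 ≤ B := integral_nonneg fun _ => by positivity
  have hQsq : ∀ J, ∫ l, ‖Q J l‖ ^ 2 ≤ B * 2 ^ J := by
    intro J
    have h2 : (0:ℝ) < 2 ^ J := by positivity
    have h3 := Measure.integral_comp_mul_left (fun τ => ‖h τ‖ ^ 2) (2 ^ J)
    have h4 := integral_sub_right_eq_self (μ := volume) (fun l => ‖h (2 ^ J * l)‖ ^ 2) (1:ℝ)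
    have hi1 : Integrable (fun l => ‖h (2 ^ J * (l - 1))‖ ^ 2) := by
      exact (hh2.comp_mul_left' h2.ne').comp_sub_right 1
    calc ∫ l, ‖Q J l‖ ^ 2 ≤ ∫ l, (2 ^ J) ^ 2 * ‖h (2 ^ J * (l - 1))‖ ^ 2 := by
          apply integral_mono (hQsqi J) (hi1.const_mul _)
          intro l
          simp only
          rw [← mul_pow]
          gcongr
          exact hQn J l
      _ = (2 ^ J) ^ 2 * ∫ l, ‖h (2 ^ J * (l - 1))‖ ^ 2 := integral_const_mul _ _
      _ = B * 2 ^ J := by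
          rw [h4, h3, abs_of_pos (by positivity), smul_eq_mul]
          rw [hB]
          field_simp
  -- the pieces
  set M : ℕ → ℝ → ℂ := fun j => match j with
    | 0 => Q 0
    | (j+1) => fun l => Q (j+1) l - Q j l with hM
  have hM0 : M 0 = Q 0 := rfl
  have hMs : ∀ j, M (j+1) = fun l => Q (j+1) l - Q j l := fun j => rfl
  have hsum : ∀ J l, ∑ j ∈ Finset.range (J+1), M j l = Q J l := by
    intro J l
    induction J with
    | zero => simp [hM0]
    | succ J ih => rw [Finset.sum_range_succ, ih, hMs]; ring
  obtain ⟨C1, hC1, H1⟩ := kernel_osc hP (fun t => b t) (fun t => η t - η (2 * t)) hχs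
    (hηs.sub (hηs.comp (by fun_prop))) hχ0 (by
      intro t ht
      have h2 : |2 * t| ≤ 1/2 := by rw [abs_mul, abs_two]; linarith
      rw [hη1 t (by linarith), hη1 _ h2, sub_self]) (by
      intro t ht
      have h2 : 1 ≤ |2 * t| := by rw [abs_mul, abs_two]; linarith
      rw [hη0 t ht, hη0 _ h2, sub_self])
  set C0 : ℝ := ∫ ξ : EuclideanSpace ℝ (Fin n), ‖M 0 (P ξ)‖ with hC0
  have hC00 : 0 ≤ C0 := integral_nonneg fun _ => norm_nonneg _
  have hηc := hηs.continuous
  have hηcs : HasCompactSupport (fun t => (η t : ℂ)) := by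
    apply HasCompactSupport.intro (isCompact_Icc (a := (-1:ℝ)) (b := 1))
    intro t ht
    rw [hη0, ofReal_zero]
    by_contra hcon
    push Not at hcon
    exact ht (abs_le.1 hcon.le)
  have hη2cs : HasCompactSupport (fun t => (η (2 * t) : ℂ)) := by
    apply HasCompactSupport.intro (isCompact_Icc (a := (-1:ℝ)) (b := 1))
    intro t ht
    rw [hη0, ofReal_zero]
    by_contra hcon
    push Not at hcon
    rw [abs_mul, abs_two] at hcon
    exact ht (abs_le.1 (by linarith [abs_nonneg t]))
  have hMform : ∀ j l, M (j+1) l = (((2 ^ (j+1) : ℝ)) : ℂ) * (∫ t, cexp (I * ((2 * Real.pi * (t * (2 ^ (j+1) * (l - 1))) : ℝ) : ℂ)) * ((η t - η (2 * t) : ℝ) : ℂ)) * (b l : ℂ) := by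
    intro j l
    rw [hMs]
    simp only [hQ]
    rw [hh, hh]
    have h3 := Measure.integral_comp_mul_left (fun t => cexp (I * ((2 * Real.pi * (t * (2 ^ j * (l - 1))) : ℝ) : ℂ)) * (η t : ℂ)) 2
    rw [abs_of_pos (by norm_num)] at h3
    have h4 : ∫ t, cexp (I * ((2 * Real.pi * (t * (2 ^ j * (l - 1))) : ℝ) : ℂ)) * (η t : ℂ) =
        2 * ∫ t, cexp (I * ((2 * Real.pi * (t * (2 ^ (j+1) * (l - 1))) : ℝ) : ℂ)) * (η (2 * t) : ℂ) := by
      have h5 : ∫ t, cexp (I * ((2 * Real.pi * (t * (2 ^ (j+1) * (l - 1))) : ℝ) : ℂ)) * (η (2 * t) : ℂ)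
        = ∫ t, cexp (I * ((2 * Real.pi * ((2 * t) * (2 ^ j * (l - 1))) : ℝ) : ℂ)) * (η (2 * t) : ℂ) := by
        congr 1; ext t; congr 3; push_cast; ring
      rw [h5, h3]
      rw [Complex.real_smul]
      push_cast
      ring
    rw [h4]
    have h6 : ∫ t, cexp (I * ((2 * Real.pi * (t * (2 ^ (j+1) * (l - 1))) : ℝ) : ℂ)) * ((η t - η (2 * t) : ℝ) : ℂ)
      = (∫ t, cexp (I * ((2 * Real.pi * (t * (2 ^ (j+1) * (l - 1))) : ℝ) : ℂ)) * (η t : ℂ)) -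
        ∫ t, cexp (I * ((2 * Real.pi * (t * (2 ^ (j+1) * (l - 1))) : ℝ) : ℂ)) * (η (2 * t) : ℂ) := by
      rw [← integral_sub]
      · congr 1; ext t; push_cast; ring
      · apply Continuous.integrable_of_hasCompactSupport
        · fun_prop
        · exact hηcs.mul_left
      · apply Continuous.integrable_of_hasCompactSupport
        · fun_prop
        · exact hη2cs.mul_left
    rw [h6]
    push_cast
    ring
  refine ⟨M, 1 + C0 + C1 + 2 * A + 4 * B, by positivity, ?_, ?_, ?_, ?_, ?_, ?_⟩
  · intro j
    cases j with
    | zero => exact hQc 0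
    | succ j => exact (hQc _).sub (hQc _)
  · intro j l hl
    cases j with
    | zero => exact hQ0 0 l hl
    | succ j => simp only [hMs, hQ0 _ l hl, sub_zero]
  · intro j x
    cases j with
    | zero =>
      simp only [pow_zero, Real.one_rpow, mul_one]
      refine (norm_integral_le_integral_norm _).trans ?_
      have : ∀ ξ, ‖M 0 (P ξ) * cexp (I * (⟪x, ξ⟫ : ℂ))‖ = ‖M 0 (P ξ)‖ := by
        intro ξ
        rw [norm_mul, mul_comm I, Complex.norm_exp_ofReal_mul_I, mul_one]
      simp_rw [this]
      change C0 ≤ _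
      linarith
    | succ j =>
      have := H1 (2 ^ (j+1)) (by positivity) x
      simp_rw [hMform]
      refine this.trans ?_
      gcongr
      linarith
  · intro j l
    cases j with
    | zero =>
      refine (hQA 0 l).trans ?_
      gcongr
      linarith
    | succ j =>
      simp only [hMs]
      calc _ ≤ ‖Q (j+1) l‖ + ‖Q j l‖ := norm_sub_le _ _
        _ ≤ A * 2 ^ (j+1) + A * 2 ^ (j+1) := by
          refine add_le_add (hQA _ _) ((hQA j l).trans ?_)
          gcongr
          · norm_num
          · omega
        _ = (2 * A) * 2 ^ (j+1) := by ring
        _ ≤ _ := by gcongr; linarith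
  · intro j
    cases j with
    | zero =>
      refine (hQsq 0).trans ?_
      gcongr
      linarith
    | succ j =>
      simp only [hMs]
      calc ∫ l, ‖Q (j+1) l - Q j l‖ ^ 2 ≤ ∫ l, (2 * ‖Q (j+1) l‖ ^ 2 + 2 * ‖Q j l‖ ^ 2) := by
            apply integral_mono
            · apply Continuous.integrable_of_hasCompactSupport
              · have := hQc j; have := hQc (j+1); fun_prop
              · exact ((hQcs _).sub (hQcs _)).comp_left (g := fun z => ‖z‖ ^ 2) (by simp)
            · exact ((hQsqi _).const_mul 2).add ((hQsqi _).const_mul 2)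
            · intro l
              simp only
              calc _ ≤ (‖Q (j+1) l‖ + ‖Q j l‖) ^ 2 := by gcongr; exact norm_sub_le _ _
                _ ≤ _ := by rw [← mul_add]; exact add_sq_le
        _ = 2 * (∫ l, ‖Q (j+1) l‖ ^ 2) + 2 * ∫ l, ‖Q j l‖ ^ 2 := by
            rw [integral_add ((hQsqi _).const_mul 2) ((hQsqi _).const_mul 2), integral_const_mul, integral_const_mul]
        _ ≤ 2 * (B * 2 ^ (j+1)) + 2 * (B * 2 ^ (j+1)) := by
            gcongr
            · exact hQsq _
            · refine (hQsq j).trans ?_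
              gcongr
              · norm_num
              · omega
        _ = (4 * B) * 2 ^ (j+1) := by ring
        _ ≤ _ := by gcongr; linarith
  · rintro F hF ⟨A', hAbd⟩ hFc
    rw [← Filter.tendsto_add_atTop_iff_nat 1]
    simp_rw [hsum]
    have := approx_id h hhi hone (fun l => (b l : ℂ) * F l)
      ((Complex.continuous_ofReal.comp hbc).stronglyMeasurable.mul hF) A' (by
        intro x
        rw [norm_mul]
        calc _ ≤ 1 * A' := by gcongr; exact hχn x; exact hAbd x
          _ = A' := one_mul _) (by
        exact (Complex.continuous_ofReal.comp hbc).continuousAt.mul hFc)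
    simp only [hχ1, ofReal_one, one_mul] at this
    refine this.congr fun J => ?_
    congr 1
    ext l
    simp only [hQ]
    ring

end

section

section
variable {X : Type*} [MeasurableSpace X]

/-- the `L^{1/α}` norm as a real number -/
def NN (μ : Measure X) (α : ℝ) (f : X → ℂ) : ℝ := (∫ x, ‖f x‖ ^ (1/α) ∂μ) ^ α

theorem NN_nonneg (μ : Measure X) (α : ℝ) (f : X → ℂ) : 0 ≤ NN μ α f :=
  Real.rpow_nonneg (integral_nonneg fun _ => by positivity) _

/-- bilinear on integrable functions, continuous for the `L¹` norm -/
structure BilinL1 (μ : Measure X) (B : (X → ℂ) → (X → ℂ) → ℂ) : Prop where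
  add_l : ∀ f f' g, Integrable f μ → Integrable f' μ → Integrable g μ →
    B (fun x => f x + f' x) g = B f g + B f' g
  smul_l : ∀ (c : ℂ) f g, Integrable f μ → Integrable g μ → B (fun x => c * f x) g = c * B f g
  add_r : ∀ f g g', Integrable f μ → Integrable g μ → Integrable g' μ →
    B f (fun x => g x + g' x) = B f g + B f g'
  smul_r : ∀ (c : ℂ) f g, Integrable f μ → Integrable g μ → B f (fun x => c * g x) = c * B f g
  bound : ∃ M, 0 ≤ M ∧ ∀ f g, Integrable f μ → Integrable g μ →
    ‖B f g‖ ≤ M * (∫ x, ‖f x‖ ∂μ) * (∫ x, ‖g x‖ ∂μ)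

theorem BilinL1.sum_l {μ : Measure X} {B : (X → ℂ) → (X → ℂ) → ℂ} (hB : BilinL1 μ B)
    {ι : Type*} (s : Finset ι) (a : ι → ℂ) (e : ι → X → ℂ) (g : X → ℂ) (hg : Integrable g μ)
    (he : ∀ i ∈ s, Integrable (e i) μ) :
    B (fun x => ∑ i ∈ s, a i * e i x) g = ∑ i ∈ s, a i * B (e i) g := by
  classical
  induction s using Finset.induction_on with
  | empty =>
    have := hB.smul_l 0 0 g (integrable_zero _ _ _) hg
    simpa using this
  | insert i s hi ih =>
    simp only [Finset.sum_insert hi]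
    rw [hB.add_l (fun x => a i * e i x) (fun x => ∑ i ∈ s, a i * e i x), hB.smul_l, ih]
    · exact fun j hj => he j (Finset.mem_insert_of_mem hj)
    · exact he i (Finset.mem_insert_self _ _)
    · exact hg
    · exact (he i (Finset.mem_insert_self _ _)).const_mul _
    · exact integrable_finsetSum _ fun j hj => (he j (Finset.mem_insert_of_mem hj)).const_mul _
    · exact hg

theorem BilinL1.sum_r {μ : Measure X} {B : (X → ℂ) → (X → ℂ) → ℂ} (hB : BilinL1 μ B)
    {ι : Type*} (s : Finset ι) (a : ι → ℂ) (e : ι → X → ℂ) (g : X → ℂ) (hg : Integrable g μ)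
    (he : ∀ i ∈ s, Integrable (e i) μ) :
    B g (fun x => ∑ i ∈ s, a i * e i x) = ∑ i ∈ s, a i * B g (e i) := by
  have hB' : BilinL1 μ (fun f g => B g f) := by
    refine ⟨?_, ?_, ?_, ?_, ?_⟩
    · intro f f' g h1 h2 h3; exact hB.add_r g f f' h3 h1 h2
    · intro c f g h1 h2; exact hB.smul_r c g f h2 h1
    · intro f f' g h1 h2 h3; exact hB.add_l f' g f h2 h3 h1
    · intro c f g h1 h2; exact hB.smul_l c g f h2 h1
    · obtain ⟨M, hM, h⟩ := hB.bound
      refine ⟨M, hM, fun f g hf hg => (h g f hg hf).trans (le_of_eq (by ring))⟩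
  exact hB'.sum_l s a e g hg he

/-- the analytic deformation -/
def rtPhi (a : ℂ) (c : ℂ) : ℂ := c * cexp ((a - 1) * (Real.log ‖c‖ : ℂ))

theorem rtPhi_zero (a : ℂ) : rtPhi a 0 = 0 := by simp [rtPhi]
theorem rtPhi_one (c : ℂ) : rtPhi 1 c = c := by simp [rtPhi]

theorem norm_rtPhi' (a : ℂ) (c : ℂ) : ‖rtPhi a c‖ = ‖c‖ * Real.exp ((a.re - 1) * Real.log ‖c‖) := by
  rw [rtPhi, norm_mul, Complex.norm_exp]
  simp

theorem norm_rtPhi (a : ℂ) (ha : 0 < a.re) (c : ℂ) : ‖rtPhi a c‖ = ‖c‖ ^ a.re := by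
  by_cases hc : c = 0
  · subst hc; rw [rtPhi_zero]; simp [ha.ne']
  · have h : 0 < ‖c‖ := norm_pos_iff.2 hc
    rw [norm_rtPhi', Real.rpow_def_of_pos h, sub_mul, one_mul, Real.exp_sub, Real.exp_log h, mul_comm (Real.log _)]
    field_simp

theorem NN_rtPhi (μ : Measure X) (α α0 : ℝ) (h : 0 < α) (h0 : 0 < α0) (a : ℂ) (ha : a.re = α0 / α)
    (f : X → ℂ) : NN μ α0 (fun x => rtPhi a (f x)) = NN μ α f ^ (α0 / α) := by
  have h1 : ∀ x, ‖rtPhi a (f x)‖ ^ (1/α0) = ‖f x‖ ^ (1/α) := by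
    intro x
    rw [norm_rtPhi a (by rw [ha]; positivity), ← Real.rpow_mul (norm_nonneg _), ha]
    congr 1
    field_simp
  simp only [NN, h1]
  rw [← Real.rpow_mul (integral_nonneg fun _ => by positivity)]
  congr 1
  field_simp

theorem simple_decomp (f : SimpleFunc X ℂ) (a : ℂ) :
    (fun x => rtPhi a (f x)) = fun x => ∑ c ∈ f.range.filter (· ≠ 0), rtPhi a c * (f ⁻¹' {c}).indicator (fun _ => (1:ℂ)) x := by
  classical
  ext x
  by_cases h0 : f x = 0
  · rw [h0, rtPhi_zero, Finset.sum_eq_zero]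
    intro c hc
    rw [Set.indicator_of_notMem, mul_zero]
    simp only [Finset.mem_filter] at hc
    simp only [Set.mem_preimage, Set.mem_singleton_iff, h0]
    exact fun h => hc.2 h.symm
  · rw [Finset.sum_eq_single (f x)]
    · simp
    · intro c _ hne
      rw [Set.indicator_of_notMem, mul_zero]
      simp only [Set.mem_preimage, Set.mem_singleton_iff]
      exact fun h => hne h.symm
    · intro hn
      exact absurd (Finset.mem_filter.2 ⟨f.mem_range_self x, h0⟩) hn

theorem riesz_thorin_simple (μ : Measure X) (B : (X → ℂ) → (X → ℂ) → ℂ) (hB : BilinL1 μ B)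
    (α0 α1 β0 β1 M0 M1 θ : ℝ) (hα0 : 0 < α0) (hα1 : 0 < α1) (hβ0 : 0 < β0) (hβ1 : 0 < β1)
    (hM0 : 0 ≤ M0) (hM1 : 0 ≤ M1) (hθ0 : 0 ≤ θ) (hθ1 : θ ≤ 1)
    (h0 : ∀ f g : SimpleFunc X ℂ, Integrable f μ → Integrable g μ → ‖B f g‖ ≤ M0 * NN μ α0 f * NN μ β0 g)
    (h1 : ∀ f g : SimpleFunc X ℂ, Integrable f μ → Integrable g μ → ‖B f g‖ ≤ M1 * NN μ α1 f * NN μ β1 g)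
    (f g : SimpleFunc X ℂ) (hf : Integrable f μ) (hg : Integrable g μ) :
    ‖B f g‖ ≤ M0 ^ (1 - θ) * M1 ^ θ * NN μ ((1 - θ) * α0 + θ * α1) f * NN μ ((1 - θ) * β0 + θ * β1) g := by
  set α := (1 - θ) * α0 + θ * α1 with hα
  set β := (1 - θ) * β0 + θ * β1 with hβ
  have convpos : ∀ x y : ℝ, 0 < x → 0 < y → 0 < (1 - θ) * x + θ * y := by
    intro x y hx hy
    rcases eq_or_lt_of_le hθ0 with h | h
    · rw [← h]; simpa using hx
    · have : 0 ≤ (1 - θ) * x := mul_nonneg (by linarith) hx.le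
      have : 0 < θ * y := mul_pos h hy
      linarith
  have hαp : 0 < α := convpos _ _ hα0 hα1
  have hβp : 0 < β := convpos _ _ hβ0 hβ1
  let A : ℂ → ℂ := fun z => ((1 - z) * α0 + z * α1) / α
  let A' : ℂ → ℂ := fun z => ((1 - z) * β0 + z * β1) / β
  have hAre : ∀ z : ℂ, (A z).re = ((1 - z.re) * α0 + z.re * α1) / α := by
    intro z
    simp only [A, Complex.div_ofReal_re]
    simp
  have hAre' : ∀ z : ℂ, (A' z).re = ((1 - z.re) * β0 + z.re * β1) / β := by
    intro z
    simp only [A', Complex.div_ofReal_re]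
    simp
  let s := f.range.filter (· ≠ 0)
  let t := g.range.filter (· ≠ 0)
  let b : ℂ → ℂ → ℂ := fun c d => B ((f ⁻¹' {c}).indicator (fun _ => (1:ℂ))) ((g ⁻¹' {d}).indicator (fun _ => (1:ℂ)))
  let G : ℂ → ℂ := fun z => ∑ c ∈ s, rtPhi (A z) c * ∑ d ∈ t, rtPhi (A' z) d * b c d
  have hindf : ∀ c ∈ s, Integrable ((f ⁻¹' {c}).indicator (fun _ => (1:ℂ))) μ := by
    intro c hc
    rw [integrable_indicator_iff (f.measurableSet_preimage _)]
    apply integrableOn_const ((SimpleFunc.integrable_iff.1 hf c (Finset.mem_filter.1 hc).2).ne)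
  have hindg : ∀ c ∈ t, Integrable ((g ⁻¹' {c}).indicator (fun _ => (1:ℂ))) μ := by
    intro c hc
    rw [integrable_indicator_iff (g.measurableSet_preimage _)]
    apply integrableOn_const ((SimpleFunc.integrable_iff.1 hg c (Finset.mem_filter.1 hc).2).ne)
  have hfi : ∀ z, Integrable (fun x => rtPhi z (f x)) μ := by
    intro z
    rw [simple_decomp f z]
    exact integrable_finsetSum _ fun c hc => (hindf c hc).const_mul _
  have hgi : ∀ z, Integrable (fun x => rtPhi z (g x)) μ := by
    intro z
    rw [simple_decomp g z]
    exact integrable_finsetSum _ fun c hc => (hindg c hc).const_mul _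
  have hG : ∀ z, G z = B (fun x => rtPhi (A z) (f x)) (fun x => rtPhi (A' z) (g x)) := by
    intro z
    have h2 := hgi (A' z)
    rw [simple_decomp f (A z)]
    rw [hB.sum_l _ _ _ _ h2 hindf]
    apply Finset.sum_congr rfl
    intro c hc
    congr 1
    rw [simple_decomp g (A' z), hB.sum_r _ _ _ _ (hindf c hc) hindg]
  have hcoe : ∀ (k : SimpleFunc X ℂ) (z : ℂ), (fun x => rtPhi z (k x)) = ⇑(k.map (rtPhi z)) := by
    intro k z; rfl
  have hdiff : Differentiable ℂ G := by
    have hA : Differentiable ℂ A := by simp only [A]; fun_prop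
    have hAbd : Differentiable ℂ A' := by simp only [A']; fun_prop
    simp only [G, rtPhi]
    fun_prop
  have hmain := HadamardThreeLines.norm_le_interp_of_mem_verticalClosedStrip₀₁' G (z := (θ : ℂ))
    (a := M0 * NN μ α f ^ (α0/α) * NN μ β g ^ (β0/β))
    (b := M1 * NN μ α f ^ (α1/α) * NN μ β g ^ (β1/β))
    (by simp [HadamardThreeLines.verticalClosedStrip, hθ0, hθ1])
    hdiff.diffContOnCl
    (by
      let gb : ℝ → ℝ := fun u => ∑ c ∈ s, (‖c‖ * Real.exp ((((1 - u) * α0 + u * α1) / α - 1) * Real.log ‖c‖)) *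
        ∑ d ∈ t, (‖d‖ * Real.exp ((((1 - u) * β0 + u * β1) / β - 1) * Real.log ‖d‖)) * ‖b c d‖
      have hgb : Continuous gb := by simp only [gb]; fun_prop
      obtain ⟨K, hK⟩ := (isCompact_Icc (a := (0:ℝ)) (b := 1)).bddAbove_image hgb.continuousOn
      refine ⟨K, ?_⟩
      rintro _ ⟨z, hz, rfl⟩
      refine le_trans ?_ (hK ⟨z.re, hz, rfl⟩)
      simp only [Function.comp, G, gb]
      refine (norm_sum_le _ _).trans (Finset.sum_le_sum fun c _ => ?_)
      rw [norm_mul, norm_rtPhi', hAre]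
      gcongr
      refine (norm_sum_le _ _).trans (Finset.sum_le_sum fun d _ => ?_)
      rw [norm_mul, norm_rtPhi', hAre'])
    (by
      intro z hz
      simp only [Set.mem_preimage, Set.mem_singleton_iff] at hz
      rw [hG, ← NN_rtPhi μ α α0 hαp hα0 (A z) (by rw [hAre, hz]; ring),
        ← NN_rtPhi μ β β0 hβp hβ0 (A' z) (by rw [hAre', hz]; ring), hcoe, hcoe]
      apply h0
      · rw [← hcoe]; exact hfi _
      · rw [← hcoe]; exact hgi _)
    (by
      intro z hz
      simp only [Set.mem_preimage, Set.mem_singleton_iff] at hz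
      rw [hG, ← NN_rtPhi μ α α1 hαp hα1 (A z) (by rw [hAre, hz]; ring),
        ← NN_rtPhi μ β β1 hβp hβ1 (A' z) (by rw [hAre', hz]; ring), hcoe, hcoe]
      apply h1
      · rw [← hcoe]; exact hfi _
      · rw [← hcoe]; exact hgi _)
  have hA1 : A (θ : ℂ) = 1 := by
    simp only [A]
    rw [div_eq_one_iff_eq (by exact_mod_cast hαp.ne'), hα]
    push_cast; ring
  have hA1' : A' (θ : ℂ) = 1 := by
    simp only [A']
    rw [div_eq_one_iff_eq (by exact_mod_cast hβp.ne'), hβ]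
    push_cast; ring
  rw [hG, hA1, hA1'] at hmain
  simp only [rtPhi_one, Complex.ofReal_re] at hmain
  refine hmain.trans (le_of_eq ?_)
  have hcomb : ∀ x a b c : ℝ, 0 ≤ x → 0 < c → 0 < a → 0 < b → (1 - θ) * a + θ * b = c →
      (x ^ (a/c)) ^ (1 - θ) * (x ^ (b/c)) ^ θ = x := by
    intro x a b c hx hc ha hb h
    rw [← Real.rpow_mul hx, ← Real.rpow_mul hx, ← Real.rpow_add_of_nonneg hx]
    · have : a / c * (1 - θ) + b / c * θ = 1 := by
        have e : a / c * (1 - θ) + b / c * θ = ((1-θ)*a+θ*b)/c := by ring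
        rw [e, h, div_self hc.ne']
      rw [this, Real.rpow_one]
    · exact mul_nonneg (by positivity) (by linarith)
    · positivity
  have e1 := hcomb (NN μ α f) α0 α1 α (NN_nonneg _ _ _) hαp hα0 hα1 hα.symm
  have e2 := hcomb (NN μ β g) β0 β1 β (NN_nonneg _ _ _) hβp hβ0 hβ1 hβ.symm
  have n1 := NN_nonneg μ α f
  have n2 := NN_nonneg μ β g
  rw [Real.mul_rpow (by positivity) (by positivity), Real.mul_rpow hM0 (by positivity),
    Real.mul_rpow (by positivity) (by positivity), Real.mul_rpow hM1 (by positivity)]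
  calc _ = M0 ^ (1-θ) * M1 ^ θ * ((NN μ α f ^ (α0/α)) ^ (1 - θ) * (NN μ α f ^ (α1/α)) ^ θ) *
        ((NN μ β g ^ (β0/β)) ^ (1 - θ) * (NN μ β g ^ (β1/β)) ^ θ) := by ring
    _ = _ := by rw [e1, e2]
end

end

section

section
variable {X : Type*} [MeasurableSpace X]

/-- measurable bounded integrable functions -/
structure SS (μ : Measure X) (f : X → ℂ) : Prop where
  meas : Measurable f
  int : Integrable f μ
  bdd : ∃ C, ∀ x, ‖f x‖ ≤ C

theorem SS.integrable_rpow {μ : Measure X} {f : X → ℂ} (hf : SS μ f) {p : ℝ} (hp : 1 ≤ p) :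
    Integrable (fun x => ‖f x‖ ^ p) μ := by
  obtain ⟨C, hC⟩ := hf.bdd
  have hC0 : 0 ≤ |C| := abs_nonneg C
  refine (hf.int.norm.const_mul (|C| ^ (p-1))).mono' ?_ ?_
  · exact (hf.meas.norm.pow_const p).aestronglyMeasurable
  · filter_upwards with x
    rw [Real.norm_of_nonneg (by positivity)]
    have : ‖f x‖ ^ p = ‖f x‖ ^ (p-1) * ‖f x‖ := by
      rcases eq_or_lt_of_le (norm_nonneg (f x)) with h | h
      · rw [← h]; simp; rw [Real.zero_rpow]; linarith
      · rw [← Real.rpow_add_one h.ne']; ring_nf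
    rw [this]
    have h3 : ‖f x‖ ^ (p-1) ≤ |C| ^ (p-1) :=
      Real.rpow_le_rpow (norm_nonneg _) ((hC x).trans (le_abs_self _)) (by linarith)
    exact mul_le_mul_of_nonneg_right h3 (norm_nonneg _)

theorem SS.NN_le {μ : Measure X} {f g : X → ℂ} (hf : SS μ f) {α c : ℝ} (hα : 0 < α) (hα1 : α ≤ 1)
    (hc : 0 ≤ c) (h : ∀ x, ‖g x‖ ≤ c * ‖f x‖) : NN μ α g ≤ c * NN μ α f := by
  unfold NN
  have h1 : ∫ x, ‖g x‖ ^ (1/α) ∂μ ≤ c ^ (1/α) * ∫ x, ‖f x‖ ^ (1/α) ∂μ := by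
    rw [← integral_const_mul]
    apply integral_mono_of_nonneg
    · filter_upwards with x; positivity
    · exact (hf.integrable_rpow (by rw [le_div_iff₀ hα]; linarith)).const_mul _
    · filter_upwards with x
      rw [← Real.mul_rpow hc (norm_nonneg _)]
      exact Real.rpow_le_rpow (norm_nonneg _) (h x) (by positivity)
  calc _ ≤ (c ^ (1/α) * ∫ x, ‖f x‖ ^ (1/α) ∂μ) ^ α :=
        Real.rpow_le_rpow (integral_nonneg fun _ => by positivity) h1 hα.le
    _ = _ := by
      rw [Real.mul_rpow (by positivity) (integral_nonneg fun _ => by positivity),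
        ← Real.rpow_mul hc, one_div_mul_cancel hα.ne', Real.rpow_one]

theorem SS.approx {μ : Measure X} {f : X → ℂ} (hf : SS μ f) :
    ∃ F : ℕ → SimpleFunc X ℂ, (∀ k, Integrable (F k) μ) ∧ (∀ k x, ‖F k x‖ ≤ 2 * ‖f x‖) ∧
      Filter.Tendsto (fun k => ∫ x, ‖F k x - f x‖ ∂μ) Filter.atTop (nhds 0) := by
  have hle : ∀ k x, ‖SimpleFunc.approxOn f hf.meas Set.univ 0 trivial k x‖ ≤ 2 * ‖f x‖ := by
    intro k x
    have := SimpleFunc.norm_approxOn_zero_le hf.meas (s := Set.univ) (h₀ := trivial) x k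
    linarith
  refine ⟨fun k => SimpleFunc.approxOn f hf.meas Set.univ 0 trivial k, ?_, hle, ?_⟩
  · intro k
    refine (hf.int.norm.const_mul 2).mono' (SimpleFunc.aestronglyMeasurable _) ?_
    filter_upwards with x using hle k x
  · have : (0:ℝ) = ∫ x, (0:ℝ) ∂μ := by simp
    rw [this]
    apply tendsto_integral_of_dominated_convergence (fun x => 3 * ‖f x‖)
    · intro k
      exact ((SimpleFunc.aestronglyMeasurable _).sub hf.meas.aestronglyMeasurable).norm
    · exact hf.int.norm.const_mul 3
    · intro k
      filter_upwards with x
      rw [norm_norm]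
      have := norm_sub_le (SimpleFunc.approxOn f hf.meas Set.univ 0 trivial k x) (f x)
      linarith [hle k x]
    · filter_upwards with x
      have := SimpleFunc.tendsto_approxOn hf.meas (s := Set.univ) (y₀ := 0) trivial (x := x) (by simp)
      exact tendsto_iff_norm_sub_tendsto_zero.1 this

/-- boundedness of a bilinear form -/
def Bd (μ : Measure X) (B : (X → ℂ) → (X → ℂ) → ℂ) (α β M : ℝ) : Prop :=
  ∀ f g, SS μ f → SS μ g → ‖B f g‖ ≤ M * NN μ α f * NN μ β g

theorem SS.of_simple {μ : Measure X} (F : SimpleFunc X ℂ) (h : Integrable F μ) : SS μ F :=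
  ⟨F.measurable, h, F.exists_forall_norm_le⟩

theorem BilinL1.tendsto {μ : Measure X} {B : (X → ℂ) → (X → ℂ) → ℂ} (hB : BilinL1 μ B)
    {f g : X → ℂ} {F G : ℕ → X → ℂ} (hf : Integrable f μ) (hg : Integrable g μ)
    (hF : ∀ k, Integrable (F k) μ) (hG : ∀ k, Integrable (G k) μ)
    (h1 : Filter.Tendsto (fun k => ∫ x, ‖F k x - f x‖ ∂μ) Filter.atTop (nhds 0))
    (h2 : Filter.Tendsto (fun k => ∫ x, ‖G k x - g x‖ ∂μ) Filter.atTop (nhds 0)) :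
    Filter.Tendsto (fun k => B (F k) (G k)) Filter.atTop (nhds (B f g)) := by
  obtain ⟨M, hM, hb⟩ := hB.bound
  have e : ∀ k, B (F k) (G k) = B f g + B (fun x => F k x - f x) g + B f (fun x => G k x - g x)
      + B (fun x => F k x - f x) (fun x => G k x - g x) := by
    intro k
    have i1 := (hF k).sub hf
    have i2 := (hG k).sub hg
    have a1 := hB.add_l f (fun x => F k x - f x) (G k) hf i1 (hG k)
    have a2 := hB.add_r f g (fun x => G k x - g x) hf hg i2
    have a3 := hB.add_r (fun x => F k x - f x) g (fun x => G k x - g x) i1 hg i2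
    simp only [add_sub_cancel] at a1 a2 a3
    rw [a1, a2, a3]; ring
  have z1 : Filter.Tendsto (fun k => B (fun x => F k x - f x) g) Filter.atTop (nhds 0) := by
    apply squeeze_zero_norm (fun k => hb _ _ ((hF k).sub hf) hg)
    have := (h1.const_mul M).mul_const (∫ x, ‖g x‖ ∂μ)
    simpa using this
  have z2 : Filter.Tendsto (fun k => B f (fun x => G k x - g x)) Filter.atTop (nhds 0) := by
    apply squeeze_zero_norm (fun k => hb _ _ hf ((hG k).sub hg))
    have := (h2.const_mul (M * (∫ x, ‖f x‖ ∂μ)))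
    simpa using this
  have z3 : Filter.Tendsto (fun k => B (fun x => F k x - f x) (fun x => G k x - g x))
      Filter.atTop (nhds 0) := by
    apply squeeze_zero_norm (fun k => hb _ _ ((hF k).sub hf) ((hG k).sub hg))
    have := (h1.const_mul M).mul h2
    simpa using this
  simp only [e]
  simpa using (((tendsto_const_nhds (x := B f g)).add z1).add z2).add z3

theorem riesz_thorin {μ : Measure X} {B : (X → ℂ) → (X → ℂ) → ℂ} (hB : BilinL1 μ B)
    {α0 β0 M0 α1 β1 M1 : ℝ} (hα0 : 0 < α0) (hβ0 : 0 < β0) (hα1 : 0 < α1) (hβ1 : 0 < β1)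
    (hα0' : α0 ≤ 1) (hβ0' : β0 ≤ 1) (hα1' : α1 ≤ 1) (hβ1' : β1 ≤ 1)
    (hM0 : 0 ≤ M0) (hM1 : 0 ≤ M1) (h0 : Bd μ B α0 β0 M0) (h1 : Bd μ B α1 β1 M1)
    {θ : ℝ} (hθ0 : 0 ≤ θ) (hθ1 : θ ≤ 1) :
    Bd μ B ((1-θ)*α0+θ*α1) ((1-θ)*β0+θ*β1) (4 * (M0^(1-θ) * M1^θ)) := by
  intro f g hf hg
  obtain ⟨F, hF, hF2, hF3⟩ := hf.approx
  obtain ⟨G, hG, hG2, hG3⟩ := hg.approx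
  have hlim := hB.tendsto hf.int hg.int hF hG hF3 hG3
  have key : ∀ a b : ℝ, 0 < a → 0 < b → a ≤ 1 → b ≤ 1 → 0 < (1-θ)*a+θ*b ∧ (1-θ)*a+θ*b ≤ 1 := by
    intro a b ha hb ha' hb'
    constructor
    · rcases eq_or_lt_of_le hθ0 with h | h
      · rw [← h]; linarith
      · have := mul_pos h hb
        have := mul_nonneg (sub_nonneg.2 hθ1) ha.le
        linarith
    · nlinarith
  obtain ⟨ka, ka'⟩ := key α0 α1 hα0 hα1 hα0' hα1'
  obtain ⟨kb, kb'⟩ := key β0 β1 hβ0 hβ1 hβ0' hβ1'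
  refine le_of_tendsto hlim.norm (Filter.Eventually.of_forall fun k => ?_)
  have := riesz_thorin_simple μ B hB α0 α1 β0 β1 M0 M1 θ hα0 hα1 hβ0 hβ1 hM0 hM1 hθ0 hθ1
    (fun f g hf hg => h0 f g (SS.of_simple f hf) (SS.of_simple g hg))
    (fun f g hf hg => h1 f g (SS.of_simple f hf) (SS.of_simple g hg)) (F k) (G k) (hF k) (hG k)
  refine this.trans ?_
  have n1 := hf.NN_le ka ka' (by norm_num : (0:ℝ) ≤ 2) (hF2 k)
  have n2 := hg.NN_le kb kb' (by norm_num : (0:ℝ) ≤ 2) (hG2 k)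
  have hMM : 0 ≤ M0^(1-θ) * M1^θ := by positivity
  have p1 := NN_nonneg μ ((1-θ)*α0+θ*α1) f
  have p2 := NN_nonneg μ ((1-θ)*β0+θ*β1) (G k)
  calc _ ≤ M0^(1-θ) * M1^θ * (2 * NN μ ((1-θ)*α0+θ*α1) f) * (2 * NN μ ((1-θ)*β0+θ*β1) g) := by
        gcongr
    _ = _ := by ring
end

end

section

section
variable {n : ℕ}

/-- the Mathlib Fourier transform on functions -/
def FTu (f : EuclideanSpace ℝ (Fin n) → ℂ) : EuclideanSpace ℝ (Fin n) → ℂ :=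
  FourierTransform.fourier f

open FourierTransform in
theorem L1L2_fourier_ae (f : EuclideanSpace ℝ (Fin n) → ℂ) (h1 : Integrable f) (h2 : MemLp f 2) :
    (𝓕 (h2.toLp f) : Lp (α := EuclideanSpace ℝ (Fin n)) ℂ 2) =ᵐ[volume] FTu f := by
  have hcont : Continuous (FTu f) :=
    VectorFourier.fourierIntegral_continuous Real.continuous_fourierChar
      (L := innerₗ (EuclideanSpace ℝ (Fin n))) (by exact continuous_inner) h1
  apply ae_eq_of_integral_contDiff_smul_eq
  · exact (Lp.memLp _).locallyIntegrable (by norm_num)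
  · exact hcont.locallyIntegrable
  · intro g g_smooth g_cpt
    have hg₁ : HasCompactSupport (Complex.ofRealCLM ∘ g) := g_cpt.comp_left rfl
    have hg₂ : ContDiff ℝ (⊤ : ℕ∞) (Complex.ofRealCLM ∘ g) := by fun_prop
    set G := hg₁.toSchwartzMap hg₂ with hG
    have e := congrArg (fun T => T G) (Lp.fourier_toTemperedDistribution_eq (h2.toLp f))
    simp only [TemperedDistribution.fourier_apply, Lp.toTemperedDistribution_apply] at e
    have e2 : ∫ x, G x • (𝓕 (h2.toLp f) : Lp (α := EuclideanSpace ℝ (Fin n)) ℂ 2 volume) x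
       = ∫ x, (𝓕 G) x • f x := by
      rw [← e]
      apply integral_congr_ae
      filter_upwards [MemLp.coeFn_toLp h2] with x hx
      rw [hx]
    have e3 : ∫ x, (FTu (G : EuclideanSpace ℝ (Fin n) → ℂ)) x • f x = ∫ x, G x • FTu f x := by
      simpa using! VectorFourier.integral_fourierIntegral_smul_eq_flip (L := innerₗ (EuclideanSpace ℝ (Fin n))) (μ := volume) (ν := volume)
         Real.continuous_fourierChar (by exact continuous_inner) G.integrable h1
    have e4 := e2.trans e3
    simpa [hG] using e4

theorem FT_eq_fourier (f : EuclideanSpace ℝ (Fin n) → ℂ) (ξ : EuclideanSpace ℝ (Fin n)) :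
    FT f ξ = FTu f ((2 * Real.pi)⁻¹ • ξ) := by
  rw [FTu, Real.fourier_eq']
  unfold FT
  congr 1; ext x
  rw [smul_eq_mul]
  congr 2
  rw [inner_smul_right]
  have := Real.pi_pos.ne'
  push_cast
  field_simp

theorem FT_continuous {f : EuclideanSpace ℝ (Fin n) → ℂ} (h1 : Integrable f) : Continuous (FT f) := by
  have hcont : Continuous (FTu f) :=
    VectorFourier.fourierIntegral_continuous Real.continuous_fourierChar
      (L := innerₗ (EuclideanSpace ℝ (Fin n))) (by exact continuous_inner) h1
  have : FT f = fun ξ => FTu f ((2 * Real.pi)⁻¹ • ξ) := by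
    ext ξ; exact FT_eq_fourier f ξ
  rw [this]
  exact hcont.comp (continuous_const_smul _)

theorem FT_norm_le (f : EuclideanSpace ℝ (Fin n) → ℂ) (ξ : EuclideanSpace ℝ (Fin n)) :
    ‖FT f ξ‖ ≤ ∫ x, ‖f x‖ := by
  refine (norm_integral_le_integral_norm _).trans (le_of_eq ?_)
  congr 1; ext x
  rw [norm_mul, Complex.norm_exp]; simp

theorem FT_plancherel (f : EuclideanSpace ℝ (Fin n) → ℂ) (h1 : Integrable f) (h2 : MemLp f 2) :
    MemLp (FT f) 2 ∧ ∫ ξ, ‖FT f ξ‖^2 = (2 * Real.pi)^n * ∫ x, ‖f x‖^2 := by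
  have hae := L1L2_fourier_ae f h1 h2
  have hm : MemLp (FTu f) 2 := (memLp_congr_ae hae).1 (Lp.memLp _)
  have hπ : (2 * Real.pi)⁻¹ ≠ 0 := by positivity
  have hEQ : FT f = fun ξ => FTu f ((2 * Real.pi)⁻¹ • ξ) := by
    ext ξ; exact FT_eq_fourier f ξ
  have hIntg : ∫ ξ, ‖FT f ξ‖^2 = (2 * Real.pi)^n * ∫ ξ, ‖FTu f ξ‖^2 := by
    rw [hEQ]
    rw [Measure.integral_comp_smul volume (fun ξ => ‖FTu f ξ‖^2)]
    simp only [finrank_euclideanSpace, Fintype.card_fin, smul_eq_mul]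
    congr 1
    rw [inv_pow, inv_inv, abs_of_pos (by positivity)]
  constructor
  · rw [memLp_two_iff_integrable_sq_norm (FT_continuous h1).aestronglyMeasurable]
    rw [hEQ]
    have := (memLp_two_iff_integrable_sq_norm hm.1).1 hm
    exact this.comp_smul hπ
  · rw [hIntg]
    congr 1
    have hn := Lp.norm_fourier_eq (h2.toLp f)
    have hn2 : ∀ g : Lp (α := EuclideanSpace ℝ (Fin n)) ℂ 2, ∫ x, ‖g x‖^2 = ‖g‖^2 := by
      intro g
      have := L2.inner_def (𝕜 := ℂ) g g
      rw [inner_self_eq_norm_sq_to_K] at this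
      have h3 : ∀ x, inner ℂ (g x) (g x) = ((‖g x‖^2 : ℝ) : ℂ) := by
        intro x; rw [inner_self_eq_norm_sq_to_K]; simp
      simp only [h3] at this
      rw [integral_complex_ofReal] at this
      have h4 := congrArg Complex.re this.symm
      rw [Complex.ofReal_re] at h4
      rw [h4]; simp [← Complex.ofReal_pow]
    have a1 := hn2 (h2.toLp f)
    have a2 := hn2 (FourierTransform.fourier (h2.toLp f))
    rw [hn, ← a1] at a2
    have e1 : ∫ x, ‖FTu f x‖^2 = ∫ x, ‖(FourierTransform.fourier (h2.toLp f) : Lp (α := EuclideanSpace ℝ (Fin n)) ℂ 2) x‖^2 := by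
      apply integral_congr_ae
      filter_upwards [hae] with x hx
      rw [hx]
    have e2 : ∫ x, ‖f x‖^2 = ∫ x, ‖h2.toLp f x‖^2 := by
      apply integral_congr_ae
      filter_upwards [MemLp.coeFn_toLp h2] with x hx
      rw [hx]
    rw [e1, e2, a2]
end

end

section

section
variable {n : ℕ}

/-- the basic bilinear form -/
def BF (ν : Measure (EuclideanSpace ℝ (Fin n))) (W : EuclideanSpace ℝ (Fin n) → ℂ)
    (f g : EuclideanSpace ℝ (Fin n) → ℂ) : ℂ := ∫ ξ, W ξ * (FT f ξ * FT g (-ξ)) ∂ν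

theorem norm_cexp_I_mul (t : ℝ) : ‖cexp (I * (t : ℂ))‖ = 1 := by
  rw [Complex.norm_exp]; simp

theorem FT_integrand_integrable {f : EuclideanSpace ℝ (Fin n) → ℂ} (hf : Integrable f)
    (ξ : EuclideanSpace ℝ (Fin n)) :
    Integrable (fun x => Complex.exp (-Complex.I * (⟪x, ξ⟫ : ℂ)) * f x) := by
  refine hf.norm.mono' ?_ ?_
  · refine AEStronglyMeasurable.mul (Continuous.aestronglyMeasurable ?_) hf.1
    fun_prop
  · filter_upwards with x
    rw [norm_mul, Complex.norm_exp]; simp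

theorem FT_add {f g : EuclideanSpace ℝ (Fin n) → ℂ} (hf : Integrable f) (hg : Integrable g) (ξ) :
    FT (fun x => f x + g x) ξ = FT f ξ + FT g ξ := by
  unfold FT
  rw [← integral_add (FT_integrand_integrable hf ξ) (FT_integrand_integrable hg ξ)]
  congr 1; ext x; ring

theorem FT_smul (c : ℂ) (f : EuclideanSpace ℝ (Fin n) → ℂ) (ξ) :
    FT (fun x => c * f x) ξ = c * FT f ξ := by
  unfold FT
  rw [← integral_const_mul]
  congr 1; ext x; ring

theorem BF_integrable {ν : Measure (EuclideanSpace ℝ (Fin n))} {W : EuclideanSpace ℝ (Fin n) → ℂ}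
    (hW : Integrable W ν) {f g : EuclideanSpace ℝ (Fin n) → ℂ} (hf : Integrable f) (hg : Integrable g) :
    Integrable (fun ξ => W ξ * (FT f ξ * FT g (-ξ))) ν := by
  refine (hW.norm.mul_const ((∫ x, ‖f x‖) * (∫ x, ‖g x‖))).mono' ?_ ?_
  · apply hW.1.mul
    exact ((FT_continuous hf).mul ((FT_continuous hg).comp continuous_neg)).aestronglyMeasurable
  · filter_upwards with ξ
    rw [norm_mul, norm_mul]
    gcongr
    · exact FT_norm_le f ξ
    · exact FT_norm_le g _

theorem BF_bilin {ν : Measure (EuclideanSpace ℝ (Fin n))} {W : EuclideanSpace ℝ (Fin n) → ℂ}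
    (hW : Integrable W ν) : BilinL1 volume (BF ν W) := by
  refine ⟨?_, ?_, ?_, ?_, ?_⟩
  · intro f f' g hf hf' hg
    unfold BF
    rw [← integral_add (BF_integrable hW hf hg) (BF_integrable hW hf' hg)]
    congr 1; ext ξ; rw [FT_add hf hf']; ring
  · intro c f g hf hg
    unfold BF
    rw [← integral_const_mul]
    congr 1; ext ξ; rw [FT_smul]; ring
  · intro f g g' hf hg hg'
    unfold BF
    rw [← integral_add (BF_integrable hW hf hg) (BF_integrable hW hf hg')]
    congr 1; ext ξ; rw [FT_add hg hg']; ring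
  · intro c f g hf hg
    unfold BF
    rw [← integral_const_mul]
    congr 1; ext ξ; rw [FT_smul]; ring
  · refine ⟨∫ ξ, ‖W ξ‖ ∂ν, integral_nonneg fun _ => norm_nonneg _, ?_⟩
    intro f g hf hg
    unfold BF
    calc _ ≤ ∫ ξ, ‖W ξ‖ * ((∫ x, ‖f x‖) * (∫ x, ‖g x‖)) ∂ν := by
          apply norm_integral_le_of_norm_le (hW.norm.mul_const _)
          filter_upwards with ξ
          rw [norm_mul, norm_mul]
          gcongr
          · exact FT_norm_le f ξ
          · exact FT_norm_le g _
      _ = _ := by rw [integral_mul_const]; ring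

/-- Fubini -/
theorem osc_fubini {ν : Measure (EuclideanSpace ℝ (Fin n))} [SFinite ν]
    {H g : EuclideanSpace ℝ (Fin n) → ℂ} (hH : Integrable H ν) (hg : Integrable g)
    (ψ : EuclideanSpace ℝ (Fin n) → EuclideanSpace ℝ (Fin n) → ℝ)
    (hψ : Continuous (fun z : EuclideanSpace ℝ (Fin n) × EuclideanSpace ℝ (Fin n) => ψ z.1 z.2)) :
    ∫ ξ, H ξ * (∫ x, cexp (I * (ψ x ξ : ℂ)) * g x) ∂ν =
    ∫ x, g x * (∫ ξ, H ξ * cexp (I * (ψ x ξ : ℂ)) ∂ν) := by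
  have hIntg : Integrable (fun z : EuclideanSpace ℝ (Fin n) × EuclideanSpace ℝ (Fin n) =>
      H z.1 * (cexp (I * (ψ z.2 z.1 : ℂ)) * g z.2)) (ν.prod volume) := by
    refine ((hH.mul_prod hg).norm).mono' ?_ ?_
    · refine (hH.1.comp_fst).mul (AEStronglyMeasurable.mul ?_ hg.1.comp_snd)
      apply Continuous.aestronglyMeasurable
      have : Continuous (fun z : EuclideanSpace ℝ (Fin n) × EuclideanSpace ℝ (Fin n) => ψ z.2 z.1) :=
        hψ.comp continuous_swap
      fun_prop
    · filter_upwards with z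
      rw [norm_mul, norm_mul, norm_cexp_I_mul, norm_mul, one_mul]
  calc _ = ∫ ξ, (∫ x, H ξ * (cexp (I * (ψ x ξ : ℂ)) * g x)) ∂ν := by
        congr 1; ext ξ; rw [integral_const_mul]
    _ = ∫ x, ∫ ξ, H ξ * (cexp (I * (ψ x ξ : ℂ)) * g x) ∂ν := integral_integral_swap hIntg
    _ = _ := by
        congr 1; ext x; rw [← integral_const_mul]
        congr 1; ext ξ; ring

theorem FT_neg (g : EuclideanSpace ℝ (Fin n) → ℂ) (ξ) :
    FT g (-ξ) = ∫ x, cexp (I * (⟪x, ξ⟫ : ℂ)) * g x := by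
  unfold FT; congr 1; ext x; rw [inner_neg_right]; push_cast; congr 2; ring

theorem BF_eq_pair {ν : Measure (EuclideanSpace ℝ (Fin n))} [SFinite ν] {W : EuclideanSpace ℝ (Fin n) → ℂ}
    (hW : Integrable W ν) {f g : EuclideanSpace ℝ (Fin n) → ℂ} (hf : Integrable f) (hg : Integrable g) :
    BF ν W f g = ∫ x, g x * (∫ ξ, W ξ * FT f ξ * cexp (I * (⟪x, ξ⟫ : ℂ)) ∂ν) := by
  unfold BF
  have hH : Integrable (fun ξ => W ξ * FT f ξ) ν := by
    refine (hW.norm.mul_const (∫ x, ‖f x‖)).mono' (hW.1.mul (FT_continuous hf).aestronglyMeasurable) ?_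
    filter_upwards with ξ
    rw [norm_mul]
    gcongr
    exact FT_norm_le f ξ
  rw [← osc_fubini hH hg (fun x ξ => ⟪x, ξ⟫) (by fun_prop)]
  congr 1; ext ξ
  rw [FT_neg]; ring

theorem BF_L1_bound {ν : Measure (EuclideanSpace ℝ (Fin n))} [SFinite ν] {W : EuclideanSpace ℝ (Fin n) → ℂ}
    (hW : Integrable W ν) (D : ℝ) (hD : ∀ x : EuclideanSpace ℝ (Fin n), ‖∫ ξ, W ξ * cexp (I * (⟪x, ξ⟫ : ℂ)) ∂ν‖ ≤ D) :
    Bd volume (BF ν W) 1 1 D := by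
  intro f g hf hg
  have key : ∀ y, ‖∫ ξ, W ξ * FT f ξ * cexp (I * (⟪y, ξ⟫ : ℂ)) ∂ν‖ ≤ D * ∫ x, ‖f x‖ := by
    intro y
    have hH : Integrable (fun ξ => W ξ * cexp (I * (⟪y, ξ⟫ : ℂ))) ν := by
      refine hW.norm.mono' (hW.1.mul (Continuous.aestronglyMeasurable (by fun_prop))) ?_
      filter_upwards with ξ
      rw [norm_mul, norm_cexp_I_mul, mul_one]
    have e := osc_fubini hH hf.int (fun x ξ => ⟪-x, ξ⟫) (by fun_prop)
    have e1 : ∫ ξ, W ξ * FT f ξ * cexp (I * (⟪y, ξ⟫ : ℂ)) ∂ν = ∫ ξ, W ξ * cexp (I * (⟪y, ξ⟫ : ℂ)) *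
        (∫ x, cexp (I * ((⟪-x, ξ⟫ : ℝ) : ℂ)) * f x) ∂ν := by
      congr 1; ext ξ
      have : FT f ξ = ∫ x, cexp (I * ((⟪-x, ξ⟫ : ℝ) : ℂ)) * f x := by
        unfold FT; congr 1; ext x; rw [inner_neg_left]; push_cast; congr 2; ring
      rw [this]; ring
    rw [e1, e, ← integral_const_mul]
    apply norm_integral_le_of_norm_le (hf.int.norm.const_mul D)
    filter_upwards with x
    rw [norm_mul, mul_comm]
    gcongr
    refine le_trans (le_of_eq ?_) (hD (y - x))
    congr 2; ext ξ
    rw [mul_assoc, ← Complex.exp_add, inner_neg_left, inner_sub_left]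
    push_cast; congr 2; ring
  rw [BF_eq_pair hW hf.int hg.int]
  have hN : ∀ f : EuclideanSpace ℝ (Fin n) → ℂ, NN volume 1 f = ∫ x, ‖f x‖ := by
    intro f; unfold NN; simp
  rw [hN, hN, ← integral_const_mul]
  apply norm_integral_le_of_norm_le (hg.int.norm.const_mul _)
  filter_upwards with x
  rw [norm_mul, mul_comm]
  gcongr
  exact key x

theorem SS.memLp_two {f : EuclideanSpace ℝ (Fin n) → ℂ} (hf : SS volume f) : MemLp f 2 := by
  rw [memLp_two_iff_integrable_sq_norm hf.meas.aestronglyMeasurable]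
  have := hf.integrable_rpow (p := 2) (by norm_num)
  simpa using this

theorem NN_half (f : EuclideanSpace ℝ (Fin n) → ℂ) : NN volume (1/2) f = Real.sqrt (∫ x, ‖f x‖^2) := by
  unfold NN; rw [Real.sqrt_eq_rpow]; norm_num

theorem cs_integral {X : Type*} [MeasurableSpace X] {μ : Measure X} {u v : X → ℂ}
    (hu : MemLp u 2 μ) (hv : MemLp v 2 μ) :
    ∫ x, ‖u x‖ * ‖v x‖ ∂μ ≤ Real.sqrt (∫ x, ‖u x‖^2 ∂μ) * Real.sqrt (∫ x, ‖v x‖^2 ∂μ) := by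
  have := integral_mul_le_Lp_mul_Lq_of_nonneg (μ := μ) (f := fun x => ‖u x‖) (g := fun x => ‖v x‖)
    Real.HolderConjugate.two_two (Filter.Eventually.of_forall fun _ => norm_nonneg _)
    (Filter.Eventually.of_forall fun _ => norm_nonneg _) (by simpa using hu.norm) (by simpa using hv.norm)
  simpa [Real.sqrt_eq_rpow] using this

theorem FT_sqrt {f : EuclideanSpace ℝ (Fin n) → ℂ} (hf : SS volume f) :
    Real.sqrt (∫ ξ, ‖FT f ξ‖^2) = Real.sqrt ((2 * Real.pi)^n) * NN volume (1/2) f := by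
  rw [(FT_plancherel f hf.int hf.memLp_two).2, Real.sqrt_mul (by positivity), NN_half]

theorem BF_L2_bound {W : EuclideanSpace ℝ (Fin n) → ℂ}
    (hW : Integrable W) (D : ℝ) (hD : ∀ ξ, ‖W ξ‖ ≤ D) :
    Bd volume (BF volume W) (1/2) (1/2) (D * (2 * Real.pi)^n) := by
  intro f g hf hg
  obtain ⟨f1, -⟩ := FT_plancherel f hf.int hf.memLp_two
  obtain ⟨g1, -⟩ := FT_plancherel g hg.int hg.memLp_two
  have g1' : MemLp (fun ξ => FT g (-ξ)) 2 := by
    have := g1.comp_measurePreserving (Measure.measurePreserving_neg volume)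
    exact this
  have hcs := cs_integral f1 g1'
  have hneg : ∫ ξ, ‖FT g (-ξ)‖^2 = ∫ ξ, ‖FT g ξ‖^2 := integral_neg_eq_self (fun ξ => ‖FT g ξ‖^2) volume
  rw [hneg, FT_sqrt hf, FT_sqrt hg] at hcs
  have hD0 : 0 ≤ D := (norm_nonneg _).trans (hD 0)
  unfold BF
  calc _ ≤ ∫ ξ, D * (‖FT f ξ‖ * ‖FT g (-ξ)‖) := by
        apply norm_integral_le_of_norm_le
        · exact (f1.norm.integrable_mul g1'.norm).const_mul D
        · filter_upwards with ξ
          rw [norm_mul, norm_mul]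
          gcongr
          exact hD ξ
    _ ≤ D * (Real.sqrt ((2 * Real.pi)^n) * NN volume (1/2) f * (Real.sqrt ((2 * Real.pi)^n) * NN volume (1/2) g)) := by
        rw [integral_const_mul]; gcongr
    _ = _ := by
        have := Real.mul_self_sqrt (show 0 ≤ (2 * Real.pi)^n by positivity)
        linear_combination (D * NN volume (1/2) f * NN volume (1/2) g) * this
end

end

section

section
variable {n m : ℕ} {P : EuclideanSpace ℝ (Fin n) → ℝ}

/-- radial projection onto `P = 1` -/
def polProj (m : ℕ) (P : EuclideanSpace ℝ (Fin n) → ℝ) (ξ : EuclideanSpace ℝ (Fin n)) :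
    EuclideanSpace ℝ (Fin n) := ((P ξ) ^ (1/(m:ℝ)))⁻¹ • ξ

/-- cone measure -/
def coneM (m : ℕ) (P : EuclideanSpace ℝ (Fin n) → ℝ) : Measure (EuclideanSpace ℝ (Fin n)) :=
  Measure.map (polProj m P) (volume.restrict {ξ | P ξ ≤ 1})

/-- radial density -/
def radD (n m : ℕ) (l : ℝ) : ℝ := (n:ℝ)/m * l ^ ((n:ℝ)/m - 1)

/-- radial measure -/
def radM (n m : ℕ) : Measure ℝ :=
  (volume.restrict (Set.Ioi 0)).withDensity (fun l => ((radD n m l).toNNReal : ℝ≥0∞))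

theorem radD_meas : Measurable (radD n m) := by unfold radD; fun_prop

instance : SigmaFinite (radM n m) := by unfold radM; infer_instance

theorem radM_Ioc0 (hn : 2 ≤ n) (hm : 2 ≤ m) {a b : ℝ} (ha : 0 ≤ a) (hab : a ≤ b) :
    radM n m (Set.Ioc a b) = ENNReal.ofReal (b ^ ((n:ℝ)/m) - a ^ ((n:ℝ)/m)) := by
  have hd : 0 < (n:ℝ)/m := by
    have : 0 < n := by omega
    have : 0 < m := by omega
    positivity
  have hi : IntegrableOn (radD n m) (Set.Ioc a b) := by
    unfold radD
    have := (intervalIntegral.intervalIntegrable_rpow' (a := a) (b := b) (r := (n:ℝ)/m-1) (by linarith)).1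
    exact this.const_mul _
  rw [radM, withDensity_apply _ measurableSet_Ioc, Measure.restrict_restrict measurableSet_Ioc]
  have : Set.Ioc a b ∩ Set.Ioi 0 = Set.Ioc a b := by
    apply Set.inter_eq_left.2; intro x hx; exact lt_of_le_of_lt ha hx.1
  rw [this]
  have h2 := ofReal_integral_eq_lintegral_ofReal hi (by
    filter_upwards [ae_restrict_mem measurableSet_Ioc] with x hx
    have : 0 ≤ x := ha.trans hx.1.le
    simp only [Pi.zero_apply]; unfold radD; positivity)
  refine h2.symm.trans ?_
  congr 1
  rw [← intervalIntegral.integral_of_le hab]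
  unfold radD
  rw [intervalIntegral.integral_const_mul, integral_rpow (Or.inl (by linarith))]
  simp only [sub_add_cancel]
  field_simp

theorem radM_Ioc (hn : 2 ≤ n) (hm : 2 ≤ m) {a b : ℝ} (hab : a ≤ b) :
    radM n m (Set.Ioc a b) = ENNReal.ofReal ((max b 0) ^ ((n:ℝ)/m) - (max a 0) ^ ((n:ℝ)/m)) := by
  rw [← radM_Ioc0 hn hm (le_max_right a 0) (max_le_max_right 0 hab)]
  simp only [radM, withDensity_apply _ measurableSet_Ioc, Measure.restrict_restrict measurableSet_Ioc]
  have : Set.Ioc a b ∩ Set.Ioi 0 = Set.Ioc (max a 0) (max b 0) ∩ Set.Ioi 0 := by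
    ext x
    simp only [Set.mem_inter_iff, Set.mem_Ioc, Set.mem_Ioi, max_lt_iff, le_max_iff]
    constructor
    · rintro ⟨⟨h1, h2⟩, h3⟩; exact ⟨⟨⟨h1, h3⟩, Or.inl h2⟩, h3⟩
    · rintro ⟨⟨⟨h1, h3⟩, h2 | h2⟩, h4⟩
      · exact ⟨⟨h1, h2⟩, h3⟩
      · linarith
  rw [this]

namespace GoodP

theorem polProj_meas (hP : GoodP m P) : Measurable (polProj m P) := by
  unfold polProj
  exact ((hP.continuous.measurable.pow_const _).inv).smul measurable_id

theorem polProj_smul (hP : GoodP m P) {r : ℝ} (hr : 0 < r) (ξ) : polProj m P (r • ξ) = polProj m P ξ := by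
  unfold polProj
  rw [hP.hom, Real.mul_rpow (by positivity) (hP.nonneg ξ), ← Real.rpow_natCast, ← Real.rpow_mul hr.le,
    mul_one_div_cancel (by exact_mod_cast hP.m_ne), Real.rpow_one, smul_smul]
  congr 1
  field_simp

theorem polProj_recover (hP : GoodP m P) {ξ} (hξ : ξ ≠ 0) : (P ξ) ^ (1/(m:ℝ)) • polProj m P ξ = ξ := by
  unfold polProj
  have := hP.pos ξ hξ
  rw [smul_smul, mul_inv_cancel₀ (by positivity), one_smul]

theorem P_polProj (hP : GoodP m P) {ξ} (hξ : ξ ≠ 0) : P (polProj m P ξ) = 1 := by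
  unfold polProj
  have := hP.pos ξ hξ
  rw [hP.hom, inv_pow, ← Real.rpow_natCast, ← Real.rpow_mul this.le,
    one_div_mul_cancel (by exact_mod_cast hP.m_ne), Real.rpow_one, inv_mul_cancel₀ this.ne']

theorem nontriv (hP : GoodP m P) : Nontrivial (EuclideanSpace ℝ (Fin n)) := by
  have : Nonempty (Fin n) := ⟨⟨0, by have := hP.hn; omega⟩⟩
  infer_instance

theorem vol_zero (hP : GoodP m P) : volume ({0} : Set (EuclideanSpace ℝ (Fin n))) = 0 := by
  have := hP.nontriv
  exact measure_singleton 0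

theorem ae_ne (hP : GoodP m P) : ∀ᵐ ξ : EuclideanSpace ℝ (Fin n), ξ ≠ 0 := by
  have := hP.vol_zero
  rw [ae_iff]; simpa using this

theorem coneM_apply (hP : GoodP m P) {s : Set (EuclideanSpace ℝ (Fin n))} (hs : MeasurableSet s) :
    coneM m P s = volume (polProj m P ⁻¹' s ∩ {ξ | P ξ ≤ 1}) := by
  rw [coneM, Measure.map_apply hP.polProj_meas hs, Measure.restrict_apply (hP.polProj_meas hs)]

theorem coneM_finite (hP : GoodP m P) : IsFiniteMeasure (coneM m P) := by
  have : IsFiniteMeasure (volume.restrict {ξ | P ξ ≤ 1}) :=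
    ⟨by rw [Measure.restrict_apply_univ]; exact (hP.isCompact_le 1).measure_lt_top⟩
  unfold coneM
  infer_instance

theorem coneM_ae (hP : GoodP m P) : ∀ᵐ ω ∂(coneM m P), P ω = 1 := by
  unfold coneM
  rw [ae_map_iff hP.polProj_meas.aemeasurable (measurableSet_eq_fun hP.continuous.measurable measurable_const)]
  filter_upwards [ae_restrict_of_ae hP.ae_ne] with ξ hξ using hP.P_polProj hξ

theorem sector (hP : GoodP m P) {s : Set (EuclideanSpace ℝ (Fin n))} (hs : MeasurableSet s) {b : ℝ} (hb : 0 ≤ b) :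
    volume (polProj m P ⁻¹' s ∩ {ξ | 0 < P ξ ∧ P ξ ≤ b}) = ENNReal.ofReal (b ^ ((n:ℝ)/m)) * coneM m P s := by
  have hm0 : 0 < m := Nat.pos_of_ne_zero hP.m_ne
  have hn0 : 0 < n := by have := hP.hn; omega
  rcases eq_or_lt_of_le hb with h | h
  · subst h
    rw [Real.zero_rpow (by positivity), ENNReal.ofReal_zero, zero_mul]
    convert measure_empty (μ := volume)
    ext ξ; simp only [Set.mem_inter_iff, Set.mem_ofPred_eq, Set.mem_empty_iff_false, iff_false]
    rintro ⟨_, h1, h2⟩; linarith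
  · have h1 : coneM m P s = volume (polProj m P ⁻¹' s ∩ {ξ | 0 < P ξ ∧ P ξ ≤ 1}) := by
      rw [hP.coneM_apply hs]
      apply measure_congr
      filter_upwards [hP.ae_ne] with ξ hξ
      apply propext
      show (ξ ∈ _ ∧ P ξ ≤ 1) ↔ (ξ ∈ _ ∧ 0 < P ξ ∧ P ξ ≤ 1)
      have := hP.pos ξ hξ
      tauto
    set r := b ^ (1/(m:ℝ)) with hr
    have hr0 : 0 < r := by positivity
    have hrm : r ^ m = b := by
      rw [hr, ← Real.rpow_natCast, ← Real.rpow_mul h.le, one_div_mul_cancel (by positivity), Real.rpow_one]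
    have h2 : polProj m P ⁻¹' s ∩ {ξ | 0 < P ξ ∧ P ξ ≤ b} =
        (fun ξ => r⁻¹ • ξ) ⁻¹' (polProj m P ⁻¹' s ∩ {ξ | 0 < P ξ ∧ P ξ ≤ 1}) := by
      ext ξ
      simp only [Set.mem_inter_iff, Set.mem_preimage, Set.mem_ofPred_eq, hP.polProj_smul (inv_pos.2 hr0),
        hP.hom, inv_pow, hrm]
      rw [inv_mul_le_iff₀ h, mul_one, mul_pos_iff_of_pos_left (inv_pos.2 h)]
    rw [h2, Measure.addHaar_preimage_smul _ (inv_ne_zero hr0.ne'), h1]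
    congr 2
    rw [finrank_euclideanSpace, Fintype.card_fin, inv_pow, inv_inv, abs_of_pos (by positivity), hr,
      ← Real.rpow_natCast, ← Real.rpow_mul h.le]
    congr 1; field_simp

theorem map_sector (hP : GoodP m P) {s : Set (EuclideanSpace ℝ (Fin n))} (hs : MeasurableSet s) :
    Measure.map P (volume.restrict (polProj m P ⁻¹' s)) = coneM m P s • radM n m := by
  have hfin := hP.coneM_finite
  have hval : ∀ ⦃a b : ℝ⦄, a < b → Measure.map P (volume.restrict (polProj m P ⁻¹' s)) (Set.Ioc a b) =
      ENNReal.ofReal ((max b 0) ^ ((n:ℝ)/m) - (max a 0) ^ ((n:ℝ)/m)) * coneM m P s := by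
    intro a b hab
    rw [Measure.map_apply hP.continuous.measurable measurableSet_Ioc,
      Measure.restrict_apply (hP.continuous.measurable measurableSet_Ioc)]
    have e : (volume (P ⁻¹' Set.Ioc a b ∩ polProj m P ⁻¹' s)) =
       volume ((polProj m P ⁻¹' s ∩ {ξ | 0 < P ξ ∧ P ξ ≤ max b 0}) \ (polProj m P ⁻¹' s ∩ {ξ | 0 < P ξ ∧ P ξ ≤ max a 0})) := by
      apply measure_congr
      filter_upwards [hP.ae_ne] with ξ hξ
      apply propext
      show ((a < P ξ ∧ P ξ ≤ b) ∧ _) ↔ ((_ ∧ 0 < P ξ ∧ P ξ ≤ max b 0) ∧ ¬ (_ ∧ 0 < P ξ ∧ P ξ ≤ max a 0))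
      have := hP.pos ξ hξ
      have k : ∀ c, P ξ ≤ max c 0 ↔ P ξ ≤ c := by
        intro c; rw [le_max_iff]; constructor
        · rintro (h | h)
          · exact h
          · linarith
        · exact Or.inl
      rw [k, k, ← not_le]
      tauto
    have hms : ∀ c : ℝ, MeasurableSet (polProj m P ⁻¹' s ∩ {ξ | 0 < P ξ ∧ P ξ ≤ c}) := by
      intro c
      refine (hP.polProj_meas hs).inter ?_
      exact (measurableSet_lt measurable_const hP.continuous.measurable).inter
        (measurableSet_le hP.continuous.measurable measurable_const)
    rw [e, measure_sdiff, hP.sector hs (le_max_right _ _), hP.sector hs (le_max_right _ _),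
      ENNReal.ofReal_sub _ (by positivity), ENNReal.sub_mul]
    · intro _ _; exact measure_ne_top _ _
    · rintro ξ ⟨h1, h2, h3⟩
      exact ⟨h1, h2, h3.trans (max_le_max_right 0 hab.le)⟩
    · exact (hms _).nullMeasurableSet
    · rw [hP.sector hs (le_max_right _ _)]
      exact ENNReal.mul_ne_top ENNReal.ofReal_ne_top (measure_ne_top _ _)
  apply Measure.ext_of_Ioc'
  · intro a b hab
    rw [hval hab]
    exact ENNReal.mul_ne_top ENNReal.ofReal_ne_top (measure_ne_top _ _)
  · intro a b hab
    rw [hval hab, Measure.smul_apply, radM_Ioc hP.hn hP.hm hab.le, smul_eq_mul, mul_comm]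

theorem polar (hP : GoodP m P) :
    Measure.map (fun ξ => (P ξ, polProj m P ξ)) volume = (radM n m).prod (coneM m P) := by
  have hfin := hP.coneM_finite
  symm
  apply Measure.prod_eq
  intro s t hs ht
  rw [Measure.map_apply (hP.continuous.measurable.prodMk hP.polProj_meas) (hs.prod ht)]
  have := congrArg (fun μ => μ s) (hP.map_sector ht)
  simp only [Measure.smul_apply, smul_eq_mul] at this
  rw [mul_comm, ← this, Measure.map_apply hP.continuous.measurable hs,
    Measure.restrict_apply (hP.continuous.measurable hs)]
  rfl

theorem polar_lintegral (hP : GoodP m P) {h : EuclideanSpace ℝ (Fin n) → ℝ≥0∞} (hh : Measurable h) :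
    ∫⁻ ξ, h ξ = ∫⁻ l in Set.Ioi 0, ENNReal.ofReal (radD n m l) *
      ∫⁻ ω, h (l ^ (1/(m:ℝ)) • ω) ∂(coneM m P) := by
  have hfin := hP.coneM_finite
  have hm' : Measurable (fun z : ℝ × EuclideanSpace ℝ (Fin n) => h (z.1 ^ (1/(m:ℝ)) • z.2)) :=
    hh.comp ((measurable_fst.pow_const _).smul measurable_snd)
  calc _ = ∫⁻ ξ, h ((P ξ) ^ (1/(m:ℝ)) • polProj m P ξ) := by
        apply lintegral_congr_ae
        filter_upwards [hP.ae_ne] with ξ hξ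
        rw [hP.polProj_recover hξ]
    _ = ∫⁻ z, h (z.1 ^ (1/(m:ℝ)) • z.2) ∂((radM n m).prod (coneM m P)) := by
        rw [← hP.polar, lintegral_map hm' (hP.continuous.measurable.prodMk hP.polProj_meas)]
    _ = _ := by
        rw [lintegral_prod _ hm'.aemeasurable, radM, lintegral_withDensity_eq_lintegral_mul _
          (by exact radD_meas.ennreal_ofReal) hm'.lintegral_prod_right']
        rfl

theorem polar_integral (hP : GoodP m P) {h : EuclideanSpace ℝ (Fin n) → ℂ} (hh : StronglyMeasurable h)
    (hi : Integrable h) :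
    ∫ ξ, h ξ = ∫ l in Set.Ioi 0, (radD n m l : ℂ) * ∫ ω, h (l ^ (1/(m:ℝ)) • ω) ∂(coneM m P) := by
  have hfin := hP.coneM_finite
  have hm0 : Measurable (fun z : ℝ × EuclideanSpace ℝ (Fin n) => (z.1 ^ (1/(m:ℝ)) • z.2)) :=
    ((measurable_fst.pow_const _).smul measurable_snd)
  have hm' : StronglyMeasurable (fun z : ℝ × EuclideanSpace ℝ (Fin n) => h (z.1 ^ (1/(m:ℝ)) • z.2)) :=
    hh.comp_measurable hm0
  have hae : (fun ξ => h ((P ξ) ^ (1/(m:ℝ)) • polProj m P ξ)) =ᵐ[volume] h := by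
    filter_upwards [hP.ae_ne] with ξ hξ
    rw [hP.polProj_recover hξ]
  have hmm := hP.continuous.measurable.prodMk hP.polProj_meas
  have hi2 : Integrable (fun z : ℝ × EuclideanSpace ℝ (Fin n) => h (z.1 ^ (1/(m:ℝ)) • z.2))
      ((radM n m).prod (coneM m P)) := by
    rw [← hP.polar, integrable_map_measure hm'.aestronglyMeasurable hmm.aemeasurable]
    exact hi.congr hae.symm
  calc _ = ∫ ξ, h ((P ξ) ^ (1/(m:ℝ)) • polProj m P ξ) := integral_congr_ae hae.symm
    _ = ∫ z, h (z.1 ^ (1/(m:ℝ)) • z.2) ∂((radM n m).prod (coneM m P)) := by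
        rw [← hP.polar, integral_map hmm.aemeasurable hm'.aestronglyMeasurable]
    _ = _ := by
        rw [integral_prod _ hi2, radM, integral_withDensity_eq_integral_smul
          (by exact radD_meas.real_toNNReal)]
        apply setIntegral_congr_fun measurableSet_Ioi
        intro l hl
        have h0 : 0 ≤ radD n m l := by
          have : 0 < l := hl
          unfold radD; positivity
        simp only [NNReal.smul_def, Real.coe_toNNReal _ h0, Complex.real_smul]
end GoodP
end

end

section

section
variable {n m : ℕ} {P : EuclideanSpace ℝ (Fin n) → ℝ}

/-- bundled multipliers -/
structure Mult (P : EuclideanSpace ℝ (Fin n) → ℝ) (M : ℕ → ℝ → ℂ) (C : ℝ) : Prop where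
  Cpos : 0 < C
  cont : ∀ j, Continuous (M j)
  supp : ∀ j l, l ∉ Set.Icc (1/2 : ℝ) (3/2) → M j l = 0
  ker : ∀ j (x : EuclideanSpace ℝ (Fin n)), ‖∫ ξ, M j (P ξ) * cexp (I * (⟪x, ξ⟫ : ℂ))‖ ≤
      C * ((2:ℝ) ^ j) ^ (-((n:ℝ) - 1) / 2)
  sup : ∀ j l, ‖M j l‖ ≤ C * 2 ^ j
  l2 : ∀ j, ∫ l, ‖M j l‖ ^ 2 ≤ C * 2 ^ j
  lim : ∀ F : ℝ → ℂ, StronglyMeasurable F → (∃ A, ∀ x, ‖F x‖ ≤ A) → ContinuousAt F 1 →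
      Filter.Tendsto (fun J : ℕ => ∫ l, (∑ j ∈ Finset.range J, M j l) * F l) Filter.atTop (nhds (F 1))

theorem GoodP.exists_mult (hP : GoodP m P) : ∃ M C, Mult P M C := by
  obtain ⟨M, C, h1, h2, h3, h4, h5, h6, h7⟩ := exists_multipliers hP
  exact ⟨M, C, ⟨h1, h2, h3, h4, h5, h6, h7⟩⟩

/-- the dyadic forms -/
def BJ (P : EuclideanSpace ℝ (Fin n) → ℝ) (M : ℕ → ℝ → ℂ) (j : ℕ) :=
  BF volume (fun ξ => M j (P ξ))

/-- rates of dyadic forms -/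
def Rate (P : EuclideanSpace ℝ (Fin n) → ℝ) (M : ℕ → ℝ → ℂ) (α β e : ℝ) : Prop :=
  ∃ D, 0 ≤ D ∧ ∀ j, Bd volume (BJ P M j) α β (D * ((2:ℝ)^e)^j)

theorem Mult.W_cpt (hP : GoodP m P) {M C} (hM : Mult P M C) (j : ℕ) :
    HasCompactSupport (fun ξ => M j (P ξ)) := by
  apply HasCompactSupport.of_support_subset_isCompact (hP.isCompact_le (3/2))
  intro ξ hξ
  by_contra h
  apply hξ
  apply hM.supp
  intro h2; exact h h2.2

theorem Mult.W_int (hP : GoodP m P) {M C} (hM : Mult P M C) (j : ℕ) :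
    Integrable (fun ξ => M j (P ξ)) :=
  ((hM.cont j).comp hP.continuous).integrable_of_hasCompactSupport (hM.W_cpt hP j)

theorem Mult.bilin (hP : GoodP m P) {M C} (hM : Mult P M C) (j : ℕ) : BilinL1 volume (BJ P M j) :=
  BF_bilin (hM.W_int hP j)

theorem Mult.rate11 (hP : GoodP m P) {M C} (hM : Mult P M C) : Rate P M 1 1 (-((n:ℝ) - 1) / 2) := by
  refine ⟨C, hM.Cpos.le, fun j => ?_⟩
  have := BF_L1_bound (hM.W_int hP j) _ (hM.ker j)
  rw [← Real.rpow_natCast, ← Real.rpow_mul (by norm_num)] at this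
  rw [← Real.rpow_natCast, ← Real.rpow_mul (by norm_num), mul_comm (-((n:ℝ) - 1) / 2)]
  exact this

theorem Mult.rate22 (hP : GoodP m P) {M C} (hM : Mult P M C) : Rate P M (1/2) (1/2) 1 := by
  refine ⟨C * (2 * Real.pi)^n, mul_nonneg hM.Cpos.le (by positivity), fun j => ?_⟩
  have := BF_L2_bound (hM.W_int hP j) _ (fun ξ => hM.sup j (P ξ))
  rw [Real.rpow_one]
  have e : C * (2 * Real.pi)^n * 2^j = C * 2^j * (2 * Real.pi)^n := by ring
  rw [e]; exact this

theorem Rate.mix (hP : GoodP m P) {M C} (hM : Mult P M C) {α0 β0 e0 α1 β1 e1 θ : ℝ}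
    (h0 : Rate P M α0 β0 e0) (h1 : Rate P M α1 β1 e1)
    (hα0 : 0 < α0) (hβ0 : 0 < β0) (hα1 : 0 < α1) (hβ1 : 0 < β1)
    (hα0' : α0 ≤ 1) (hβ0' : β0 ≤ 1) (hα1' : α1 ≤ 1) (hβ1' : β1 ≤ 1) (hθ0 : 0 ≤ θ) (hθ1 : θ ≤ 1) :
    Rate P M ((1-θ)*α0+θ*α1) ((1-θ)*β0+θ*β1) ((1-θ)*e0+θ*e1) := by
  obtain ⟨D0, hD0, k0⟩ := h0
  obtain ⟨D1, hD1, k1⟩ := h1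
  refine ⟨4 * (D0^(1-θ) * D1^θ), by positivity, fun j => ?_⟩
  have := riesz_thorin (hM.bilin hP j) hα0 hβ0 hα1 hβ1 hα0' hβ0' hα1' hβ1' (by positivity) (by positivity)
    (k0 j) (k1 j) hθ0 hθ1
  convert this using 1
  rw [Real.mul_rpow hD0 (by positivity), Real.mul_rpow hD1 (by positivity)]
  have e : ((2:ℝ)^((1-θ)*e0+θ*e1))^j = (((2:ℝ)^e0)^j)^(1-θ) * (((2:ℝ)^e1)^j)^θ := by
    simp only [← Real.rpow_natCast, ← Real.rpow_mul (show (0:ℝ) ≤ 2 by norm_num)]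
    rw [← Real.rpow_add (by norm_num)]
    congr 1; ring
  rw [e]; ring

theorem Rate.symm (hP : GoodP m P) {M} {α β e : ℝ} (h : Rate P M α β e) : Rate P M β α e := by
  obtain ⟨D, hD, k⟩ := h
  refine ⟨D, hD, fun j f g hf hg => ?_⟩
  have := k j g f hg hf
  have e1 : BJ P M j f g = BJ P M j g f := by
    unfold BJ BF
    rw [← integral_neg_eq_self]
    congr 1; ext ξ
    beta_reduce
    rw [hP.even, neg_neg]; ring
  rw [e1]; refine this.trans (le_of_eq (by ring))

/-- the radial density of `f̂ ĝ` -/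
def GG (m : ℕ) (P : EuclideanSpace ℝ (Fin n) → ℝ) (f g : EuclideanSpace ℝ (Fin n) → ℂ) : ℝ → ℂ :=
  (Set.Icc (1/2:ℝ) (3/2)).indicator (fun l => (radD n m l : ℂ) *
    ∫ ω, FT f (l ^ (1/(m:ℝ)) • ω) * FT g (-(l ^ (1/(m:ℝ)) • ω)) ∂(coneM m P))

theorem GoodP.P_rpow (hP : GoodP m P) {l : ℝ} (hl : 0 < l) {ω} (hω : P ω = 1) :
    P (l ^ (1/(m:ℝ)) • ω) = l := by
  rw [hP.hom, hω, mul_one, ← Real.rpow_natCast, ← Real.rpow_mul hl.le,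
    one_div_mul_cancel (by exact_mod_cast hP.m_ne), Real.rpow_one]

theorem BJ_eq (hP : GoodP m P) {M C} (hM : Mult P M C) (j : ℕ) {f g : EuclideanSpace ℝ (Fin n) → ℂ}
    (hf : Integrable f) (hg : Integrable g) :
    BJ P M j f g = ∫ l, M j l * GG m P f g l := by
  have hfin := hP.coneM_finite
  unfold BJ BF
  rw [hP.polar_integral _ (BF_integrable (hM.W_int hP j) hf hg), ← integral_indicator measurableSet_Ioi]
  · congr 1; ext l
    by_cases hl : l ∈ Set.Icc (1/2:ℝ) (3/2)
    · have hl0 : 0 < l := by have := hl.1; linarith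
      rw [Set.indicator_of_mem (show l ∈ Set.Ioi (0:ℝ) from hl0), GG, Set.indicator_of_mem hl]
      have : ∫ ω, M j (P (l ^ (1/(m:ℝ)) • ω)) * (FT f (l ^ (1/(m:ℝ)) • ω) * FT g (-(l ^ (1/(m:ℝ)) • ω))) ∂(coneM m P)
          = ∫ ω, M j l * (FT f (l ^ (1/(m:ℝ)) • ω) * FT g (-(l ^ (1/(m:ℝ)) • ω))) ∂(coneM m P) := by
        apply integral_congr_ae
        filter_upwards [hP.coneM_ae] with ω hω
        rw [hP.P_rpow hl0 hω]
      rw [this, integral_const_mul]; ring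
    · rw [hM.supp j l hl, zero_mul]
      by_cases hl0 : l ∈ Set.Ioi (0:ℝ)
      · rw [Set.indicator_of_mem hl0]
        have : ∫ ω, M j (P (l ^ (1/(m:ℝ)) • ω)) * (FT f (l ^ (1/(m:ℝ)) • ω) * FT g (-(l ^ (1/(m:ℝ)) • ω))) ∂(coneM m P)
          = ∫ ω, (0:ℂ) ∂(coneM m P) := by
          apply integral_congr_ae
          filter_upwards [hP.coneM_ae] with ω hω
          rw [hP.P_rpow hl0 hω, hM.supp j l hl, zero_mul]
        rw [this]; simp
      · rw [Set.indicator_of_notMem hl0]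
  · apply Continuous.stronglyMeasurable
    exact ((hM.cont j).comp hP.continuous).mul
      ((FT_continuous hf).mul ((FT_continuous hg).comp continuous_neg))

theorem GG_inner_cont (hP : GoodP m P) {f g : EuclideanSpace ℝ (Fin n) → ℂ}
    (hf : Integrable f) (hg : Integrable g) :
    Continuous (fun l : ℝ => ∫ ω, FT f (l ^ (1/(m:ℝ)) • ω) * FT g (-(l ^ (1/(m:ℝ)) • ω)) ∂(coneM m P)) := by
  have hfin := hP.coneM_finite
  have hc : Continuous (fun l : ℝ => l ^ (1/(m:ℝ))) := Real.continuous_rpow_const (by positivity)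
  have h1 := FT_continuous hf
  have h2 := FT_continuous hg
  apply continuous_of_dominated (bound := fun _ => (∫ x, ‖f x‖) * (∫ x, ‖g x‖))
  · intro l
    apply Continuous.aestronglyMeasurable
    fun_prop
  · intro l
    filter_upwards with ω
    rw [norm_mul]
    gcongr
    · exact FT_norm_le f _
    · exact FT_norm_le g _
  · exact integrable_const _
  · filter_upwards with ω
    fun_prop

theorem radD_contOn : ContinuousOn (radD n m) (Set.Icc (1/2:ℝ) (3/2)) := by
  unfold radD
  apply ContinuousOn.mul continuousOn_const
  apply ContinuousOn.rpow_const continuousOn_id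
  intro x hx; left; have := hx.1; simp only [id]; intro h; rw [h] at this; norm_num at this

theorem radD_bdd (n m : ℕ) : ∃ A, 0 ≤ A ∧ ∀ l ∈ Set.Icc (1/2:ℝ) (3/2), |radD n m l| ≤ A := by
  obtain ⟨A, hA⟩ := (isCompact_Icc (a := (1/2:ℝ)) (b := 3/2)).exists_bound_of_continuousOn (radD_contOn (n := n) (m := m))
  refine ⟨A, (norm_nonneg _).trans (hA 1 (by norm_num)), hA⟩

theorem BJ_lim (hP : GoodP m P) {M C} (hM : Mult P M C) {f g : EuclideanSpace ℝ (Fin n) → ℂ}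
    (hf : Integrable f) (hg : Integrable g) :
    Filter.Tendsto (fun J : ℕ => ∑ j ∈ Finset.range J, BJ P M j f g) Filter.atTop
      (nhds ((n:ℝ)/m * BF (coneM m P) (fun _ => 1) f g)) := by
  have hfin := hP.coneM_finite
  have hcont := GG_inner_cont hP hf hg
  have hsm : StronglyMeasurable (GG m P f g) := by
    refine StronglyMeasurable.indicator ?_ measurableSet_Icc
    exact (Complex.measurable_ofReal.comp radD_meas).stronglyMeasurable.mul hcont.stronglyMeasurable
  obtain ⟨A, hA0, hA⟩ := radD_bdd n m
  have hb : ∃ A, ∀ x, ‖GG m P f g x‖ ≤ A := by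
    obtain ⟨A', hAbd⟩ := (isCompact_Icc (a := (1/2:ℝ)) (b := 3/2)).exists_bound_of_continuousOn hcont.continuousOn
    have hAbd0 : 0 ≤ A' := (norm_nonneg _).trans (hAbd 1 (by norm_num))
    refine ⟨A * A', fun l => ?_⟩
    unfold GG
    by_cases hl : l ∈ Set.Icc (1/2:ℝ) (3/2)
    · rw [Set.indicator_of_mem hl, norm_mul]
      gcongr
      · simpa using hA l hl
      · exact hAbd l hl
    · rw [Set.indicator_of_notMem hl, norm_zero]; positivity
  have hnh : Set.Icc (1/2:ℝ) (3/2) ∈ nhds (1:ℝ) := Icc_mem_nhds (by norm_num) (by norm_num)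
  have hca : ContinuousAt (GG m P f g) 1 := by
    have : ContinuousAt (fun l => (radD n m l : ℂ) *
      ∫ ω, FT f (l ^ (1/(m:ℝ)) • ω) * FT g (-(l ^ (1/(m:ℝ)) • ω)) ∂(coneM m P)) 1 := by
      apply ContinuousAt.mul _ hcont.continuousAt
      exact Complex.continuous_ofReal.continuousAt.comp (radD_contOn.continuousAt hnh)
    apply this.congr
    filter_upwards [hnh] with l hl
    unfold GG; rw [Set.indicator_of_mem hl]
  have hlim := hM.lim _ hsm hb hca
  have e1 : GG m P f g 1 = (n:ℝ)/m * BF (coneM m P) (fun _ => 1) f g := by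
    unfold GG BF
    rw [Set.indicator_of_mem (by norm_num)]
    simp [radD]
  rw [e1] at hlim
  refine hlim.congr fun J => ?_
  simp only [BJ_eq hP hM _ hf hg]
  rw [← integral_finsetSum]
  · congr 1; ext l; rw [Finset.sum_mul]
  · intro j _
    obtain ⟨A', hAbd⟩ := hb
    have hMi : Integrable (M j) := by
      apply (hM.cont j).integrable_of_hasCompactSupport
      apply HasCompactSupport.of_support_subset_isCompact (isCompact_Icc (a := (1/2:ℝ)) (b := 3/2))
      intro l hl; by_contra h; exact hl (hM.supp j l h)
    exact hMi.mul_bdd hsm.aestronglyMeasurable (Filter.Eventually.of_forall hAbd)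

/-- summation of a geometric series -/
theorem Rate.sum (hP : GoodP m P) {M C} (hM : Mult P M C) {α β e : ℝ} (h : Rate P M α β e) (he : e < 0) :
    ∃ D, 0 ≤ D ∧ Bd volume (BF (coneM m P) (fun _ => 1)) α β D := by
  obtain ⟨D, hD, k⟩ := h
  have hm0 : 0 < m := Nat.pos_of_ne_zero hP.m_ne
  have hn0 : 0 < n := by have := hP.hn; omega
  set r := (2:ℝ)^e with hr
  have hr0 : 0 ≤ r := by positivity
  have hr1 : r < 1 := Real.rpow_lt_one_of_one_lt_of_neg (by norm_num) he
  have h1r : 0 < 1 - r := by linarith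
  refine ⟨(m:ℝ)/n * (D * (1-r)⁻¹), by positivity, fun f g hf hg => ?_⟩
  have hlim := (BJ_lim hP hM hf.int hg.int).norm
  have p1 := NN_nonneg volume α f
  have p2 := NN_nonneg volume β g
  have hb : ‖((n:ℝ)/m : ℂ) * BF (coneM m P) (fun _ => 1) f g‖ ≤ D * (1-r)⁻¹ * NN volume α f * NN volume β g := by
    refine le_of_tendsto hlim (Filter.Eventually.of_forall fun J => ?_)
    calc _ ≤ ∑ j ∈ Finset.range J, D * r^j * NN volume α f * NN volume β g :=
          norm_sum_le_of_le _ fun j _ => k j f g hf hg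
      _ = D * (∑ j ∈ Finset.range J, r^j) * NN volume α f * NN volume β g := by
          rw [Finset.mul_sum, Finset.sum_mul, Finset.sum_mul]
      _ ≤ _ := by
          gcongr
          have := (summable_geometric_of_lt_one hr0 hr1).sum_le_tsum (Finset.range J) (fun i _ => by positivity)
          rwa [tsum_geometric_of_lt_one hr0 hr1] at this
  rw [norm_mul] at hb
  have hc : ‖((n:ℝ)/m : ℂ)‖ = (n:ℝ)/m := by simp
  rw [hc] at hb
  calc _ = (m:ℝ)/n * ((n:ℝ)/m * ‖BF (coneM m P) (fun _ => 1) f g‖) := by field_simp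
    _ ≤ (m:ℝ)/n * (D * (1-r)⁻¹ * NN volume α f * NN volume β g) := by gcongr
    _ = _ := by ring
end

end

section

section
variable {n m : ℕ} {P : EuclideanSpace ℝ (Fin n) → ℝ}

theorem FT_conj (f : EuclideanSpace ℝ (Fin n) → ℂ) (ξ) :
    FT (fun x => (starRingEnd ℂ) (f x)) (-ξ) = (starRingEnd ℂ) (FT f ξ) := by
  unfold FT
  rw [← integral_conj]
  congr 1; ext x
  rw [map_mul, ← Complex.exp_conj, inner_neg_right]
  simp

theorem SS.conj {f : EuclideanSpace ℝ (Fin n) → ℂ} (hf : SS volume f) :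
    SS volume (fun x => (starRingEnd ℂ) (f x)) := by
  refine ⟨Complex.continuous_conj.measurable.comp hf.meas, ?_, ?_⟩
  · refine hf.int.norm.mono' (Complex.continuous_conj.measurable.comp hf.meas).aestronglyMeasurable ?_
    filter_upwards with x; simp
  · obtain ⟨C, hC⟩ := hf.bdd
    exact ⟨C, fun x => by simpa using hC x⟩

theorem TS_of_Bd {a D : ℝ} (h : Bd volume (BF (coneM m P) (fun _ => 1)) a a D)
    {f : EuclideanSpace ℝ (Fin n) → ℂ} (hf : SS volume f) :
    ∫ ω, ‖FT f ω‖^2 ∂(coneM m P) ≤ D * NN volume a f ^ 2 := by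
  have := h f _ hf hf.conj
  have e : BF (coneM m P) (fun _ => 1) f (fun x => (starRingEnd ℂ) (f x)) =
      ((∫ ω, ‖FT f ω‖^2 ∂(coneM m P) : ℝ) : ℂ) := by
    unfold BF
    rw [← integral_complex_ofReal]
    congr 1; ext ξ
    rw [FT_conj, one_mul, Complex.mul_conj, Complex.normSq_eq_norm_sq]
  rw [e, Complex.norm_real] at this
  refine (Real.le_norm_self _).trans (this.trans (le_of_eq ?_))
  have e2 : NN volume a (fun x => (starRingEnd ℂ) (f x)) = NN volume a f := by
    unfold NN; simp
  rw [e2]; ring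

theorem FT_dil (f : EuclideanSpace ℝ (Fin n) → ℂ) {r : ℝ} (hr : 0 < r) (ω) :
    FT f (r • ω) = FT (fun x => ((r^n)⁻¹ : ℝ) * f (r⁻¹ • x)) ω := by
  unfold FT
  have := Measure.integral_comp_inv_smul (volume : Measure (EuclideanSpace ℝ (Fin n)))
    (fun x => cexp (-I * (⟪x, r • ω⟫ : ℂ)) * (((r^n)⁻¹ : ℝ) * f x)) r
  have e : ∀ x, cexp (-I * (⟪x, ω⟫ : ℂ)) * (((r^n)⁻¹ : ℝ) * f (r⁻¹ • x)) =
      cexp (-I * (⟪r⁻¹ • x, r • ω⟫ : ℂ)) * (((r^n)⁻¹ : ℝ) * f (r⁻¹ • x)) := by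
    intro x
    rw [inner_smul_left, inner_smul_right]
    congr 4
    simp
    field_simp
  simp_rw [e]
  rw [this, finrank_euclideanSpace_fin, ← integral_smul]
  congr 1; ext x
  rw [abs_of_pos (by positivity), Complex.real_smul]
  push_cast
  have : (r:ℂ)^n ≠ 0 := pow_ne_zero _ (by exact_mod_cast hr.ne')
  field_simp

theorem SS.dil {f : EuclideanSpace ℝ (Fin n) → ℂ} (hf : SS volume f) {r : ℝ} (hr : 0 < r) (c : ℂ) :
    SS volume (fun x => c * f (r⁻¹ • x)) := by
  refine ⟨?_, ?_, ?_⟩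
  · exact (hf.meas.comp (measurable_const_smul r⁻¹)).const_mul c
  · exact (hf.int.comp_smul (inv_ne_zero hr.ne')).const_mul c
  · obtain ⟨C, hC⟩ := hf.bdd
    exact ⟨‖c‖ * C, fun x => by rw [norm_mul]; gcongr; exact hC _⟩

theorem NN_dil (f : EuclideanSpace ℝ (Fin n) → ℂ) {r a : ℝ} (hr : 0 < r) (ha : 0 < a) :
    NN volume a (fun x => ((r^n)⁻¹ : ℝ) * f (r⁻¹ • x)) = (r^n)⁻¹ * (r^n)^a * NN volume a f := by
  unfold NN
  have e : ∀ x, ‖(((r^n)⁻¹ : ℝ) : ℂ) * f (r⁻¹ • x)‖ ^ (1/a) = ((r^n)⁻¹)^(1/a) * ‖f (r⁻¹ • x)‖ ^ (1/a) := by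
    intro x
    rw [norm_mul, Complex.norm_real, Real.norm_of_nonneg (by positivity),
      Real.mul_rpow (by positivity) (norm_nonneg _)]
  simp_rw [e]
  have hi : 0 ≤ ∫ x, ‖f x‖ ^ (1/a) := integral_nonneg fun x => by positivity
  rw [integral_const_mul, Measure.integral_comp_inv_smul volume (fun x => ‖f x‖ ^ (1/a)) r,
    finrank_euclideanSpace_fin, abs_of_pos (by positivity), smul_eq_mul,
    Real.mul_rpow (by positivity) (by positivity), Real.mul_rpow (by positivity) hi,
    ← Real.rpow_mul (by positivity), one_div_mul_cancel ha.ne', Real.rpow_one]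
  ring

theorem Rate.of_TS (hP : GoodP m P) {M C} (hM : Mult P M C) {a D : ℝ} (ha : 0 < a)
    (hD0 : 0 ≤ D) (h : Bd volume (BF (coneM m P) (fun _ => 1)) a a D) : Rate P M a (1/2) (1/2) := by
  have hfin := hP.coneM_finite
  obtain ⟨A, hA0, hA⟩ := radD_bdd n m
  obtain ⟨K, hK⟩ := (isCompact_Icc (a := (1/2:ℝ)) (b := 3/2)).exists_bound_of_continuousOn
    (f := fun l : ℝ => ((((l^(1/(m:ℝ)))^n)⁻¹ * ((l^(1/(m:ℝ)))^n)^a))^2) (by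
      intro l hl
      have h0 : l ≠ 0 := by have := hl.1; intro h; rw [h] at this; norm_num at this
      have h1 : 0 < l := by have := hl.1; linarith
      have h2 : (l^(1/(m:ℝ)))^n ≠ 0 := by positivity
      apply ContinuousAt.continuousWithinAt
      have c1 : ContinuousAt (fun l : ℝ => (l^(1/(m:ℝ)))^n) l :=
        (Real.continuousAt_rpow_const _ _ (Or.inl h0)).pow n
      exact ((c1.inv₀ h2).mul (c1.rpow_const (Or.inl h2))).pow 2)
  have hK0 : 0 ≤ K := (norm_nonneg _).trans (hK 1 (by norm_num))
  have hCp := hM.Cpos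
  refine ⟨Real.sqrt (A * (K * D) * C) * Real.sqrt ((2*Real.pi)^n), by positivity, fun j f g hf hg => ?_⟩
  have hNf := NN_nonneg volume a f
  have hNg := NN_nonneg volume (1/2) g
  have hsl : ∀ l ∈ Set.Icc (1/2:ℝ) (3/2), ∫ ω, ‖FT f (l ^ (1/(m:ℝ)) • ω)‖^2 ∂(coneM m P) ≤
      K * D * NN volume a f ^ 2 := by
    intro l hl
    have hl0 : 0 < l := by have := hl.1; linarith
    have hr : 0 < l ^ (1/(m:ℝ)) := by positivity
    simp_rw [FT_dil f hr]
    refine (TS_of_Bd h (hf.dil hr _)).trans ?_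
    rw [NN_dil f hr ha, mul_pow]
    have := (Real.le_norm_self _).trans (hK l hl)
    calc _ = D * NN volume a f ^ 2 * ((((l^(1/(m:ℝ)))^n)⁻¹ * ((l^(1/(m:ℝ)))^n)^a))^2 := by ring
      _ ≤ D * NN volume a f ^ 2 * K := by gcongr
      _ = _ := by ring
  have c1 := FT_continuous hf.int
  have c2 := (hM.cont j).comp hP.continuous
  have hMi : Integrable (fun l => ‖M j l‖^2) := by
    apply ((hM.cont j).norm.pow 2).integrable_of_hasCompactSupport
    apply HasCompactSupport.of_support_subset_isCompact (isCompact_Icc (a := (1/2:ℝ)) (b := 3/2))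
    intro l hl; by_contra h; exact hl (by simp [hM.supp j l h])
  have c3 : Continuous (fun ξ => ((‖M j (P ξ) * FT f ξ‖^2 : ℝ) : ℂ)) :=
    Complex.continuous_ofReal.comp ((c2.mul c1).norm.pow 2)
  have hui : Integrable (fun ξ => ((‖M j (P ξ) * FT f ξ‖^2 : ℝ) : ℂ)) := by
    apply Continuous.integrable_of_hasCompactSupport
    · exact c3
    · apply (hM.W_cpt hP j).mono'
      intro ξ hξ
      apply subset_tsupport
      intro h; apply hξ
      simp only [] at h
      simp [h]
  have hmain : ∫ ξ, ‖M j (P ξ) * FT f ξ‖^2 ≤ A * (K * D) * C * NN volume a f ^ 2 * 2^j := by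
    have e1 := hP.polar_integral (Continuous.stronglyMeasurable c3) hui
    rw [integral_complex_ofReal] at e1
    refine (Real.le_norm_self _).trans ?_
    rw [← Complex.norm_real, e1]
    calc _ ≤ ∫ l in Set.Ioi (0:ℝ), ‖M j l‖^2 * (A * (K * D * NN volume a f ^ 2)) := by
          apply norm_integral_le_of_norm_le (hMi.mul_const _).integrableOn
          filter_upwards [ae_restrict_mem measurableSet_Ioi] with l hl
          have : ∫ ω, ((‖M j (P (l ^ (1/(m:ℝ)) • ω)) * FT f (l ^ (1/(m:ℝ)) • ω)‖^2 : ℝ) : ℂ) ∂(coneM m P)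
             = ((‖M j l‖^2 * ∫ ω, ‖FT f (l ^ (1/(m:ℝ)) • ω)‖^2 ∂(coneM m P) : ℝ) : ℂ) := by
            rw [← integral_const_mul, ← integral_complex_ofReal]
            apply integral_congr_ae
            filter_upwards [hP.coneM_ae] with ω hω
            rw [hP.P_rpow hl hω, norm_mul, mul_pow]
          rw [this]
          by_cases hl2 : l ∈ Set.Icc (1/2:ℝ) (3/2)
          · rw [norm_mul, Complex.norm_real, Complex.norm_real, Real.norm_eq_abs,
              Real.norm_of_nonneg (by positivity)]
            calc _ ≤ A * (‖M j l‖^2 * (K * D * NN volume a f ^ 2)) := by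
                  gcongr
                  · exact hA l hl2
                  · exact hsl l hl2
              _ = _ := by ring
          · rw [hM.supp j l hl2]; simp
      _ = (∫ l in Set.Ioi (0:ℝ), ‖M j l‖^2) * (A * (K * D * NN volume a f ^ 2)) := integral_mul_const _ _
      _ ≤ (C * 2^j) * (A * (K * D * NN volume a f ^ 2)) := by
          gcongr
          refine le_trans ?_ (hM.l2 j)
          exact setIntegral_le_integral hMi (Filter.Eventually.of_forall fun l => by positivity)
      _ = _ := by ring
  obtain ⟨g1, -⟩ := FT_plancherel g hg.int hg.memLp_two
  have g1' : MemLp (fun ξ => FT g (-ξ)) 2 :=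
    g1.comp_measurePreserving (Measure.measurePreserving_neg volume)
  have hu : MemLp (fun ξ => M j (P ξ) * FT f ξ) 2 := by
    rw [memLp_two_iff_integrable_sq_norm]
    · exact_mod_cast hui.re
    · exact (c2.mul c1).aestronglyMeasurable
  have hgn : Real.sqrt (∫ ξ, ‖FT g (-ξ)‖^2) = Real.sqrt ((2 * Real.pi)^n) * NN volume (1/2) g := by
    rw [← FT_sqrt hg, integral_neg_eq_self (fun ξ => ‖FT g ξ‖^2)]
  unfold BJ BF
  calc _ ≤ ∫ ξ, ‖M j (P ξ) * (FT f ξ * FT g (-ξ))‖ := norm_integral_le_integral_norm _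
    _ = ∫ ξ, ‖M j (P ξ) * FT f ξ‖ * ‖FT g (-ξ)‖ := by
        congr 1; ext ξ; rw [← mul_assoc, norm_mul]
    _ ≤ Real.sqrt (A * (K * D) * C * NN volume a f ^ 2 * 2^j) * (Real.sqrt ((2 * Real.pi)^n) * NN volume (1/2) g) := by
        refine (cs_integral hu g1').trans ?_
        rw [hgn]
        gcongr
    _ = _ := by
        have e2 : Real.sqrt (2^j) = ((2:ℝ)^(1/2:ℝ))^j := by
          rw [Real.sqrt_eq_rpow, ← Real.rpow_natCast, ← Real.rpow_natCast, ← Real.rpow_mul (by norm_num), ← Real.rpow_mul (by norm_num)]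
          congr 1; ring
        rw [Real.sqrt_mul (by positivity), Real.sqrt_mul (by positivity), Real.sqrt_sq hNf, e2]
        ring
end

end

section

section
variable {n m : ℕ} {P : EuclideanSpace ℝ (Fin n) → ℝ}

theorem Rate.cast {M} {α β e α' β' e' : ℝ} (h : Rate P M α β e) (h1 : α = α') (h2 : β = β') (h3 : e = e') :
    Rate P M α' β' e' := by subst h1 h2 h3; exact h

theorem Rate.tomasStein (hP : GoodP m P) {M C} (hM : Mult P M C) {a : ℝ} (ha1 : a ≤ 1)
    (ha : 1/((n:ℝ)+1) < a - 1/2) : Rate P M a (1/2) (1/2) := by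
  have hn : (2:ℝ) ≤ n := by exact_mod_cast hP.hn
  have h0 : 0 < 1/((n:ℝ)+1) := by positivity
  have h1 := Rate.mix hP hM (hM.rate22 hP) (hM.rate11 hP) (by norm_num) (by norm_num) (by norm_num) (by norm_num)
    (by norm_num) (by norm_num) (by norm_num) (by norm_num) (θ := 2*a-1) (by linarith) (by linarith)
  have h2 : Rate P M a a (1 - (2*a-1)*((n:ℝ)+1)/2) := h1.cast (by ring) (by ring) (by ring)
  have h3 : 1 - (2*a-1)*((n:ℝ)+1)/2 < 0 := by
    rw [div_lt_iff₀ (by positivity)] at ha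
    nlinarith
  obtain ⟨D, hD, hB⟩ := h2.sum hP hM h3
  exact Rate.of_TS hP hM (by linarith) hD hB

theorem Rate.exists_neg (hP : GoodP m P) {M C} (hM : Mult P M C) {α β : ℝ} (hα : α ≤ 1) (hβα : β ≤ α)
    (hβ : 1/(2*(n:ℝ)) < β - 1/2) (hs : 2/((n:ℝ)+1) < α + β - 1) : ∃ e < 0, Rate P M α β e := by
  have hn : (2:ℝ) ≤ n := by exact_mod_cast hP.hn
  have hβ0 : 1/2 < β := by
    have : 0 < 1/(2*(n:ℝ)) := by positivity
    linarith
  rcases eq_or_lt_of_le (hβα.trans hα) with hb | hb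
  · have : α = 1 := le_antisymm hα (hb ▸ hβα)
    rw [this, hb]
    exact ⟨_, by linarith, hM.rate11 hP⟩
  set θ := 2*(1-β) with hθ
  have hθ0 : 0 < θ := by rw [hθ]; linarith
  have hθ1 : θ < 1 := by rw [hθ]; linarith
  set α1 := 1 - (1-α)/θ with hα1
  have e1 : θ * α1 = θ - (1-α) := by rw [hα1]; field_simp
  have hα1a : 1/2 ≤ α1 := by
    by_contra h
    push Not at h
    nlinarith
  have hα1b : α1 ≤ 1 := by
    rw [hα1]
    have : 0 ≤ (1-α)/θ := div_nonneg (by linarith) hθ0.le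
    linarith
  rw [div_lt_iff₀ (by positivity)] at hβ hs
  have key : ∀ e', (1-θ)*(-((n:ℝ)-1)/2) + θ * e' < 0 → Rate P M α1 (1/2) e' → ∃ e < 0, Rate P M α β e := by
    intro e' he h
    refine ⟨_, he, ?_⟩
    have h1 := Rate.mix hP hM (hM.rate11 hP) h (by norm_num) (by norm_num) (by linarith) (by norm_num)
      (by norm_num) (by norm_num) (by linarith) (by norm_num) hθ0.le hθ1.le
    exact h1.cast (by linarith) (by rw [hθ]; ring) rfl
  by_cases hc : 1/((n:ℝ)+1) < α1 - 1/2
  · apply key _ _ (Rate.tomasStein hP hM hα1b hc)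
    have : θ * n < n - 1 := by rw [hθ]; nlinarith
    nlinarith
  · push Not at hc
    rw [le_div_iff₀ (by positivity)] at hc
    set E := 1 - ((n:ℝ)+1)/2*(α+β-1) with hE
    have hE0 : E < 0 := by rw [hE]; nlinarith
    set ε := min ((n:ℝ)-1) (-E) with hε
    have hε0 : 0 < ε := lt_min (by linarith) (by linarith)
    have hε1 : ε ≤ n - 1 := min_le_left _ _
    have hε2 : ε ≤ -E := min_le_right _ _
    set s := (n:ℝ) + 1 - ε with hs'
    have hs2 : 2 ≤ s := by linarith
    have hs3 : s < n + 1 := by linarith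
    have hsi : 1/s ≤ 1/2 := one_div_le_one_div_of_le (by norm_num) hs2
    have hsi0 : 0 < 1/s := by positivity
    have hR := Rate.tomasStein hP hM (a := 1/2 + 1/s) (by linarith) (by
      have : 1/((n:ℝ)+1) < 1/s := one_div_lt_one_div_of_lt (by linarith) hs3
      linarith)
    have ht0 : 0 ≤ (α1 - 1/2)*s := mul_nonneg (by linarith) (by linarith)
    have ht1 : (α1 - 1/2)*s ≤ 1 := by
      refine le_trans ?_ hc
      gcongr
    have hR2 := Rate.mix hP hM (hM.rate22 hP) hR (by norm_num) (by norm_num) (by linarith) (by norm_num)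
      (by norm_num) (by norm_num) (by linarith) (by norm_num) ht0 ht1
    have hs0 : s ≠ 0 := by linarith
    have hR3 : Rate P M α1 (1/2) (1 - (α1 - 1/2)*s/2) := hR2.cast (by field_simp; ring) (by ring) (by ring)
    apply key _ _ hR3
    have e2 : (1-θ)*(-((n:ℝ)-1)/2) + θ * (1 - (α1 - 1/2)*s/2) = E + (α-β)*ε/2 := by
      have : θ * (α1 - 1/2) = α - β := by rw [mul_sub, e1, hθ]; ring
      calc _ = (1-θ)*(-((n:ℝ)-1)/2) + θ - (θ * (α1 - 1/2))*s/2 := by ring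
        _ = _ := by rw [this, hE, hs', hθ]; ring
    rw [e2]
    nlinarith

theorem cone_bound (hP : GoodP m P) {α β : ℝ} (hα : α ≤ 1) (hβ : β ≤ 1)
    (hα1 : 1/(2*(n:ℝ)) < α - 1/2) (hβ1 : 1/(2*(n:ℝ)) < β - 1/2) (hs : 2/((n:ℝ)+1) < α + β - 1) :
    ∃ D, 0 ≤ D ∧ Bd volume (BF (coneM m P) (fun _ => 1)) α β D := by
  obtain ⟨M, C, hM⟩ := hP.exists_mult
  rcases le_total β α with h | h
  · obtain ⟨e, he, hR⟩ := Rate.exists_neg hP hM hα h hβ1 hs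
    exact hR.sum hP hM he
  · obtain ⟨e, he, hR⟩ := Rate.exists_neg hP hM hβ h hα1 (by linarith)
    exact (hR.symm hP).sum hP hM he
end

end

section

section
variable {n m : ℕ} {P : EuclideanSpace ℝ (Fin n) → ℝ}

theorem indicator_SS {s : Set (EuclideanSpace ℝ (Fin n))} (hs : MeasurableSet s) (hv : volume s < ∞)
    {u : EuclideanSpace ℝ (Fin n) → ℂ} (hu : Measurable u) {A : ℝ} (hA : ∀ x, ‖u x‖ ≤ A) :
    SS volume (s.indicator u) := by
  refine ⟨hu.indicator hs, ?_, A, fun x => ?_⟩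
  · rw [integrable_indicator_iff hs]
    exact Measure.integrableOn_of_bounded hv.ne hu.aestronglyMeasurable (Filter.Eventually.of_forall hA)
  · exact (norm_indicator_le_norm_self _ _).trans (hA x)

theorem duality_top {h : EuclideanSpace ℝ (Fin n) → ℂ} (hm : Measurable h) {A : ℝ} (hA : ∀ x, ‖h x‖ ≤ A)
    {K : ℝ} (hK : 0 ≤ K) (hd : ∀ g, SS volume g → ‖∫ x, g x * h x‖ ≤ K * NN volume 1 g) :
    eLpNorm h ∞ volume ≤ ENNReal.ofReal K := by
  rw [eLpNorm_exponent_top]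
  apply eLpNormEssSup_le_of_ae_bound
  have := ae_nonneg_of_forall_setIntegral_nonneg_of_sigmaFinite (μ := (volume : Measure (EuclideanSpace ℝ (Fin n))))
    (f := fun x => K - ‖h x‖) ?_ ?_
  · filter_upwards [this] with x hx
    simp only [Pi.zero_apply] at hx; linarith
  · intro s hs hv
    refine Measure.integrableOn_of_bounded (M := K + A) hv.ne (by fun_prop) (Filter.Eventually.of_forall fun x => ?_)
    rw [Real.norm_eq_abs, abs_le]
    have := hA x; have := norm_nonneg (h x)
    constructor <;> linarith
  · intro s hs hv
    have hu : Measurable (fun x => (starRingEnd ℂ) (h x) / (‖h x‖ : ℂ)) :=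
      (Complex.continuous_conj.measurable.comp hm).div (Complex.measurable_ofReal.comp hm.norm)
    have hub : ∀ x, ‖(starRingEnd ℂ) (h x) / (‖h x‖ : ℂ)‖ ≤ 1 := by
      intro x; simp only [norm_div, RCLike.norm_conj, Complex.norm_real, norm_norm]; exact div_self_le_one _
    have hg := indicator_SS hs hv hu hub
    have h1 := hd _ hg
    have hi : IntegrableOn (fun x => ‖h x‖) s :=
      Measure.integrableOn_of_bounded (M := A) hv.ne (by fun_prop) (Filter.Eventually.of_forall fun x => by simpa using hA x)
    have e1 : ∫ x, s.indicator (fun x => (starRingEnd ℂ) (h x) / (‖h x‖ : ℂ)) x * h x =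
        ((∫ x in s, ‖h x‖ : ℝ) : ℂ) := by
      rw [← integral_complex_ofReal, ← integral_indicator hs]
      congr 1; ext x
      by_cases hx : x ∈ s
      · rw [Set.indicator_of_mem hx, Set.indicator_of_mem hx]
        by_cases h0 : h x = 0
        · simp [h0]
        · have : (‖h x‖ : ℂ) ≠ 0 := by simpa using h0
          field_simp
          rw [Complex.conj_mul']
      · simp [hx]
    have e2 : NN volume 1 (s.indicator (fun x => (starRingEnd ℂ) (h x) / (‖h x‖ : ℂ))) ≤ volume.real s := by
      unfold NN
      simp only [div_one, Real.rpow_one]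
      calc _ ≤ ∫ x, s.indicator (fun _ => (1:ℝ)) x := by
            apply integral_mono hg.int.norm
            · rw [integrable_indicator_iff hs]; exact integrableOn_const hv.ne
            · intro x
              by_cases hx : x ∈ s
              · beta_reduce
                rw [Set.indicator_of_mem hx, Set.indicator_of_mem hx]; exact hub x
              · simp [hx]
        _ = _ := by rw [integral_indicator hs]; simp
    rw [e1, Complex.norm_real] at h1
    have hi2 : Integrable (fun _ : EuclideanSpace ℝ (Fin n) => K) (volume.restrict s) := integrableOn_const hv.ne
    rw [integral_sub hi2 hi, setIntegral_const, smul_eq_mul, sub_nonneg]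
    refine (Real.le_norm_self _).trans (h1.trans ?_)
    rw [mul_comm]; gcongr

theorem duality_lt {h : EuclideanSpace ℝ (Fin n) → ℂ} (hm : Measurable h) {A : ℝ} (hA : ∀ x, ‖h x‖ ≤ A)
    {K β q : ℝ} (hK : 0 ≤ K) (hq : 2 < q) (hβ : β = 1 - 1/q)
    (hd : ∀ g, SS volume g → ‖∫ x, g x * h x‖ ≤ K * NN volume β g) :
    eLpNorm h (ENNReal.ofReal q) volume ≤ ENNReal.ofReal K := by
  have hq0 : 0 < q := by linarith
  have hA0 : 0 ≤ A := (norm_nonneg _).trans (hA 0)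
  have hβ0 : 0 < β := by
    rw [hβ]; have : 1/q < 1 := by rw [div_lt_one hq0]; linarith
    linarith
  have hβq : β * q = q - 1 := by rw [hβ]; field_simp
  have hset : ∀ R : ℝ, ∫ x in Metric.closedBall 0 R, ‖h x‖^q ≤ K^q := by
    intro R
    set s := Metric.closedBall (0 : EuclideanSpace ℝ (Fin n)) R
    have hs : MeasurableSet s := Metric.isClosed_closedBall.measurableSet
    have hv : volume s < ∞ := measure_closedBall_lt_top
    set u := fun x => (starRingEnd ℂ) (h x) * ((‖h x‖^(q-2) : ℝ) : ℂ) with hu'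
    have hun : ∀ x, ‖u x‖ = ‖h x‖^(q-1) := by
      intro x
      have : ‖u x‖ = ‖h x‖ * ‖h x‖^(q-2) := by
        rw [hu', norm_mul, RCLike.norm_conj, Complex.norm_real, Real.norm_of_nonneg (by positivity)]
      rw [this]
      rcases eq_or_lt_of_le (norm_nonneg (h x)) with h0 | h0
      · rw [← h0, zero_mul, Real.zero_rpow (by linarith)]
      · rw [← Real.rpow_one_add' (by positivity) (by linarith)]; congr 1; ring
    have hu : Measurable u :=
      (Complex.continuous_conj.measurable.comp hm).mul (Complex.measurable_ofReal.comp (hm.norm.pow_const _))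
    have hub : ∀ x, ‖u x‖ ≤ A^(q-1) := by
      intro x; rw [hun]; apply Real.rpow_le_rpow (norm_nonneg _) (hA x) (by linarith)
    have hg := indicator_SS hs hv hu hub
    have h1 := hd _ hg
    set S := ∫ x in s, ‖h x‖^q with hS
    have hS0 : 0 ≤ S := integral_nonneg fun x => by positivity
    have e1 : ∫ x, s.indicator u x * h x = (S : ℂ) := by
      rw [hS, ← integral_complex_ofReal, ← integral_indicator hs]
      congr 1; ext x
      by_cases hx : x ∈ s
      · rw [Set.indicator_of_mem hx, Set.indicator_of_mem hx, hu']
        have : (‖h x‖ : ℝ)^q = ‖h x‖^2 * ‖h x‖^(q-2) := by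
          rcases eq_or_lt_of_le (norm_nonneg (h x)) with h0 | h0
          · rw [← h0, Real.zero_rpow (by linarith)]; simp
          · rw [← Real.rpow_natCast, ← Real.rpow_add h0]; congr 1; push_cast; ring
        rw [this]
        push_cast
        rw [← Complex.conj_mul' (h x)]; ring
      · simp [hx]
    have e2 : NN volume β (s.indicator u) = S^β := by
      unfold NN
      rw [hS, ← integral_indicator hs]
      congr 2; ext x
      by_cases hx : x ∈ s
      · rw [Set.indicator_of_mem hx, Set.indicator_of_mem hx, hun, ← Real.rpow_mul (norm_nonneg _)]
        congr 1; rw [← hβq]; field_simp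
      · simp only [Set.indicator_of_notMem hx, norm_zero]
        exact Real.zero_rpow (by positivity)
    rw [e1, e2, Complex.norm_real, Real.norm_of_nonneg hS0] at h1
    rcases eq_or_lt_of_le hS0 with h0 | h0
    · rw [← h0]; positivity
    · have h2 : S^(1/q) ≤ K := by
        have : S = S^(1/q) * S^β := by rw [← Real.rpow_add h0, hβ]; simp
        rw [this] at h1
        refine le_of_mul_le_mul_right (h1.trans (le_of_eq ?_)) (Real.rpow_pos_of_pos h0 β)
        rw [← this]
      calc S = (S^(1/q))^q := by rw [← Real.rpow_mul hS0]; field_simp; simp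
        _ ≤ K^q := Real.rpow_le_rpow (by positivity) h2 hq0.le
  have hlim := (aecover_closedBall (μ := volume) (x := (0 : EuclideanSpace ℝ (Fin n)))
    (tendsto_natCast_atTop_atTop (R := ℝ))).lintegral_tendsto_of_countably_generated
      (f := fun x => ‖h x‖ₑ^q) (by fun_prop)
  have hle : ∫⁻ x, ‖h x‖ₑ^q ≤ ENNReal.ofReal (K^q) := by
    refine le_of_tendsto hlim (Filter.Eventually.of_forall fun k => ?_)
    refine le_trans (le_of_eq ?_) (ENNReal.ofReal_le_ofReal (hset k))
    rw [ofReal_integral_eq_lintegral_ofReal]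
    · congr 1; ext x
      rw [← ENNReal.ofReal_rpow_of_nonneg (norm_nonneg _) hq0.le, ofReal_norm]
    · refine Measure.integrableOn_of_bounded (M := A^q) measure_closedBall_lt_top.ne
        (hm.norm.pow_const _).aestronglyMeasurable (Filter.Eventually.of_forall fun x => ?_)
      rw [Real.norm_of_nonneg (by positivity)]
      exact Real.rpow_le_rpow (norm_nonneg _) (hA x) hq0.le
    · filter_upwards with x; positivity
  rw [eLpNorm_eq_lintegral_rpow_enorm_toReal (by simpa using hq0) ENNReal.ofReal_ne_top,
    ENNReal.toReal_ofReal hq0.le]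
  calc _ ≤ (ENNReal.ofReal (K^q))^(1/q) := by gcongr
    _ = _ := by
      rw [ENNReal.ofReal_rpow_of_nonneg (by positivity) (by positivity), ← Real.rpow_mul hK]
      field_simp; simp

theorem NN_eLpNorm {f : EuclideanSpace ℝ (Fin n) → ℂ} (hf : SS volume f) {p : ℝ≥0∞} (hp : 1 ≤ p) (hp' : p ≠ ∞) :
    ENNReal.ofReal (NN volume (1/p).toReal f) = eLpNorm f p volume := by
  have hp0 : p ≠ 0 := by rintro rfl; simp at hp
  have hp1 : 1 ≤ p.toReal := by
    rw [← ENNReal.toReal_one]; exact ENNReal.toReal_mono hp' hp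
  rw [eLpNorm_eq_lintegral_rpow_enorm_toReal hp0 hp']
  unfold NN
  have : (1/p).toReal = 1/p.toReal := by rw [ENNReal.toReal_div]; simp
  rw [this, one_div_one_div, ← ENNReal.ofReal_rpow_of_nonneg (integral_nonneg fun x => by positivity) (by positivity),
    ofReal_integral_eq_lintegral_ofReal (hf.integrable_rpow hp1) (Filter.Eventually.of_forall fun x => by positivity)]
  congr 2; ext x
  rw [← ENNReal.ofReal_rpow_of_nonneg (norm_nonneg _) (by linarith), ofReal_norm]

/-- the extension-restriction operator for the cone measure -/
def ER (m : ℕ) (P : EuclideanSpace ℝ (Fin n) → ℝ) (f : EuclideanSpace ℝ (Fin n) → ℂ)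
    (x : EuclideanSpace ℝ (Fin n)) : ℂ := ∫ ξ, FT f ξ * cexp (I * (⟪x, ξ⟫ : ℂ)) ∂(coneM m P)

theorem ER_bound (hP : GoodP m P) (p q : ℝ≥0∞) (hp : 1 ≤ p) (hq : 1 ≤ q)
    (hmin : 1/(2*(n : ℝ)) < min ((1/p).toReal - 1/2) (1/2 - (1/q).toReal))
    (hdiff : 2/((n : ℝ)+1) < (1/p).toReal - (1/q).toReal) :
    ∃ D : ℝ, 0 ≤ D ∧ ∀ f, SS volume f → eLpNorm (ER m P f) q volume ≤ ENNReal.ofReal D * eLpNorm f p volume := by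
  have hfin := hP.coneM_finite
  have hn : (2:ℝ) ≤ n := by exact_mod_cast hP.hn
  obtain ⟨h1, h2⟩ := lt_min_iff.1 hmin
  have hn0 : 0 < 1/(2*(n:ℝ)) := by positivity
  have le1 : ∀ r : ℝ≥0∞, 1 ≤ r → (1/r).toReal ≤ 1 := by
    intro r hr
    rw [← ENNReal.toReal_one]
    apply ENNReal.toReal_mono (by simp)
    rw [one_div]; exact ENNReal.inv_le_one.2 hr
  have hp' : p ≠ ∞ := by rintro rfl; rw [ENNReal.div_top, ENNReal.toReal_zero] at h1; linarith
  obtain ⟨D, hD, hB⟩ := cone_bound hP (α := (1/p).toReal) (β := 1 - (1/q).toReal) (le1 p hp)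
    (by have : 0 ≤ (1/q).toReal := ENNReal.toReal_nonneg
        linarith) h1 (by linarith) (by linarith)
  refine ⟨D, hD, fun f hf => ?_⟩
  have hcont : Continuous (ER m P f) := by
    unfold ER
    have c1 := FT_continuous hf.int
    apply continuous_of_dominated (bound := fun _ => ∫ x, ‖f x‖)
    · intro x; apply Continuous.aestronglyMeasurable; fun_prop
    · intro x; filter_upwards with ξ
      rw [norm_mul, norm_cexp_I_mul, mul_one]; exact FT_norm_le f ξ
    · exact integrable_const _
    · filter_upwards with ξ; fun_prop
  have hbd : ∀ x, ‖ER m P f x‖ ≤ (∫ x, ‖f x‖) * (coneM m P).real Set.univ := by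
    intro x
    apply norm_integral_le_of_norm_le_const
    filter_upwards with ξ
    rw [norm_mul, norm_cexp_I_mul, mul_one]; exact FT_norm_le f ξ
  have hNf := NN_nonneg volume (1/p).toReal f
  have hd : ∀ g, SS volume g → ‖∫ x, g x * ER m P f x‖ ≤
      (D * NN volume (1/p).toReal f) * NN volume (1 - (1/q).toReal) g := by
    intro g hg
    have := hB f g hf hg
    rw [BF_eq_pair (integrable_const 1) hf.int hg.int] at this
    simpa only [ER, one_mul] using this
  rw [← NN_eLpNorm hf hp hp', ← ENNReal.ofReal_mul hD]
  by_cases hqt : q = ∞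
  · subst hqt
    apply duality_top hcont.measurable hbd (by positivity)
    simpa using hd
  · have hq0 : 0 < q.toReal := ENNReal.toReal_pos (by rintro rfl; simp at hq) hqt
    have e : (1/q).toReal = 1/q.toReal := by rw [ENNReal.toReal_div]; simp
    have hq2 : 2 < q.toReal := by
      rw [e] at h2
      by_contra h
      push Not at h
      have := one_div_le_one_div_of_le hq0 h
      linarith
    have := duality_lt hcont.measurable hbd (mul_nonneg hD hNf) hq2 (by rw [e]) hd
    rwa [ENNReal.ofReal_toReal hqt] at this
end

end

section

section
variable {n : ℕ}

/-- truncated cone over a set -/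
def Cn (A : Set (EuclideanSpace ℝ (Fin n))) : Set (EuclideanSpace ℝ (Fin n)) :=
  {x | ∃ t : ℝ, 0 < t ∧ t ≤ 1 ∧ ∃ a ∈ A, x = t • a}

theorem flat_base (hn : 2 ≤ n) (e : EuclideanSpace ℝ (Fin n)) (he : ‖e‖ = 1) :
    ∃ c : ℝ≥0∞, c ≠ ∞ ∧ ∀ B : Set (EuclideanSpace ℝ (Fin n)), MeasurableSet B → (∀ x ∈ B, ⟪e, x⟫ = 1) →
      volume (Cn B) = c * Measure.hausdorffMeasure ((n:ℝ)-1) B := by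
  have he0 : e ≠ 0 := by rintro rfl; simp at he
  have hee : ⟪e, e⟫ = 1 := by rw [real_inner_self_eq_norm_sq, he]; norm_num
  set K := (Submodule.span ℝ {e})ᗮ with hK
  have hKm : ∀ y ∈ K, ⟪e, y⟫ = 0 := fun y hy => (Submodule.mem_orthogonal_singleton_iff_inner_right).1 hy
  have hfact : Fact (Module.finrank ℝ (EuclideanSpace ℝ (Fin n)) = (n-1) + 1) := ⟨by
    rw [finrank_euclideanSpace_fin]; omega⟩
  have hrank : Module.finrank ℝ K = n - 1 := Submodule.finrank_orthogonal_span_singleton he0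
  have hd : ((Module.finrank ℝ K : ℕ) : ℝ) = (n:ℝ) - 1 := by
    rw [hrank, Nat.cast_sub (by omega)]; simp
  set ψ : EuclideanSpace ℝ (Fin n) → K := fun x => K.orthogonalProjectionOnto (⟪e, x⟫⁻¹ • x) with hψ
  have hψm : Measurable ψ := by
    apply K.orthogonalProjectionOnto.continuous.measurable.comp
    have : Measurable (fun x : EuclideanSpace ℝ (Fin n) => ⟪e, x⟫) := (by fun_prop : Continuous _).measurable
    exact this.inv.smul measurable_id
  set S : Set (EuclideanSpace ℝ (Fin n)) := {x | 0 < ⟪e, x⟫ ∧ ⟪e, x⟫ ≤ 1} with hS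
  have hcm : Measurable (fun x : EuclideanSpace ℝ (Fin n) => ⟪e, x⟫) := (by fun_prop : Continuous _).measurable
  have hSm : MeasurableSet S :=
    (measurableSet_lt measurable_const hcm).inter (measurableSet_le hcm measurable_const)
  -- recover
  have hrec : ∀ x, 0 < ⟪e, x⟫ → ⟪e, x⟫⁻¹ • x = e + (ψ x : EuclideanSpace ℝ (Fin n)) := by
    intro x hx
    have hmem : ⟪e, x⟫⁻¹ • x - e ∈ K := by
      rw [hK, Submodule.mem_orthogonal_singleton_iff_inner_right, inner_sub_right, inner_smul_right, hee]
      rw [inv_mul_cancel₀ hx.ne', sub_self]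
    have h1 : ψ x = ⟨_, hmem⟩ := by
      rw [hψ]
      have : K.orthogonalProjectionOnto (⟪e, x⟫⁻¹ • x) = K.orthogonalProjectionOnto (⟪e, x⟫⁻¹ • x - e) + K.orthogonalProjectionOnto e := by
        rw [← map_add]; congr 1; abel
      beta_reduce
      rw [this]
      have h2 : K.orthogonalProjectionOnto e = 0 := by
        apply Submodule.orthogonalProjectionOnto_apply_of_mem_orthogonal
        rw [hK]
        exact Submodule.le_orthogonal_orthogonal _ (Submodule.mem_span_singleton_self e)
      rw [h2, add_zero]
      exact Submodule.orthogonalProjectionOnto_mem_subspace_eq_self (⟨_, hmem⟩ : K)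
    rw [h1]; simp
  set ν : Measure K := Measure.map ψ (volume.restrict S) with hν
  have hνa : ∀ A, MeasurableSet A → ν A = volume (ψ ⁻¹' A ∩ S) := fun A hA => by
    rw [hν, Measure.map_apply hψm hA, Measure.restrict_apply (hψm hA)]
  have i1 : IsFiniteMeasureOnCompacts ν := by
    refine ⟨fun A hA => ?_⟩
    obtain ⟨R, hR⟩ := hA.isBounded.exists_norm_le
    rw [hνa A hA.measurableSet]
    refine lt_of_le_of_lt (measure_mono (t := Metric.closedBall 0 (1 + R)) ?_) measure_closedBall_lt_top
    rintro x ⟨hx1, hx2, hx3⟩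
    have h1 := hrec x hx2
    have h2 : x = ⟪e, x⟫ • (e + (ψ x : EuclideanSpace ℝ (Fin n))) := by
      rw [← h1, smul_smul, mul_inv_cancel₀ hx2.ne', one_smul]
    rw [mem_closedBall_zero_iff, h2, norm_smul, Real.norm_of_nonneg hx2.le]
    have h3 : ‖e + (ψ x : EuclideanSpace ℝ (Fin n))‖ ≤ 1 + R := by
      refine (norm_add_le _ _).trans ?_
      have := hR _ hx1
      rw [he]; simpa using this
    calc _ ≤ 1 * ‖e + (ψ x : EuclideanSpace ℝ (Fin n))‖ := by gcongr
      _ ≤ _ := by linarith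
  have i2 : Measure.IsAddLeftInvariant ν := by
    refine ⟨fun v => ?_⟩
    ext A hA
    rw [Measure.map_apply (measurable_const_add v) hA, hνa _ hA, hνa _ (measurable_const_add v hA)]
    set T : EuclideanSpace ℝ (Fin n) →ₗ[ℝ] EuclideanSpace ℝ (Fin n) :=
      LinearMap.transvection (innerₛₗ ℝ e) (v : EuclideanSpace ℝ (Fin n)) with hT
    have hTa : ∀ x, T x = x + ⟪e, x⟫ • (v : EuclideanSpace ℝ (Fin n)) := fun x => by
      rw [hT, LinearMap.transvection.apply]; rfl
    have hev : ⟪e, (v : EuclideanSpace ℝ (Fin n))⟫ = 0 := hKm _ v.2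
    have hdet : LinearMap.det T = 1 := by
      rw [hT, LinearMap.transvection.det]
      simpa using hev
    have hTe : ∀ x, ⟪e, T x⟫ = ⟪e, x⟫ := fun x => by
      rw [hTa, inner_add_right, inner_smul_right, hev]; simp
    have hTψ : ∀ x, 0 < ⟪e, x⟫ → ψ (T x) = v + ψ x := by
      intro x hx
      apply Subtype.ext
      have h1 := hrec (T x) (by rwa [hTe])
      have h2 := hrec x hx
      rw [hTe, hTa, smul_add, smul_smul, inv_mul_cancel₀ hx.ne', one_smul, h2] at h1
      push_cast
      have h3 : e + ((v : EuclideanSpace ℝ (Fin n)) + (ψ x : EuclideanSpace ℝ (Fin n))) = e + (ψ (T x) : EuclideanSpace ℝ (Fin n)) := by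
        rw [hTa, ← h1]; abel
      exact (add_left_cancel h3).symm
    have := Measure.addHaar_preimage_linearMap (volume : Measure (EuclideanSpace ℝ (Fin n))) (f := T) (by rw [hdet]; norm_num) (ψ ⁻¹' A ∩ S)
    rw [hdet] at this
    simp only [inv_one, abs_one, ENNReal.ofReal_one, one_mul] at this
    rw [← this]
    congr 1
    ext x
    simp only [Set.mem_inter_iff, Set.mem_preimage, hS, Set.mem_ofPred_eq, hTe]
    constructor
    · rintro ⟨h1, h2, h3⟩; rw [hTψ x h2]; exact ⟨h1, h2, h3⟩
    · rintro ⟨h1, h2, h3⟩; rw [hTψ x h2] at h1; exact ⟨h1, h2, h3⟩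
  have hH : Measure.IsAddHaarMeasure (Measure.hausdorffMeasure ((n:ℝ)-1) : Measure K) := by
    rw [← hd]; infer_instance
  have huniq := Measure.isAddLeftInvariant_eq_smul ν (Measure.hausdorffMeasure ((n:ℝ)-1) : Measure K)
  refine ⟨(Measure.addHaarScalarFactor ν (Measure.hausdorffMeasure ((n:ℝ)-1) : Measure K) : ℝ≥0∞), ENNReal.coe_ne_top, fun B hB hB1 => ?_⟩
  set j : K → EuclideanSpace ℝ (Fin n) := fun y => e + y with hj
  have hji : Isometry j := by
    rw [isometry_iff_dist_eq]; intro x y; rw [hj]; simp; rfl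
  have hjB : B = j '' (j ⁻¹' B) := by
    rw [Set.image_preimage_eq_inter_range, eq_comm, Set.inter_eq_left]
    intro x hx
    refine ⟨⟨x - e, ?_⟩, by simp [hj]⟩
    rw [hK, Submodule.mem_orthogonal_singleton_iff_inner_right, inner_sub_right, hee, hB1 x hx, sub_self]
  have hn1 : (0:ℝ) ≤ (n:ℝ) - 1 := by rw [← hd]; positivity
  have hBj : MeasurableSet (j ⁻¹' B) := hji.continuous.measurable hB
  conv_rhs => rw [hjB, hji.hausdorffMeasure_image (Or.inl hn1)]
  have e1 : ν (j ⁻¹' B) = volume (Cn B) := by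
    rw [hνa _ hBj]
    congr 1
    ext x
    simp only [Set.mem_inter_iff, Set.mem_preimage, hS, Set.mem_ofPred_eq, Cn]
    constructor
    · rintro ⟨h1, h2, h3⟩
      refine ⟨_, h2, h3, _, h1, ?_⟩
      rw [hj]; beta_reduce
      rw [← hrec x h2, smul_smul, mul_inv_cancel₀ h2.ne', one_smul]
    · rintro ⟨t, h1, h2, a, ha, rfl⟩
      have h3 : ⟪e, t • a⟫ = t := by rw [inner_smul_right, hB1 a ha, mul_one]
      rw [h3]
      refine ⟨?_, h1, h2⟩
      have h4 := hrec (t • a) (by rwa [h3])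
      rw [h3, smul_smul, inv_mul_cancel₀ h1.ne', one_smul] at h4
      rw [hj]; beta_reduce
      rwa [← h4]
  rw [← e1]
  exact congrArg (fun μ : Measure K => μ (j ⁻¹' B)) huniq

theorem Cn_smul (s : ℝ) (A : Set (EuclideanSpace ℝ (Fin n))) :
    Cn ((fun x => s • x) '' A) = (fun x => s • x) '' Cn A := by
  ext x
  constructor
  · rintro ⟨t, h1, h2, _, ⟨a, ha, rfl⟩, rfl⟩
    exact ⟨t • a, ⟨t, h1, h2, a, ha, rfl⟩, smul_comm _ _ _⟩
  · rintro ⟨_, ⟨t, h1, h2, a, ha, rfl⟩, rfl⟩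
    exact ⟨t, h1, h2, _, ⟨a, ha, rfl⟩, smul_comm _ _ _⟩

theorem Cn_iso (R : EuclideanSpace ℝ (Fin n) ≃ₗᵢ[ℝ] EuclideanSpace ℝ (Fin n)) (A : Set (EuclideanSpace ℝ (Fin n))) :
    Cn (R '' A) = R '' Cn A := by
  ext x
  constructor
  · rintro ⟨t, h1, h2, _, ⟨a, ha, rfl⟩, rfl⟩
    exact ⟨t • a, ⟨t, h1, h2, a, ha, rfl⟩, by simp⟩
  · rintro ⟨_, ⟨t, h1, h2, a, ha, rfl⟩, rfl⟩
    exact ⟨t, h1, h2, _, ⟨a, ha, rfl⟩, by simp⟩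

theorem vol_smul_image (s : ℝ) (A : Set (EuclideanSpace ℝ (Fin n))) :
    volume ((fun x => s • x) '' A) = ENNReal.ofReal (|s ^ n|) * volume A := by
  have := Measure.addHaar_smul (volume : Measure (EuclideanSpace ℝ (Fin n))) s A
  rwa [finrank_euclideanSpace_fin] at this

theorem flat_gen (hn : 2 ≤ n) :
    ∃ c : ℝ≥0∞, c ≠ ∞ ∧ ∀ (w : EuclideanSpace ℝ (Fin n)) (r : ℝ), w ≠ 0 → 0 < r →
      ∀ B : Set (EuclideanSpace ℝ (Fin n)), MeasurableSet B → (∀ x ∈ B, ⟪w, x⟫ = r) →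
      volume (Cn B) = ENNReal.ofReal (r * ‖w‖⁻¹) * c * Measure.hausdorffMeasure ((n:ℝ)-1) B := by
  set e0 : EuclideanSpace ℝ (Fin n) := EuclideanSpace.single ⟨0, by omega⟩ 1 with he0'
  have he0 : ‖e0‖ = 1 := by rw [he0', EuclideanSpace.norm_single]; simp
  obtain ⟨c, hc, hflat⟩ := flat_base hn e0 he0
  refine ⟨c, hc, fun w r hw hr B hB hBw => ?_⟩
  have hw0 : 0 < ‖w‖ := norm_pos_iff.2 hw
  set s := r * ‖w‖⁻¹ with hs
  have hs0 : 0 < s := by positivity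
  set R := Submodule.reflection (Submodule.span ℝ {‖w‖⁻¹ • w - e0})ᗮ with hR
  have hRe : R (‖w‖⁻¹ • w) = e0 := Submodule.reflection_sub (by rw [norm_smul, he0]; simp [hw0.ne'])
  set B2 := R '' ((fun x => s⁻¹ • x) '' B) with hB2
  have hmB1 : MeasurableSet ((fun x : EuclideanSpace ℝ (Fin n) => s⁻¹ • x) '' B) := by
    exact hB.const_smul₀ s⁻¹
  have hmB2 : MeasurableSet B2 := by
    rw [hB2]
    exact (R.toHomeomorph.toMeasurableEquiv.measurableSet_image).2 hmB1
  have h1 := hflat B2 hmB2 (by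
    rintro _ ⟨_, ⟨b, hb, rfl⟩, rfl⟩
    rw [← hRe, LinearIsometryEquiv.inner_map_map, inner_smul_left, inner_smul_right, hBw b hb, hs]
    simp
    field_simp)
  have hv : volume (Cn B2) = ENNReal.ofReal (|s⁻¹ ^ n|) * volume (Cn B) := by
    rw [hB2, Cn_iso, Cn_smul, ← vol_smul_image]
    rw [R.image_eq_preimage_symm]
    exact R.symm.measurePreserving.measure_preimage_equiv (f := R.symm.toHomeomorph.toMeasurableEquiv) _
  have hh : Measure.hausdorffMeasure ((n:ℝ)-1) B2 = ENNReal.ofReal (s⁻¹ ^ ((n:ℝ)-1)) * Measure.hausdorffMeasure ((n:ℝ)-1) B := by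
    have hn1 : (0:ℝ) ≤ (n:ℝ) - 1 := by
      have : (2:ℝ) ≤ n := by exact_mod_cast hn
      linarith
    rw [hB2, R.isometry.hausdorffMeasure_image (Or.inl hn1)]
    have := Measure.hausdorffMeasure_smul₀ (𝕜 := ℝ) hn1 (inv_ne_zero hs0.ne') B
    refine this.trans ?_
    rw [ENNReal.smul_def, smul_eq_mul]
    congr 1
    rw [ENNReal.coe_rpow_of_nonneg _ hn1, ← ENNReal.ofReal_rpow_of_nonneg (by positivity) hn1]
    congr 1
    rw [← enorm_eq_nnnorm, ← ofReal_norm, Real.norm_of_nonneg (inv_nonneg.2 hs0.le)]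
  rw [hv, hh] at h1
  have hpos : 0 < s⁻¹ ^ n := by positivity
  have e : volume (Cn B) = ENNReal.ofReal (s^n) * (ENNReal.ofReal (|s⁻¹ ^ n|) * volume (Cn B)) := by
    rw [← mul_assoc, ← ENNReal.ofReal_mul (by positivity), abs_of_pos hpos, ← mul_pow, mul_inv_cancel₀ hs0.ne']
    simp
  rw [e, h1]
  have e3 : s ^ n * s⁻¹ ^ ((n:ℝ)-1) = s := by
    rw [Real.inv_rpow hs0.le, ← Real.rpow_neg hs0.le, ← Real.rpow_natCast, ← Real.rpow_add hs0]
    conv_rhs => rw [← Real.rpow_one s]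
    congr 1; ring
  calc _ = (ENNReal.ofReal (s^n) * ENNReal.ofReal (s⁻¹ ^ ((n:ℝ)-1))) * c * Measure.hausdorffMeasure ((n:ℝ)-1) B := by ring
    _ = _ := by rw [← ENNReal.ofReal_mul (by positivity), e3]
end

end

section

section
variable {n m : ℕ} {P : EuclideanSpace ℝ (Fin n) → ℝ}

theorem inner_gradient (ξ h : EuclideanSpace ℝ (Fin n)) :
    ⟪gradient P ξ, h⟫ = fderiv ℝ P ξ h := by
  rw [gradient, InnerProductSpace.toDual_symm_apply]

theorem norm_gradient (ξ : EuclideanSpace ℝ (Fin n)) :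
    ‖gradient P ξ‖ = ‖fderiv ℝ P ξ‖ := by
  rw [gradient, LinearIsometryEquiv.norm_map]

theorem polProj_one {ξ : EuclideanSpace ℝ (Fin n)} (h : P ξ = 1) : polProj m P ξ = ξ := by
  unfold polProj; rw [h]; simp

theorem cone_eq_Cn (hP : GoodP m P) {A : Set (EuclideanSpace ℝ (Fin n))} (hA : MeasurableSet A)
    (hA1 : ∀ a ∈ A, P a = 1) : coneM m P A = volume (Cn A) := by
  rw [hP.coneM_apply hA]
  congr 1
  ext x
  simp only [Set.mem_inter_iff, Set.mem_preimage, Set.mem_ofPred_eq, Cn]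
  constructor
  · rintro ⟨h1, h2⟩
    have hx : x ≠ 0 := by
      rintro rfl
      have := hA1 _ h1
      rw [polProj, smul_zero, hP.zero] at this
      norm_num at this
    have hp := hP.pos x hx
    exact ⟨_, by positivity, Real.rpow_le_one hp.le h2 (by positivity), _, h1, (hP.polProj_recover hx).symm⟩
  · rintro ⟨t, h1, h2, a, ha, rfl⟩
    rw [hP.polProj_smul h1, polProj_one (hA1 a ha), hP.hom, hA1 a ha, mul_one]
    exact ⟨ha, pow_le_one₀ h1.le h2⟩

theorem local_chart (hP : GoodP m P) {ξ0 : EuclideanSpace ℝ (Fin n)} (h0 : P ξ0 = 1) {ε : ℝ} (hε : 0 < ε)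
    (hε1 : ε ≤ 1) :
    ∃ U ∈ nhds ξ0, (∀ ξ ∈ U, 0 < fderiv ℝ P ξ0 ξ ∧ (m:ℝ) / fderiv ℝ P ξ0 ξ ≤ 1 + ε ∧
      fderiv ℝ P ξ0 ξ / m ≤ 1 + ε ∧ ‖fderiv ℝ P ξ‖ ≤ (1+ε) * ‖fderiv ℝ P ξ0‖ ∧
      ‖fderiv ℝ P ξ0‖ ≤ (1+ε) * ‖fderiv ℝ P ξ‖) ∧
      ∀ ξ ∈ U, ∀ η ∈ U, P ξ = 1 → P η = 1 →
        ‖((m:ℝ) / fderiv ℝ P ξ0 ξ) • ξ - ((m:ℝ) / fderiv ℝ P ξ0 η) • η‖ ≤ (1+ε) * ‖ξ - η‖ ∧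
        ‖ξ - η‖ ≤ (1+ε) * ‖((m:ℝ) / fderiv ℝ P ξ0 ξ) • ξ - ((m:ℝ) / fderiv ℝ P ξ0 η) • η‖ := by
  set L := fderiv ℝ P ξ0 with hL
  have hm0 : (0:ℝ) < m := by have := hP.hm; exact_mod_cast (by omega : 0 < m)
  have hL0 : L ξ0 = m := by rw [hL, hP.euler1, h0, mul_one]
  have hLn : 0 < ‖L‖ := by
    rw [norm_pos_iff]
    intro h
    rw [h] at hL0
    simp at hL0
    exact hP.m_ne (by exact_mod_cast hL0.symm)
  set G : EuclideanSpace ℝ (Fin n) → EuclideanSpace ℝ (Fin n) := fun ξ => ((m:ℝ) / L ξ) • ξ - ξ + (P ξ / m) • ξ0 with hG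
  have hPs : HasStrictFDerivAt P L ξ0 := hP.smooth.contDiffAt.hasStrictFDerivAt (by simp)
  have hLs : HasStrictFDerivAt (fun ξ => L ξ) L ξ0 := L.hasStrictFDerivAt
  have hGs : HasStrictFDerivAt G (0 : EuclideanSpace ℝ (Fin n) →L[ℝ] EuclideanSpace ℝ (Fin n)) ξ0 := by
    have hinv : HasStrictFDerivAt (fun ξ => (L ξ)⁻¹) ((-((m:ℝ)^2)⁻¹) • L) ξ0 := by
      have := (hasStrictDerivAt_inv (x := L ξ0) (by rw [hL0]; exact hm0.ne')).comp_hasStrictFDerivAt ξ0 hLs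
      rwa [hL0] at this
    have hid : HasStrictFDerivAt (fun ξ : EuclideanSpace ℝ (Fin n) => ξ)
      (ContinuousLinearMap.id ℝ (EuclideanSpace ℝ (Fin n))) ξ0 := hasStrictFDerivAt_id ξ0
    have k1 := (hinv.const_mul (m:ℝ)).smul hid
    have k2 := (hPs.mul_const ((m:ℝ)⁻¹)).smul_const ξ0
    have h2 := (k1.sub hid).add k2
    have h3 := h2.congr_of_eventuallyEq (f₁ := G) (Filter.Eventually.of_forall fun ξ => by
      simp [hG, div_eq_mul_inv])
    refine h3.congr_fderiv ?_
    ext1 h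
    simp [hL0]
    rw [mul_inv_cancel₀ hm0.ne', one_smul,
      show (m:ℝ) * (((m:ℝ)^2)⁻¹ * L h) = (m:ℝ)⁻¹ * L h by field_simp]
    abel
  obtain ⟨U, hU, hlip⟩ := hGs.exists_lipschitzOnWith_of_nnnorm_lt (Real.toNNReal (ε/2)) (by simpa using hε)
  rw [lipschitzOnWith_iff_norm_sub_le, Real.coe_toNNReal _ (by positivity)] at hlip
  have hLc : Continuous fun ξ => L ξ := L.continuous
  have hdc : Continuous fun ξ => ‖fderiv ℝ P ξ‖ := hP.diff1.continuous.norm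
  have e1 : ∀ᶠ ξ in nhds ξ0, 0 < L ξ := hLc.continuousAt.eventually_const_lt (by beta_reduce; rw [hL0]; exact hm0)
  have e2 : ∀ᶠ ξ in nhds ξ0, (m:ℝ) / L ξ < 1 + ε := by
    have : ContinuousAt (fun ξ => (m:ℝ) / L ξ) ξ0 :=
      continuousAt_const.div hLc.continuousAt (by rw [hL0]; exact hm0.ne')
    refine this.eventually_lt_const ?_
    beta_reduce; rw [hL0, div_self hm0.ne']; linarith
  have e3 : ∀ᶠ ξ in nhds ξ0, L ξ / m < 1 + ε := by
    have : ContinuousAt (fun ξ => L ξ / (m:ℝ)) ξ0 := hLc.continuousAt.div_const _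
    refine this.eventually_lt_const ?_
    beta_reduce; rw [hL0, div_self hm0.ne']; linarith
  have e4 : ∀ᶠ ξ in nhds ξ0, ‖fderiv ℝ P ξ‖ < (1 + ε) * ‖L‖ := by
    refine hdc.continuousAt.eventually_lt_const ?_
    beta_reduce; rw [← hL]; nlinarith
  have e5 : ∀ᶠ ξ in nhds ξ0, ‖L‖ < (1 + ε) * ‖fderiv ℝ P ξ‖ := by
    refine (hdc.const_mul (1+ε)).continuousAt.eventually_const_lt ?_
    beta_reduce; rw [← hL]; nlinarith
  refine ⟨U ∩ {ξ | 0 < L ξ ∧ (m:ℝ) / L ξ ≤ 1 + ε ∧ L ξ / m ≤ 1 + ε ∧ ‖fderiv ℝ P ξ‖ ≤ (1+ε) * ‖L‖ ∧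
      ‖L‖ ≤ (1+ε) * ‖fderiv ℝ P ξ‖}, Filter.inter_mem hU ?_, fun ξ hξ => hξ.2, ?_⟩
  · filter_upwards [e1, e2, e3, e4, e5] with ξ h1 h2 h3 h4 h5
    exact ⟨h1, h2.le, h3.le, h4.le, h5.le⟩
  · intro ξ hξ η hη h1 h2
    have h3 := hlip hξ.1 hη.1
    set a := ((m:ℝ) / L ξ) • ξ - ((m:ℝ) / L η) • η with ha
    have h4 : G ξ - G η = a - (ξ - η) := by
      simp only [hG, h1, h2, ha]; abel
    rw [h4] at h3
    have h5 := norm_sub_norm_le a (ξ - η)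
    have h6 := norm_sub_norm_le (ξ - η) a
    rw [norm_sub_rev (ξ - η) a] at h6
    have h7 := norm_nonneg (ξ - η)
    constructor
    · nlinarith
    · have h8 : (1 - ε/2) * ‖ξ - η‖ ≤ ‖a‖ := by nlinarith
      nlinarith [mul_nonneg h7 hε.le, mul_le_mul_of_nonneg_left h8 (by linarith : 0 ≤ 1 + ε), mul_nonneg (mul_nonneg h7 hε.le) (sub_nonneg.2 hε1)]
end

end

section

section
variable {n m : ℕ} {P : EuclideanSpace ℝ (Fin n) → ℝ}

theorem Cn_vol_le {k : ℝ} (hk : 0 < k) {A B : Set (EuclideanSpace ℝ (Fin n))}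
    (h : ∀ a ∈ A, ∃ s, 0 < s ∧ s ≤ k ∧ ∃ b ∈ B, a = s • b) :
    volume (Cn A) ≤ ENNReal.ofReal k ^ n * volume (Cn B) := by
  rw [← ENNReal.ofReal_pow hk.le, ← abs_of_pos (pow_pos hk n), ← vol_smul_image]
  apply measure_mono
  rintro _ ⟨t, h1, h2, a, ha, rfl⟩
  obtain ⟨s, hs, hsk, b, hb, rfl⟩ := h a ha
  refine ⟨(t * s / k) • b, ⟨t * s / k, by positivity, ?_, b, hb, rfl⟩, ?_⟩
  · rw [div_le_one hk]
    calc t * s ≤ 1 * s := by gcongr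
      _ ≤ k := by linarith
  · simp only [smul_smul]
    congr 1
    field_simp

theorem local_cmp (hP : GoodP m P) {c : ℝ≥0∞}
    (hflat : ∀ (w : EuclideanSpace ℝ (Fin n)) (r : ℝ), w ≠ 0 → 0 < r →
      ∀ B : Set (EuclideanSpace ℝ (Fin n)), MeasurableSet B → (∀ x ∈ B, ⟪w, x⟫ = r) →
      volume (Cn B) = ENNReal.ofReal (r * ‖w‖⁻¹) * c * Measure.hausdorffMeasure ((n:ℝ)-1) B)
    {ξ0 : EuclideanSpace ℝ (Fin n)} (h0 : P ξ0 = 1) {ε : ℝ} (hε : 0 < ε)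
    (hε1 : ε ≤ 1) :
    ∃ U ∈ nhds ξ0, ∀ A : Set (EuclideanSpace ℝ (Fin n)), MeasurableSet A → A ⊆ U → (∀ a ∈ A, P a = 1) →
      coneM m P A ≤ ENNReal.ofReal (1+ε) ^ (2*n+1) *
        (ENNReal.ofReal m * c * ∫⁻ ξ in A, ENNReal.ofReal (‖gradient P ξ‖⁻¹) ∂(Measure.hausdorffMeasure ((n:ℝ)-1))) ∧
      ENNReal.ofReal m * c * ∫⁻ ξ in A, ENNReal.ofReal (‖gradient P ξ‖⁻¹) ∂(Measure.hausdorffMeasure ((n:ℝ)-1)) ≤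
        ENNReal.ofReal (1+ε) ^ (2*n+1) * coneM m P A := by
  obtain ⟨U, hU, hU1, hU2⟩ := local_chart hP h0 hε hε1
  refine ⟨U, hU, fun A hA hAU hA1 => ?_⟩
  set L := fderiv ℝ P ξ0 with hL
  have hm0 : (0:ℝ) < m := by have := hP.hm; exact_mod_cast (by omega : 0 < m)
  have hL0 : L ξ0 = m := by rw [hL, hP.euler1, h0, mul_one]
  have hLn : 0 < ‖L‖ := by
    rw [norm_pos_iff]
    intro h
    rw [h] at hL0
    simp at hL0
    exact hP.m_ne (by exact_mod_cast hL0.symm)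
  have hn1 : (0:ℝ) ≤ (n:ℝ) - 1 := by
    have : (2:ℝ) ≤ n := by exact_mod_cast hP.hn
    linarith
  rw [cone_eq_Cn hP hA hA1]
  set k := 1 + ε with hk
  have hk0 : 0 < k := by positivity
  set B := {ζ | L ζ = m ∧ polProj m P ζ ∈ A} with hB
  have hBm : MeasurableSet B :=
    (measurableSet_eq_fun L.continuous.measurable measurable_const).inter (hP.polProj_meas hA)
  have hLpos : ∀ a ∈ A, 0 < L a := fun a ha => (hU1 a (hAU ha)).1
  have hpiA : ∀ a ∈ A, ((m:ℝ) / L a) • a ∈ B ∧ polProj m P (((m:ℝ) / L a) • a) = a := by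
    intro a ha
    have h1 := hLpos a ha
    have h2 : polProj m P (((m:ℝ) / L a) • a) = a := by
      rw [hP.polProj_smul (by positivity), polProj_one (hA1 a ha)]
    refine ⟨⟨?_, by rwa [h2]⟩, h2⟩
    rw [map_smul, smul_eq_mul, div_mul_cancel₀ _ h1.ne']
  have hBpi : ∀ ζ ∈ B, ∃ a ∈ A, ζ = ((m:ℝ) / L a) • a := by
    rintro ζ ⟨h1, h2⟩
    refine ⟨_, h2, ?_⟩
    have hz : ζ ≠ 0 := by
      rintro rfl
      rw [map_zero] at h1
      exact hm0.ne h1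
    have hp := hP.pos ζ hz
    unfold polProj
    have hs : 0 < ((P ζ) ^ (1/(m:ℝ)))⁻¹ := by positivity
    generalize ((P ζ) ^ (1/(m:ℝ)))⁻¹ = s at hs
    rw [map_smul, h1, smul_smul, smul_eq_mul, show (m:ℝ) / (s * m) * s = 1 by field_simp, one_smul]
  have hBA : B = (fun a => ((m:ℝ) / L a) • a) '' A := by
    ext ζ; constructor
    · intro h; obtain ⟨a, ha, rfl⟩ := hBpi ζ h; exact ⟨a, ha, rfl⟩
    · rintro ⟨a, ha, rfl⟩; exact (hpiA a ha).1
  have hAB : A = polProj m P '' B := by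
    ext a; constructor
    · intro h; exact ⟨_, (hpiA a h).1, (hpiA a h).2⟩
    · rintro ⟨a, ha, rfl⟩; exact ha.2
  have hl1 : LipschitzOnWith k.toNNReal (fun a => ((m:ℝ) / L a) • a) A := by
    rw [lipschitzOnWith_iff_norm_sub_le, Real.coe_toNNReal _ hk0.le]
    intro a ha b hb
    exact (hU2 a (hAU ha) b (hAU hb) (hA1 a ha) (hA1 b hb)).1
  have hl2 : LipschitzOnWith k.toNNReal (polProj m P) B := by
    rw [lipschitzOnWith_iff_norm_sub_le, Real.coe_toNNReal _ hk0.le]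
    intro x hx y hy
    obtain ⟨a, ha, rfl⟩ := hBpi x hx
    obtain ⟨b, hb, rfl⟩ := hBpi y hy
    rw [(hpiA a ha).2, (hpiA b hb).2]
    exact (hU2 a (hAU ha) b (hAU hb) (hA1 a ha) (hA1 b hb)).2
  set K := ENNReal.ofReal k with hK
  have hK1 : 1 ≤ K := by rw [hK, ← ENNReal.ofReal_one]; exact ENNReal.ofReal_le_ofReal (by linarith)
  have hKp : K ^ ((n:ℝ)-1) ≤ K ^ n := by
    rw [← ENNReal.rpow_natCast]; exact ENNReal.rpow_le_rpow_of_exponent_le hK1 (by linarith)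
  set μ : Measure (EuclideanSpace ℝ (Fin n)) := Measure.hausdorffMeasure ((n:ℝ)-1) with hμ
  have hm1 : μ B ≤ K ^ n * μ A := by
    have := hl1.hausdorffMeasure_image_le hn1
    rw [← hBA] at this
    exact this.trans (by gcongr; exact hKp)
  have hm2 : μ A ≤ K ^ n * μ B := by
    have := hl2.hausdorffMeasure_image_le hn1
    rw [← hAB] at this
    exact this.trans (by gcongr; exact hKp)
  have hv1 : volume (Cn A) ≤ K ^ n * volume (Cn B) := Cn_vol_le hk0 (by
    intro a ha
    have h1 := hLpos a ha
    refine ⟨L a / m, by positivity, (hU1 a (hAU ha)).2.2.1, _, (hpiA a ha).1, ?_⟩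
    rw [smul_smul, div_mul_div_cancel₀ hm0.ne', div_self h1.ne', one_smul])
  have hv2 : volume (Cn B) ≤ K ^ n * volume (Cn A) := Cn_vol_le hk0 (by
    intro x hx
    obtain ⟨a, ha, rfl⟩ := hBpi x hx
    have h1 := hLpos a ha
    exact ⟨_, by positivity, (hU1 a (hAU ha)).2.1, a, ha, rfl⟩)
  have hf : volume (Cn B) = ENNReal.ofReal m * c * (ENNReal.ofReal (‖L‖⁻¹) * μ B) := by
    have hw : gradient P ξ0 ≠ 0 := by rw [← norm_pos_iff, norm_gradient]; exact hLn
    rw [hflat (gradient P ξ0) m hw hm0 B hBm (fun x hx => by rw [inner_gradient]; exact hx.1), norm_gradient,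
      ENNReal.ofReal_mul hm0.le]
    ring
  have hi1 : ENNReal.ofReal (‖L‖⁻¹) * μ A ≤ K * ∫⁻ ξ in A, ENNReal.ofReal (‖gradient P ξ‖⁻¹) ∂μ := by
    rw [← lintegral_const_mul' _ _ (by simp [hK]), ← setLIntegral_const]
    refine setLIntegral_mono' hA fun ξ hξ => ?_
    rw [hK, ← ENNReal.ofReal_mul hk0.le, norm_gradient]
    apply ENNReal.ofReal_le_ofReal
    have h1 := (hU1 ξ (hAU hξ)).2.2.2
    have h2 : 0 < ‖fderiv ℝ P ξ‖ := by nlinarith [h1.2]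
    rw [← div_eq_mul_inv, inv_eq_one_div, div_le_div_iff₀ hLn h2]
    linarith [h1.1]
  have hi2 : ∫⁻ ξ in A, ENNReal.ofReal (‖gradient P ξ‖⁻¹) ∂μ ≤ K * (ENNReal.ofReal (‖L‖⁻¹) * μ A) := by
    rw [← mul_assoc, ← setLIntegral_const]
    refine setLIntegral_mono' hA fun ξ hξ => ?_
    rw [hK, ← ENNReal.ofReal_mul hk0.le, norm_gradient]
    apply ENNReal.ofReal_le_ofReal
    have h1 := (hU1 ξ (hAU hξ)).2.2.2
    have h2 : 0 < ‖fderiv ℝ P ξ‖ := by nlinarith [h1.2]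
    rw [← div_eq_mul_inv, inv_eq_one_div, div_le_div_iff₀ h2 hLn]
    linarith [h1.2]
  constructor
  · calc volume (Cn A) ≤ K ^ n * (ENNReal.ofReal m * c * (ENNReal.ofReal (‖L‖⁻¹) * μ B)) := hv1.trans (by rw [hf])
      _ ≤ K ^ n * (ENNReal.ofReal m * c * (ENNReal.ofReal (‖L‖⁻¹) * (K ^ n * μ A))) := by gcongr
      _ = K ^ (2*n) * (ENNReal.ofReal m * c * (ENNReal.ofReal (‖L‖⁻¹) * μ A)) := by ring
      _ ≤ K ^ (2*n) * (ENNReal.ofReal m * c * (K * ∫⁻ ξ in A, ENNReal.ofReal (‖gradient P ξ‖⁻¹) ∂μ)) := by gcongr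
      _ = _ := by ring
  · calc _ ≤ ENNReal.ofReal m * c * (K * (ENNReal.ofReal (‖L‖⁻¹) * μ A)) := by gcongr
      _ ≤ ENNReal.ofReal m * c * (K * (ENNReal.ofReal (‖L‖⁻¹) * (K ^ n * μ B))) := by gcongr
      _ = K ^ (n+1) * volume (Cn B) := by rw [hf]; ring
      _ ≤ K ^ (n+1) * (K ^ n * volume (Cn A)) := by gcongr
      _ = _ := by ring
end

end

section

section
variable {n m : ℕ} {P : EuclideanSpace ℝ (Fin n) → ℝ}

theorem measure_le_of_local {X : Type*} [TopologicalSpace X] [SecondCountableTopology X] [MeasurableSpace X]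
    [OpensMeasurableSpace X] {μ ν : Measure X} {S : Set X} {K : ℝ≥0∞}
    (h : ∀ x ∈ S, ∃ U ∈ nhds x, ∀ A, MeasurableSet A → A ⊆ U → A ⊆ S → μ A ≤ K * ν A)
    {A : Set X} (hA : MeasurableSet A) (hAS : A ⊆ S) : μ A ≤ K * ν A := by
  choose! U hU hUA using h
  obtain ⟨t, htS, htc, ht⟩ := TopologicalSpace.countable_cover_nhdsWithin (s := S) (f := fun x => interior (U x))
    (fun x hx => mem_nhdsWithin_of_mem_nhds (interior_mem_nhds.2 (hU x hx)))
  rcases t.eq_empty_or_nonempty with rfl | hne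
  · have : A = ∅ := by
      apply Set.subset_empty_iff.1
      refine (hAS.trans ht).trans ?_
      simp
    simp [this]
  obtain ⟨g, hg⟩ := htc.exists_eq_range hne
  have hgS : ∀ i, g i ∈ S := fun i => htS (hg ▸ Set.mem_range_self i)
  set V : ℕ → Set X := fun i => interior (U (g i)) with hV
  have hVm : ∀ i, MeasurableSet (disjointed V i) := fun i =>
    MeasurableSet.disjointed (fun i => isOpen_interior.measurableSet) i
  have hAe : A = ⋃ i, (A ∩ disjointed V i) := by
    rw [← Set.inter_iUnion, iUnion_disjointed, Set.inter_eq_left.2]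
    refine (hAS.trans ht).trans ?_
    rw [hg]; simp [hV]
  have hd : Pairwise (Function.onFun Disjoint fun i => A ∩ disjointed V i) := by
    intro i j hij
    exact ((disjoint_disjointed V) hij).mono Set.inter_subset_right Set.inter_subset_right
  rw [hAe, measure_iUnion hd (fun i => hA.inter (hVm i)), measure_iUnion hd (fun i => hA.inter (hVm i)),
    ← ENNReal.tsum_mul_left]
  refine ENNReal.tsum_le_tsum fun i => ?_
  exact hUA (g i) (hgS i) _ (hA.inter (hVm i))
    (Set.inter_subset_right.trans ((disjointed_subset V i).trans interior_subset)) (Set.inter_subset_left.trans hAS)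

theorem le_of_eps {a b : ℝ≥0∞} {N : ℕ} (h : ∀ ε : ℝ, 0 < ε → ε ≤ 1 → a ≤ ENNReal.ofReal (1+ε) ^ N * b) : a ≤ b := by
  have h1 : Filter.Tendsto (fun ε : ℝ => ENNReal.ofReal (1+ε) ^ N * b) (nhdsWithin 0 (Set.Ioi 0)) (nhds (1 * b)) := by
    apply ENNReal.Tendsto.mul_const _ (Or.inl one_ne_zero)
    have : Continuous fun ε : ℝ => ENNReal.ofReal (1+ε) ^ N :=
      (ENNReal.continuous_pow N).comp (ENNReal.continuous_ofReal.comp (by fun_prop))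
    have h2 := this.tendsto 0
    simp only [add_zero, ENNReal.ofReal_one, one_pow] at h2
    exact h2.mono_left nhdsWithin_le_nhds
  rw [one_mul] at h1
  refine ge_of_tendsto h1 ?_
  filter_upwards [Ioc_mem_nhdsGT (zero_lt_one' ℝ)] with ε hε
  exact h ε hε.1 hε.2

/-- the surface measure `|∇P|⁻¹ dσ` on `P = lam`. -/
def surfM (P : EuclideanSpace ℝ (Fin n) → ℝ) (lam : ℝ) : Measure (EuclideanSpace ℝ (Fin n)) :=
  ((Measure.hausdorffMeasure ((n:ℝ)-1)).restrict {ξ | P ξ = lam}).withDensity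
    (fun ξ => ((‖gradient P ξ‖₊⁻¹ : NNReal) : ℝ≥0∞))

theorem grad_meas (hP : GoodP m P) : Measurable fun ξ => ‖gradient P ξ‖₊⁻¹ := by
  have : Measurable fun ξ => ‖fderiv ℝ P ξ‖₊⁻¹ := hP.diff1.continuous.nnnorm.measurable.inv
  convert this using 3 with ξ
  exact NNReal.eq (norm_gradient ξ)

theorem surf_ms (hP : GoodP m P) (lam : ℝ) : MeasurableSet {ξ | P ξ = lam} :=
  measurableSet_eq_fun hP.continuous.measurable measurable_const

theorem coneM_eq_surf (hP : GoodP m P) : ∃ c : ℝ≥0∞, c ≠ 0 ∧ c ≠ ∞ ∧ coneM m P = c • surfM P 1 := by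
  obtain ⟨c, hc, hflat⟩ := flat_gen hP.hn
  set C := ENNReal.ofReal m * c with hC
  have hdens : ∀ A ⊆ {ξ | P ξ = 1}, MeasurableSet A → surfM P 1 A =
      ∫⁻ ξ in A, ENNReal.ofReal (‖gradient P ξ‖⁻¹) ∂(Measure.hausdorffMeasure ((n:ℝ)-1)) := by
    intro A hA hAm
    rw [surfM, withDensity_apply _ hAm, Measure.restrict_restrict hAm, Set.inter_eq_left.2 hA]
    congr 1
    ext ξ
    rw [ENNReal.ofReal, Real.toNNReal_inv]
    simp
  have key : ∀ A ⊆ {ξ | P ξ = 1}, MeasurableSet A → coneM m P A = C * surfM P 1 A := by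
    intro A hA hAm
    apply le_antisymm
    · refine le_of_eps (N := 2*n+1) fun ε h1 h2 => ?_
      have := measure_le_of_local (μ := coneM m P) (ν := C • surfM P 1) (S := {ξ | P ξ = 1})
        (K := ENNReal.ofReal (1+ε) ^ (2*n+1)) (fun x hx => by
          obtain ⟨U, hU, hUA⟩ := local_cmp hP hflat hx h1 h2
          refine ⟨U, hU, fun A hA hAU hAS => ?_⟩
          have := (hUA A hA hAU hAS).1
          rwa [← hdens A hAS hA] at this) hAm hA
      simpa using this
    · refine le_of_eps (N := 2*n+1) fun ε h1 h2 => ?_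
      have := measure_le_of_local (ν := coneM m P) (μ := C • surfM P 1) (S := {ξ | P ξ = 1})
        (K := ENNReal.ofReal (1+ε) ^ (2*n+1)) (fun x hx => by
          obtain ⟨U, hU, hUA⟩ := local_cmp hP hflat hx h1 h2
          refine ⟨U, hU, fun A hA hAU hAS => ?_⟩
          have := (hUA A hA hAU hAS).2
          rwa [← hdens A hAS hA] at this) hAm hA
      simpa using this
  have hS := surf_ms hP 1
  have hsa : ∀ᵐ ξ ∂(surfM P 1), P ξ = 1 := by
    refine (withDensity_absolutelyContinuous _ _).ae_le ?_
    exact ae_restrict_mem hS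
  have heq : coneM m P = C • surfM P 1 := by
    ext A hA
    have e1 : coneM m P A = coneM m P (A ∩ {ξ | P ξ = 1}) := by
      apply measure_congr
      filter_upwards [hP.coneM_ae] with x hx
      apply propext
      exact ⟨fun h => ⟨h, hx⟩, fun h => h.1⟩
    have e2 : surfM P 1 A = surfM P 1 (A ∩ {ξ | P ξ = 1}) := by
      apply measure_congr
      filter_upwards [hsa] with x hx
      apply propext
      exact ⟨fun h => ⟨h, hx⟩, fun h => h.1⟩
    rw [Measure.smul_apply, smul_eq_mul, e1, e2, key _ Set.inter_subset_right (hA.inter hS)]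
  refine ⟨C, ?_, ENNReal.mul_ne_top ENNReal.ofReal_ne_top hc, heq⟩
  intro h
  have h1 : coneM m P Set.univ = 0 := by rw [heq, h]; simp
  rw [hP.coneM_apply MeasurableSet.univ, Set.preimage_univ, Set.univ_inter] at h1
  have h2 : 0 < volume {ξ | P ξ < 1} := by
    apply IsOpen.measure_pos _ (isOpen_lt hP.continuous continuous_const)
    exact ⟨0, by simp [hP.zero]⟩
  have h3 : volume {ξ | P ξ < 1} ≤ volume {ξ | P ξ ≤ 1} := measure_mono (fun x (hx : P x < 1) => (hx.le : P x ≤ 1))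
  rw [h1] at h3
  exact absurd h2 (not_lt.2 h3)

theorem surf_eq_cone (hP : GoodP m P) : ∃ c : ℝ, 0 < c ∧ ∀ h : EuclideanSpace ℝ (Fin n) → ℂ,
    ∫ ξ in {ξ | P ξ = 1}, h ξ * ((‖gradient P ξ‖⁻¹:ℝ):ℂ) ∂(Measure.hausdorffMeasure ((n:ℝ)-1)) =
      (c:ℂ) * ∫ ξ, h ξ ∂(coneM m P) := by
  obtain ⟨c, h0, ht, he⟩ := coneM_eq_surf hP
  refine ⟨c.toReal⁻¹, inv_pos.2 (ENNReal.toReal_pos h0 ht), fun h => ?_⟩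
  have h1 := ENNReal.toReal_pos h0 ht
  rw [he, integral_smul_measure, surfM, integral_withDensity_eq_integral_smul (grad_meas hP)]
  rw [Complex.real_smul, ← mul_assoc, ← Complex.ofReal_mul, inv_mul_cancel₀ h1.ne', Complex.ofReal_one, one_mul]
  congr 1
  ext ξ
  rw [NNReal.smul_def, Complex.real_smul, mul_comm]
  simp
end

end

section

section
variable {n m : ℕ} {P : EuclideanSpace ℝ (Fin n) → ℝ}

theorem eLpNorm_dil (F : EuclideanSpace ℝ (Fin n) → ℂ) (q : ℝ≥0∞) {s : ℝ} (hs : 0 < s) :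
    eLpNorm (fun x => F (s • x)) q volume = ENNReal.ofReal (s ^ (-((n:ℝ) * (1/q).toReal))) * eLpNorm F q volume := by
  have h1 := (measurableEmbedding_const_smul₀ (α := EuclideanSpace ℝ (Fin n)) hs.ne').eLpNorm_map_measure
    (g := F) (p := q) (μ := volume)
  rw [Measure.map_addHaar_smul _ hs.ne', finrank_euclideanSpace_fin,
    eLpNorm_smul_measure_of_ne_zero (by simp; positivity)] at h1
  refine h1.symm.trans ?_
  rw [smul_eq_mul]
  congr 1
  rw [ENNReal.ofReal_rpow_of_pos (by positivity), abs_of_pos (by positivity), ← Real.rpow_natCast,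
    ← Real.rpow_neg hs.le, ← Real.rpow_mul hs.le]
  congr 2
  ring

theorem haus_scale (hP : GoodP m P) {r : ℝ} (hr : 0 < r) (h : EuclideanSpace ℝ (Fin n) → ℂ) :
    ∫ ξ in {ξ | P ξ = r ^ m}, h ξ ∂(Measure.hausdorffMeasure ((n:ℝ)-1)) =
      ((r ^ ((n:ℝ)-1) : ℝ) : ℂ) * ∫ ξ in {ξ | P ξ = 1}, h (r • ξ) ∂(Measure.hausdorffMeasure ((n:ℝ)-1)) := by
  have hn1 : (0:ℝ) ≤ (n:ℝ) - 1 := by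
    have : (2:ℝ) ≤ n := by exact_mod_cast hP.hn
    linarith
  set μ : Measure (EuclideanSpace ℝ (Fin n)) := Measure.hausdorffMeasure ((n:ℝ)-1) with hμ
  have hemb := measurableEmbedding_const_smul₀ (α := EuclideanSpace ℝ (Fin n)) hr.ne'
  have hrm : 0 < r ^ m := by positivity
  have hmeas : μ.restrict {ξ | P ξ = r ^ m} =
      (‖r‖₊ ^ ((n:ℝ)-1)) • Measure.map (fun x => r • x) (μ.restrict {ξ | P ξ = 1}) := by
    ext A hA
    rw [Measure.smul_apply, hemb.map_apply, Measure.restrict_apply hA,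
      Measure.restrict_apply (hemb.measurable hA), hμ]
    have := Measure.hausdorffMeasure_smul₀ (𝕜 := ℝ) hn1 hr.ne'
      ((fun x : EuclideanSpace ℝ (Fin n) => r • x) ⁻¹' A ∩ {ξ | P ξ = 1})
    rw [← this]
    congr 1
    ext x
    rw [Set.mem_smul_set]
    constructor
    · rintro ⟨h1, h2⟩
      have h3 : r • (r⁻¹ • x) = x := by rw [smul_smul, mul_inv_cancel₀ hr.ne', one_smul]
      refine ⟨r⁻¹ • x, ⟨by simpa [h3] using h1, ?_⟩, h3⟩
      simp only [Set.mem_ofPred_eq] at h2 ⊢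
      rw [hP.hom, h2, ← mul_pow, inv_mul_cancel₀ hr.ne', one_pow]
    · rintro ⟨y, ⟨h1, h2⟩, rfl⟩
      refine ⟨h1, ?_⟩
      simp only [Set.mem_ofPred_eq] at h2 ⊢
      rw [hP.hom, h2, mul_one]
  rw [hmeas, integral_smul_nnreal_measure, hemb.integral_map, NNReal.smul_def, Complex.real_smul]
  congr 2
  simp [abs_of_pos hr]

theorem A_scale (hP : GoodP m P) : ∃ c : ℝ, 0 < c ∧ ∀ r : ℝ, 0 < r → ∀ f : EuclideanSpace ℝ (Fin n) → ℂ, ∀ x,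
    ∫ ξ in {ξ | P ξ = r ^ m}, cexp (I * (⟪x, ξ⟫ : ℂ)) * FT f ξ * ((‖gradient P ξ‖⁻¹:ℝ):ℂ)
      ∂(Measure.hausdorffMeasure ((n:ℝ)-1)) =
    ((c * r ^ ((n:ℝ) - m) : ℝ) : ℂ) * ER m P (fun x => (((r ^ n)⁻¹ : ℝ) : ℂ) * f (r⁻¹ • x)) (r • x) := by
  obtain ⟨c, hc, h⟩ := surf_eq_cone hP
  refine ⟨c, hc, fun r hr f x => ?_⟩
  rw [haus_scale hP hr]
  have e1 : ∀ ξ, cexp (I * (⟪x, r • ξ⟫ : ℂ)) * FT f (r • ξ) * ((‖gradient P (r • ξ)‖⁻¹:ℝ):ℂ) =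
      (((r ^ (m-1))⁻¹ : ℝ) : ℂ) * ((FT (fun x => (((r ^ n)⁻¹ : ℝ) : ℂ) * f (r⁻¹ • x)) ξ * cexp (I * (⟪r • x, ξ⟫ : ℂ))) *
        ((‖gradient P ξ‖⁻¹:ℝ):ℂ)) := by
    intro ξ
    rw [FT_dil f hr, norm_gradient, norm_gradient, hP.fderiv_hom r hr.ne', norm_smul, inner_smul_right,
      real_inner_smul_left, Real.norm_of_nonneg (by positivity), mul_inv]
    push_cast
    ring
  simp_rw [e1]
  rw [integral_const_mul, h, ER]
  rw [show r ^ ((n:ℝ) - m) = r ^ ((n:ℝ)-1) * (r ^ (m-1))⁻¹ by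
    rw [← Real.rpow_natCast, ← Real.rpow_neg hr.le, ← Real.rpow_add hr, Nat.cast_sub (by have := hP.hm; omega)]
    congr 1; push_cast; ring]
  push_cast
  ring

theorem hess_inj (hs : ContDiff ℝ (⊤ : ℕ∞) P) {ξ} (h : HessDet P ξ ≠ 0) (v : EuclideanSpace ℝ (Fin n))
    (hv : fderiv ℝ (fderiv ℝ P) ξ v = 0) : v = 0 := by
  have hd : DifferentiableAt ℝ (fderiv ℝ P) ξ :=
    ((hs.fderiv_right (m := (⊤:ℕ∞)) (by simp)).differentiable (by simp)).differentiableAt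
  have e1 : ∀ i j : Fin n, fderiv ℝ (fun y => fderiv ℝ P y (EuclideanSpace.single j 1)) ξ (EuclideanSpace.single i 1)
      = fderiv ℝ (fderiv ℝ P) ξ (EuclideanSpace.single i 1) (EuclideanSpace.single j 1) := by
    intro i j
    rw [fderiv_clm_apply hd (by fun_prop)]
    simp
  unfold HessDet at h
  have h2 := Matrix.eq_zero_of_vecMul_eq_zero h (v := fun i => v i) (by
    ext j
    simp only [Matrix.vecMul, dotProduct, Matrix.of_apply, e1, Pi.zero_apply]
    have hv2 : v = ∑ i, v i • EuclideanSpace.single i (1:ℝ) := by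
      ext k
      simp [Finset.sum_apply, Pi.single_apply]
    have := congrArg (fun T : EuclideanSpace ℝ (Fin n) →L[ℝ] ℝ => T (EuclideanSpace.single j 1)) hv
    rw [hv2] at this
    simpa using this)
  ext i
  exact congrFun h2 i

theorem goodP_of (hn : 2 ≤ n) (hm : 2 ≤ m)
    (Q : MvPolynomial (Fin n) ℝ) (hhom : Q.IsHomogeneous m)
    (hPf : ∀ ξ, P ξ = MvPolynomial.eval (fun i => ξ i) Q)
    (hell : ∀ ξ : EuclideanSpace ℝ (Fin n), ξ ≠ 0 → 0 < P ξ)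
    (hnd : ∀ ξ : EuclideanSpace ℝ (Fin n), ξ ≠ 0 → HessDet P ξ ≠ 0) : GoodP m P := by
  have hs : ContDiff ℝ (⊤ : ℕ∞) P := by
    have : P = fun ξ => MvPolynomial.eval (fun i => ξ i) Q := funext hPf
    rw [this]
    simp_rw [MvPolynomial.eval_eq]
    fun_prop
  refine ⟨hn, hm, hs, ?_, hell, fun ξ hξ v hv => hess_inj hs (hnd ξ hξ) v hv⟩
  intro r ξ
  rw [hPf, hPf]
  rw [MvPolynomial.eval_eq, MvPolynomial.eval_eq, Finset.mul_sum]
  refine Finset.sum_congr rfl fun d hd => ?_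
  have h1 : d.degree = m := by
    rw [Finsupp.degree_eq_weight_one]; exact hhom (MvPolynomial.mem_support_iff.1 hd)
  have h2 : r ^ m = ∏ i ∈ d.support, r ^ d i := by
    rw [Finset.prod_pow_eq_pow_sum, ← h1, Finsupp.degree_apply]
  rw [h2]
  simp only [PiLp.smul_apply, smul_eq_mul, mul_pow, Finset.prod_mul_distrib]
  ring

theorem SS_schwartz (f : SchwartzMap (EuclideanSpace ℝ (Fin n)) ℂ) : SS volume (⇑f) := by
  refine ⟨f.continuous.measurable, f.integrable, ?_⟩
  obtain ⟨C, hC⟩ := f.decay 0 0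
  exact ⟨C, fun x => by simpa using hC.2 x⟩
end

end

/-- Restriction-type estimate for the spectral measure of `P(D)`: the operator
`A_λ f(x) = (2π)^{−n} ∫_{Σ_λ} e^{ix·ξ} f̂(ξ) |∇P(ξ)|^{−1} dσ(ξ)` maps `L^p → L^q`
with norm `O(λ^{(n/m)(1/p−1/q)−1})`. -/
theorem statement4
    (n m : ℕ) (hn : 2 ≤ n) (hm : 2 ≤ m)
    (P : MvPolynomial (Fin n) ℝ) (hhom : P.IsHomogeneous m)
    (Pf : EuclideanSpace ℝ (Fin n) → ℝ)
    (hPf : ∀ ξ, Pf ξ = MvPolynomial.eval (fun i => ξ i) P)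
    (hell : ∀ ξ : EuclideanSpace ℝ (Fin n), ξ ≠ 0 → 0 < Pf ξ)
    (hnd : ∀ ξ : EuclideanSpace ℝ (Fin n), ξ ≠ 0 → HessDet Pf ξ ≠ 0)
    (p q : ℝ≥0∞) (hp : 1 ≤ p) (hq : 1 ≤ q)
    (hmin : 1/(2*(n : ℝ)) < min ((1/p).toReal - 1/2) (1/2 - (1/q).toReal))
    (hdiff : 2/((n : ℝ)+1) < (1/p).toReal - (1/q).toReal) :
    ∃ C : ℝ, 0 < C ∧ ∀ lam : ℝ, 0 < lam →
      ∀ f : SchwartzMap (EuclideanSpace ℝ (Fin n)) ℂ,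
        eLpNorm (fun x : EuclideanSpace ℝ (Fin n) =>
            (((2 * Real.pi) ^ n : ℝ) : ℂ)⁻¹ *
            ∫ ξ in {ξ : EuclideanSpace ℝ (Fin n) | Pf ξ = lam},
              Complex.exp (Complex.I * (⟪x, ξ⟫ : ℂ)) * FT (⇑f) ξ *
                ((‖gradient Pf ξ‖⁻¹ : ℝ) : ℂ)
              ∂(Measure.hausdorffMeasure ((n : ℝ) - 1))) q volume ≤
          ENNReal.ofReal (C * lam ^
            (((n : ℝ)/(m : ℝ)) * ((1/p).toReal - (1/q).toReal) - 1)) *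
          eLpNorm (⇑f) p volume := by
  have hP : GoodP m Pf := goodP_of hn hm P hhom hPf hell hnd
  have hm0 : (0:ℝ) < m := by exact_mod_cast (by omega : 0 < m)
  obtain ⟨c, hc, hA⟩ := A_scale hP
  obtain ⟨D, hD0, hD⟩ := ER_bound hP p q hp hq hmin hdiff
  set b : ℝ := ((2 * Real.pi) ^ n)⁻¹ with hb
  have hb0 : 0 < b := by positivity
  refine ⟨b * c * (D + 1), by positivity, fun lam hlam f => ?_⟩
  set r := lam ^ (1/(m:ℝ)) with hr
  have hr0 : 0 < r := by positivity
  have hrm : r ^ m = lam := by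
    rw [hr, ← Real.rpow_natCast, ← Real.rpow_mul hlam.le, one_div_mul_cancel hm0.ne', Real.rpow_one]
  set g : EuclideanSpace ℝ (Fin n) → ℂ := fun x => (((r ^ n)⁻¹ : ℝ) : ℂ) * f (r⁻¹ • x) with hg
  have hgS : SS volume g := (SS_schwartz f).dil hr0 _
  have e1 : (fun x : EuclideanSpace ℝ (Fin n) =>
            (((2 * Real.pi) ^ n : ℝ) : ℂ)⁻¹ *
            ∫ ξ in {ξ : EuclideanSpace ℝ (Fin n) | Pf ξ = lam},
              Complex.exp (Complex.I * (⟪x, ξ⟫ : ℂ)) * FT (⇑f) ξ *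
                ((‖gradient Pf ξ‖⁻¹ : ℝ) : ℂ)
              ∂(Measure.hausdorffMeasure ((n : ℝ) - 1))) =
      ((b * (c * r ^ ((n:ℝ) - m)) : ℝ) : ℂ) • fun x => ER m Pf g (r • x) := by
    funext x
    rw [← hrm, hA r hr0, ← hg]
    simp only [Pi.smul_apply, smul_eq_mul, hb]
    push_cast
    ring
  have e2 : g = (((r ^ n)⁻¹ : ℝ) : ℂ) • fun x => f (r⁻¹ • x) := rfl
  have h1 := hD g hgS
  rw [e2, eLpNorm_const_smul, eLpNorm_dil _ p (inv_pos.2 hr0), ← e2] at h1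
  rw [e1, eLpNorm_const_smul, eLpNorm_dil _ q hr0]
  have n1 : ‖((b * (c * r ^ ((n:ℝ) - m)) : ℝ) : ℂ)‖ₑ = ENNReal.ofReal (b * (c * r ^ ((n:ℝ) - m))) := by
    rw [← ofReal_norm, Complex.norm_real, Real.norm_of_nonneg (by positivity)]
  have n2 : ‖(((r ^ n)⁻¹ : ℝ) : ℂ)‖ₑ = ENNReal.ofReal ((r ^ n)⁻¹) := by
    rw [← ofReal_norm, Complex.norm_real, Real.norm_of_nonneg (by positivity)]
  rw [n2] at h1
  rw [n1]
  set u := (1/p).toReal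
  set v := (1/q).toReal
  have hpow : r ^ ((n:ℝ) - m) * r ^ (-((n:ℝ) * v)) * ((r ^ n)⁻¹ * r⁻¹ ^ (-((n:ℝ) * u))) =
      lam ^ (((n : ℝ)/(m : ℝ)) * (u - v) - 1) := by
    rw [Real.inv_rpow hr0.le, ← Real.rpow_neg hr0.le, ← Real.rpow_natCast, ← Real.rpow_neg hr0.le,
      ← Real.rpow_add hr0, ← Real.rpow_add hr0, ← Real.rpow_add hr0, hr, ← Real.rpow_mul hlam.le]
    congr 1
    field_simp
    ring
  calc _ ≤ ENNReal.ofReal (b * (c * r ^ ((n:ℝ) - m))) * (ENNReal.ofReal (r ^ (-((n:ℝ) * v))) *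
        (ENNReal.ofReal D * (ENNReal.ofReal ((r ^ n)⁻¹) * (ENNReal.ofReal (r⁻¹ ^ (-((n:ℝ) * u))) * eLpNorm (⇑f) p volume)))) := by
        gcongr
    _ = ENNReal.ofReal (b * (c * r ^ ((n:ℝ) - m)) * (r ^ (-((n:ℝ) * v)) * (D * ((r ^ n)⁻¹ * r⁻¹ ^ (-((n:ℝ) * u)))))) *
        eLpNorm (⇑f) p volume := by
        rw [ENNReal.ofReal_mul (p := b * (c * r ^ ((n:ℝ) - m))) (by positivity),
          ENNReal.ofReal_mul (p := r ^ (-((n:ℝ) * v))) (by positivity), ENNReal.ofReal_mul hD0,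
          ENNReal.ofReal_mul (p := (r ^ n)⁻¹) (by positivity)]
        ring
    _ ≤ _ := by
        refine mul_le_mul_left (ENNReal.ofReal_le_ofReal ?_) _
        rw [← hpow]
        have : 0 ≤ b * c * (r ^ ((n:ℝ) - m) * r ^ (-((n:ℝ) * v)) * ((r ^ n)⁻¹ * r⁻¹ ^ (-((n:ℝ) * u)))) := by positivity
        nlinarith
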